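/- For each fixed integer r ≥ 3, almost all r-regular graphs are Hamiltonian. Precisely: for fixed r ≥ 3, the number of labeled r-regular simple graphs on vertex set {1,...,n} that contain a Hamiltonian cycle, divided by the total number of labeled r-regular simple graphs on vertex set {1,...,n}, tends to 1 as n tends to infinity along those n with rn even and n ≥ r+1. -/

import Mathlib

open Classical in
/-- The proportion, among labeled `r`-regular simple graphs on `Fin n`, of those satisfying `P`. -/
noncomputable def regularProportion (r n : ℕ) (P : SimpleGraph (Fin n) → Prop) : ℝ :=
  ((Finset.univ.filter
      (fun G : SimpleGraph (Fin n) => (∀ v, (G.neighborSet v).ncard = r) ∧ P G)).card : ℝ) /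
    ((Finset.univ.filter
      (fun G : SimpleGraph (Fin n) => ∀ v, (G.neighborSet v).ncard = r)).card : ℝ)

set_option linter.unusedSectionVars false
set_option linter.unusedVariables false

namespace RegHam

section
open Finset Function

section Involutions
variable {D : Type*} [Fintype D] [DecidableEq D]

/-- The set of points moved by `f`. -/
def mv (f : D → D) : Finset D := univ.filter fun x => f x ≠ x

@[simp] lemma mem_mv {f : D → D} {x : D} : x ∈ mv f ↔ f x ≠ x := by simp [mv]

/-- `f` is contained in `g` as a partial matching. -/
def Sub (f g : D → D) : Prop := ∀ x, f x ≠ x → g x = f x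

instance (f g : D → D) : Decidable (Sub f g) := by unfold Sub; infer_instance

/-- Involutions moving precisely the points of `S`, i.e. perfect matchings of `S`. -/
def invs (S : Finset D) : Finset (D → D) := univ.filter fun f => (∀ x, f (f x) = x) ∧ mv f = S

lemma mem_invs {S : Finset D} {f : D → D} : f ∈ invs S ↔ (∀ x, f (f x) = x) ∧ mv f = S := by
  simp [invs]

/-- `f` on `R`, the identity elsewhere. -/
def restr (f : D → D) (R : Finset D) : D → D := fun x => if x ∈ R then f x else x

lemma restr_invol {f : D → D} (hf : ∀ x, f (f x) = x) {R : Finset D} (hR : ∀ x ∈ R, f x ∈ R) :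
    ∀ x, restr f R (restr f R x) = x := by
  intro x
  by_cases h : x ∈ R
  · simp [restr, h, hR x h, hf]
  · simp [restr, h]

lemma mv_restr (f : D → D) (R : Finset D) : mv (restr f R) = mv f ∩ R := by
  ext x
  by_cases h : x ∈ R <;> simp [restr, h]

lemma mv_closed {f : D → D} (hf : ∀ x, f (f x) = x) {x : D} (hx : x ∈ mv f) : f x ∈ mv f := by
  simp only [mem_mv] at *
  intro h
  exact hx (by rw [hf] at h; exact h.symm)

/-- Matchings of `S` containing `f` correspond to matchings of `S \ mv f`. -/
lemma card_invs_sub {f : D → D} (hf : ∀ x, f (f x) = x) {S : Finset D} (hS : mv f ⊆ S) :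
    ((invs S).filter (Sub f)).card = (invs (S \ mv f)).card := by
  refine Finset.card_nbij' (fun M => restr M (mv f)ᶜ) (fun m x => if x ∈ mv f then f x else m x)
    ?_ ?_ ?_ ?_
  · intro M hM
    simp only [coe_filter, mem_invs, Set.mem_ofPred_eq, mem_coe] at hM ⊢
    obtain ⟨⟨h1, h2⟩, h3⟩ := hM
    refine ⟨restr_invol h1 ?_, ?_⟩
    · intro x hx
      rw [mem_compl] at hx ⊢
      intro hx'
      rw [mem_mv] at hx'
      apply hx
      have := mv_closed hf (mem_mv.2 hx')
      rw [← h3 _ hx', h1] at this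
      exact this
    · rw [mv_restr, h2]; ext x; simp
  · intro m hm
    simp only [coe_filter, mem_invs, Set.mem_ofPred_eq, mem_coe] at hm ⊢
    obtain ⟨h1, h2⟩ := hm
    have key : ∀ x, x ∉ mv f → m x ∉ mv f := by
      intro x hx
      by_cases hmx : m x = x
      · rwa [hmx]
      · have : x ∈ mv m := mem_mv.2 hmx
        have := mv_closed h1 this
        rw [h2] at this
        exact (mem_sdiff.1 this).2
    refine ⟨⟨?_, ?_⟩, ?_⟩
    · intro x
      by_cases hx : x ∈ mv f
      · simp only [hx, if_true, mv_closed hf hx, hf]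
      · simp only [hx, if_false, key x hx, h1]
    · ext x
      by_cases hx : x ∈ mv f
      · rw [mem_mv, if_pos hx]
        exact iff_of_true (mem_mv.1 hx) (hS hx)
      · have : x ∈ mv m ↔ x ∈ S \ mv f := by rw [h2]
        simp only [mem_sdiff, hx, not_false_eq_true, and_true] at this
        rw [← this, mem_mv, if_neg hx, mem_mv]
    · intro x hx
      exact if_pos (mem_mv.2 hx)
  · intro M hM
    simp only [coe_filter, mem_invs, Set.mem_ofPred_eq] at hM
    funext x
    by_cases hx : x ∈ mv f
    · simp only [hx, if_true]; exact (hM.2 x (mem_mv.1 hx)).symm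
    · simp only [hx, if_false, restr, mem_compl, not_false_eq_true, if_true]
  · intro m hm
    simp only [mem_invs, mem_coe] at hm
    funext x
    by_cases hx : x ∈ mv f
    · have : x ∉ mv m := by rw [hm.2]; simp only [mem_sdiff, hx, not_true, and_false, not_false_eq_true]
      simp only [mem_mv, not_not] at this
      simp only [restr, mem_compl, hx, not_true, if_false, this]
    · simp only [hx, if_false, restr, mem_compl, not_false_eq_true, if_true]

/-- The number of perfect matchings of a set of size `n`. -/
def dm : ℕ → ℕ
  | 0 => 1
  | 1 => 0
  | n + 2 => (n + 1) * dm n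

lemma swap_invol (p q : D) : ∀ x, Equiv.swap p q (Equiv.swap p q x) = x :=
  fun x => Equiv.swap_apply_self p q x

lemma mv_swap {p q : D} (h : p ≠ q) : mv (Equiv.swap p q) = {p, q} := by
  ext x
  simp only [mem_mv, mem_insert, mem_singleton]
  rcases eq_or_ne x p with rfl | hp
  · simp [h.symm]
  rcases eq_or_ne x q with rfl | hq
  · simp [h]
  · simp [Equiv.swap_apply_of_ne_of_ne hp hq, hp, hq]

lemma sub_swap {p q : D} (h : p ≠ q) {M : D → D} (hM : ∀ x, M (M x) = x) :
    Sub (Equiv.swap p q) M ↔ M p = q := by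
  constructor
  · intro hs
    have := hs p (by simpa using h.symm)
    simpa using this
  · rintro rfl x hx
    have : x ∈ mv (Equiv.swap p (M p)) := mem_mv.2 hx
    rw [mv_swap h] at this
    simp only [mem_insert, mem_singleton] at this
    rcases this with rfl | rfl
    · simp
    · simp [hM]

lemma card_invs (S : Finset D) : (invs S).card = dm S.card := by
  induction h : S.card using Nat.strong_induction_on generalizing S with
  | _ n ih =>
    rcases S.eq_empty_or_nonempty with rfl | ⟨p, hp⟩
    · simp only [card_empty] at h
      subst h
      rw [dm, card_eq_one]
      refine ⟨id, ?_⟩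
      ext f
      simp only [mem_invs, mem_singleton]
      constructor
      · rintro ⟨-, h⟩
        funext x
        have : x ∉ mv f := by simp [h]
        simpa using this
      · rintro rfl
        simp [mv]
    · have hpart : (invs S).card = ∑ q ∈ S.erase p, ((invs S).filter fun M => M p = q).card := by
        refine card_eq_sum_card_fiberwise ?_
        intro M hM
        simp only [mem_coe, mem_invs] at hM
        have h1 : p ∈ mv M := by rw [hM.2]; exact hp
        have h2 := mv_closed hM.1 h1
        rw [hM.2] at h2
        simp only [mem_coe, mem_erase]
        exact ⟨mem_mv.1 h1, h2⟩
      have hterm : ∀ q ∈ S.erase p, ((invs S).filter fun M => M p = q).card = dm (n - 2) := by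
        intro q hq
        rw [mem_erase] at hq
        have hc : (S \ {p, q}).card = n - 2 := by
          rw [card_sdiff_of_subset (by intro x; simp only [mem_insert, mem_singleton]; rintro (rfl | rfl); exacts [hp, hq.2]),
            card_pair hq.1.symm, h]
        have hn : 0 < n := by rw [← h]; exact card_pos.2 ⟨p, hp⟩
        rw [← ih (n - 2) (by omega) _ hc, ← mv_swap hq.1.symm, ← card_invs_sub (swap_invol p q)]
        · congr 1
          ext M
          simp only [mem_filter, mem_invs]
          constructor
          · rintro ⟨h1, h2⟩; exact ⟨h1, (sub_swap hq.1.symm h1.1).2 h2⟩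
          · rintro ⟨h1, h2⟩; exact ⟨h1, (sub_swap hq.1.symm h1.1).1 h2⟩
        · rw [mv_swap hq.1.symm]
          intro x; simp only [mem_insert, mem_singleton]; rintro (rfl | rfl); exacts [hp, hq.2]
      rw [hpart, sum_congr rfl hterm, sum_const, card_erase_of_mem hp, h]
      have hn : 0 < n := by rw [← h]; exact card_pos.2 ⟨p, hp⟩
      match n, hn with
      | 1, _ => simp [dm]
      | k + 2, _ => simp [dm]

end Involutions

end

section
open Finset Function

section Contraction
variable {D : Type*} [Fintype D] [DecidableEq D]

/-- `T` is closed under both `π` and `f`. -/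
def Cl (π f : D → D) (T : Finset D) : Prop := ∀ x ∈ T, π x ∈ T ∧ f x ∈ T

/-- The union of the matchings `π` and `m` is connected. -/
def Conn (π m : D → D) : Prop := ∀ T ⊆ mv π, T.Nonempty → Cl π m T → T = mv π

/-- The union of the matchings `π` and `f` has no alternating cycle. -/
def Acyc (π f : D → D) : Prop := ∀ T ⊆ mv f, Cl π f T → T = ∅

open scoped Classical in
/-- Matchings `m` of the support of `π` such that `π ∪ m` is a single alternating cycle. -/
noncomputable def sc (π : D → D) : Finset (D → D) := (invs (mv π)).filter (Conn π)

lemma mem_sc {π m : D → D} : m ∈ sc π ↔ ((∀ x, m (m x) = x) ∧ mv m = mv π) ∧ Conn π m := by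
  simp [sc, mem_invs]

/-- The matching obtained from `π` by contracting a new edge joining `p` and `q`. -/
def contr (π : D → D) (p q : D) : D → D := fun x =>
  if x = p ∨ x = q then x else if x = π p then π q else if x = π q then π p else π x

variable {π : D → D} {p q : D}

/-- Hypotheses under which contraction is used. -/
structure CData (π : D → D) (p q : D) : Prop where
  inv : ∀ x, π (π x) = x
  hp : π p ≠ p
  hq : π q ≠ q
  hpq : p ≠ q
  hqp : q ≠ π p

namespace CData
lemma contr_invol (h : CData π p q) (x : D) : contr π p q (contr π p q x) = x := by
  obtain ⟨h1, h2, h3, h4, h5⟩ := h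
  have e1 := h1 p
  have e2 := h1 q
  have e3 := h1 x
  unfold contr
  grind

lemma mv_contr (h : CData π p q) : mv (contr π p q) = mv π \ {p, q} := by
  obtain ⟨h1, h2, h3, h4, h5⟩ := h
  ext x
  have e1 := h1 p
  have e2 := h1 q
  have e3 := h1 x
  simp only [mem_mv, mem_sdiff, mem_insert, mem_singleton]
  unfold contr
  grind

lemma card_mv_contr (h : CData π p q) : (mv (contr π p q)).card + 2 = (mv π).card := by
  rw [h.mv_contr, ← card_pair h.hpq]
  apply card_sdiff_add_card_eq_card
  intro x; simp only [mem_insert, mem_singleton]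
  rintro (rfl | rfl)
  · exact mem_mv.2 h.hp
  · exact mem_mv.2 h.hq

lemma cl_down (h : CData π p q) {f : D → D} (hf : ∀ x, f (f x) = x) (hfp : f p = q) {T : Finset D}
    (hT : Cl π f T) : Cl (contr π p q) (restr f {p, q}ᶜ) (T \ {p, q}) := by
  have hfq : f q = p := by rw [← hfp, hf]
  obtain ⟨h1, h2, h3, h4, h5⟩ := h
  intro x hx
  have e1 := h1 p
  have e2 := h1 q
  have e3 := h1 x
  have e4 := hf x
  have t1 := hT x
  have t2 := hT p
  have t3 := hT q
  have t4 := hT (π x)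
  have t5 := hT (π p)
  have t6 := hT (π q)
  simp only [mem_sdiff, mem_insert, mem_singleton, contr, restr, mem_compl] at *
  constructor <;> grind

/-- Lift a set through a contraction. -/
def up (π : D → D) (p q : D) (T : Finset D) : Finset D := if π p ∈ T then T ∪ {p, q} else T

lemma mem_up {T : Finset D} {x : D} : x ∈ up π p q T ↔ x ∈ T ∨ (π p ∈ T ∧ (x = p ∨ x = q)) := by
  unfold up; split_ifs with h <;> simp [h] <;> tauto

lemma cl_up (h : CData π p q) {f : D → D} (hf : ∀ x, f (f x) = x) (hfp : f p = q) {T : Finset D}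
    (hT : Cl (contr π p q) (restr f {p, q}ᶜ) T) (hpT : p ∉ T) (hqT : q ∉ T) :
    Cl π f (up π p q T) := by
  have hfq : f q = p := by rw [← hfp, hf]
  obtain ⟨h1, h2, h3, h4, h5⟩ := h
  intro x hx
  have e1 := h1 p
  have e2 := h1 q
  have e3 := h1 x
  have e4 := hf x
  have t1 := hT x
  have t4 := hT (π x)
  have t5 := hT (π p)
  have t6 := hT (π q)
  simp only [mem_up, mem_insert, mem_singleton, contr, restr, mem_compl] at *
  constructor <;> grind

lemma conn_iff (h : CData π p q) {f : D → D} (hf : ∀ x, f (f x) = x) (hfp : f p = q) :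
    Conn π f ↔ Conn (contr π p q) (restr f {p, q}ᶜ) := by
  have hfq : f q = p := by rw [← hfp, hf]
  constructor
  · intro hc T hT hne hcl
    rw [h.mv_contr] at hT ⊢
    have hp : p ∉ T := fun hp => by simpa using hT hp
    have hq : q ∉ T := fun hp => by simpa using hT hp
    have := hc (up π p q T) ?_ ?_ (h.cl_up hf hfp hcl hp hq)
    · rw [← this]
      ext x
      simp only [mem_sdiff, mem_up, mem_insert, mem_singleton]
      constructor
      · intro hx
        refine ⟨Or.inl hx, ?_⟩
        rintro (rfl | rfl) <;> contradiction
      · tauto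
    · intro x hx
      rcases mem_up.1 hx with hx | ⟨-, rfl | rfl⟩
      · exact (mem_sdiff.1 (hT hx)).1
      · exact mem_mv.2 h.hp
      · exact mem_mv.2 h.hq
    · obtain ⟨x, hx⟩ := hne
      exact ⟨x, mem_up.2 (Or.inl hx)⟩
  · intro hc T hT hne hcl
    have hne' : (T \ {p, q}).Nonempty := by
      obtain ⟨x, hx⟩ := hne
      by_cases hxp : x ∈ ({p, q} : Finset D)
      · have hpT : p ∈ T := by
          simp only [mem_insert, mem_singleton] at hxp
          rcases hxp with rfl | rfl
          · exact hx
          · have := (hcl _ hx).2; rwa [hfq] at this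
        refine ⟨π p, ?_⟩
        simp only [mem_sdiff, mem_insert, mem_singleton, (hcl _ hpT).1, true_and, not_or]
        exact ⟨h.hp, h.hqp.symm⟩
      · exact ⟨x, mem_sdiff.2 ⟨hx, hxp⟩⟩
    have := hc (T \ {p, q}) ?_ hne' (h.cl_down hf hfp hcl)
    · rw [h.mv_contr] at this
      apply subset_antisymm hT
      have ha : π p ∈ T := by
        have : π p ∈ T \ {p, q} := by
          rw [this]
          simp only [mem_sdiff, mem_insert, mem_singleton, mem_mv, not_or, h.inv]
          exact ⟨h.hp.symm, h.hp, h.hqp.symm⟩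
        exact (mem_sdiff.1 this).1
      have hpT : p ∈ T := by have := (hcl _ ha).1; rwa [h.inv] at this
      have hqT : q ∈ T := by have := (hcl _ hpT).2; rwa [hfp] at this
      intro x hx
      by_cases hxp : x ∈ ({p, q} : Finset D)
      · simp only [mem_insert, mem_singleton] at hxp
        rcases hxp with rfl | rfl <;> assumption
      · have : x ∈ T \ {p, q} := by rw [this]; exact mem_sdiff.2 ⟨hx, hxp⟩
        exact (mem_sdiff.1 this).1
    · rw [h.mv_contr]
      exact sdiff_subset_sdiff hT subset_rfl

lemma acyc_iff (h : CData π p q) {f : D → D} (hf : ∀ x, f (f x) = x) (hfp : f p = q) :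
    Acyc π f ↔ Acyc (contr π p q) (restr f {p, q}ᶜ) := by
  have hfq : f q = p := by rw [← hfp, hf]
  constructor
  · intro hc T hT hcl
    rw [mv_restr] at hT
    have hp : p ∉ T := fun hp => by simpa using hT hp
    have hq : q ∉ T := fun hp => by simpa using hT hp
    have := hc (up π p q T) ?_ (h.cl_up hf hfp hcl hp hq)
    · rw [eq_empty_iff_forall_notMem] at this ⊢
      exact fun x hx => this x (mem_up.2 (Or.inl hx))
    · intro x hx
      rcases mem_up.1 hx with hx | ⟨-, rfl | rfl⟩
      · exact (mem_inter.1 (hT hx)).1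
      · rw [mem_mv, hfp]; exact h.hpq.symm
      · rw [mem_mv, hfq]; exact h.hpq
  · intro hc T hT hcl
    have := hc (T \ {p, q}) ?_ (h.cl_down hf hfp hcl)
    · rw [eq_empty_iff_forall_notMem] at this ⊢
      intro x hx
      have hsub : ∀ y ∈ T, y = p ∨ y = q := by
        intro y hy
        have := this y
        simp only [mem_sdiff, mem_insert, mem_singleton] at this
        tauto
      have hpT : p ∈ T := by
        rcases hsub x hx with rfl | rfl
        · exact hx
        · have := (hcl _ hx).2; rwa [hfq] at this
      rcases hsub _ (hcl _ hpT).1 with e | e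
      · exact h.hp e
      · exact h.hqp e.symm
    · rw [mv_restr]
      intro x hx
      rw [mem_sdiff] at hx
      exact mem_inter.2 ⟨hT hx.1, mem_compl.2 hx.2⟩

/-- Matchings containing a prescribed edge correspond to matchings of the contraction. -/
lemma card_sc_sub_contr (h : CData π p q) {f : D → D} (hf : ∀ x, f (f x) = x) (hfp : f p = q) :
    ((sc π).filter (Sub f)).card = ((sc (contr π p q)).filter (Sub (restr f {p, q}ᶜ))).card := by
  have hfq : f q = p := by rw [← hfp, hf]
  have hs1 : restr f {p, q}ᶜ p = p := by simp [restr]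
  have hs2 : restr f {p, q}ᶜ q = q := by simp [restr]
  have hbase : ((invs (mv π)).filter (Sub (Equiv.swap p q))).card
      = (invs (mv π \ mv (Equiv.swap p q))).card := by
    apply card_invs_sub (swap_invol p q)
    rw [mv_swap h.hpq]; intro x; simp only [mem_insert, mem_singleton]
    rintro (rfl | rfl)
    · exact mem_mv.2 h.hp
    · exact mem_mv.2 h.hq
  have hMp : ∀ M : D → D, Sub f M → (∀ x, M (M x) = x) → M p = q ∧ M q = p := by
    intro M hM hM'
    have : M p = q := by rw [hM p (by rw [hfp]; exact h.hpq.symm), hfp]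
    exact ⟨this, by rw [← this, hM']⟩
  refine Finset.card_nbij' (fun M => restr M {p, q}ᶜ)
    (fun m x => if x = p ∨ x = q then f x else m x) ?_ ?_ ?_ ?_
  · intro M hM
    simp only [coe_filter, mem_sc, Set.mem_ofPred_eq] at hM ⊢
    obtain ⟨⟨⟨h1, h2⟩, h3⟩, h4⟩ := hM
    obtain ⟨e1, e2⟩ := hMp M h4 h1
    refine ⟨⟨⟨restr_invol h1 ?_, ?_⟩, (h.conn_iff h1 e1).1 h3⟩, ?_⟩
    · intro x hx
      simp only [mem_compl, mem_insert, mem_singleton] at hx ⊢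
      have := h1 x
      grind
    · rw [mv_restr, h2, h.mv_contr]; ext x; simp
    · intro x hx
      have := h4 x
      simp only [restr] at hx ⊢
      split_ifs at hx ⊢ with hc
      · exact this hx
      · exact absurd rfl hx
  · intro m hm
    simp only [coe_filter, mem_sc, Set.mem_ofPred_eq] at hm ⊢
    obtain ⟨⟨⟨h1, h2⟩, h3⟩, h4⟩ := hm
    rw [h.mv_contr] at h2
    have hmp : m p = p := by
      by_contra hc
      have := mem_mv.2 hc
      rw [h2] at this; simp at this
    have hmq : m q = q := by
      by_contra hc
      have := mem_mv.2 hc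
      rw [h2] at this; simp at this
    set M : D → D := fun x => if x = p ∨ x = q then f x else m x with hM
    have hinv : ∀ x, M (M x) = x := by
      intro x
      have := h1 x
      have := hf x
      simp only [hM]
      grind
    have hMp : M p = q := by simp [hM, hfp]
    have hres : restr M {p, q}ᶜ = m := by
      funext x
      simp only [restr, hM, mem_compl, mem_insert, mem_singleton]
      grind
    refine ⟨⟨⟨hinv, ?_⟩, (h.conn_iff hinv hMp).2 (by rw [hres]; exact h3)⟩, ?_⟩
    · ext x
      by_cases hx : x = p ∨ x = q
      · rw [mem_mv, mem_mv]
        rcases hx with rfl | rfl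
        · simp only [hMp]; exact iff_of_true h.hpq.symm h.hp
        · have : M x = p := by simp [hM, hfq]
          rw [this]; exact iff_of_true h.hpq h.hq
      · have : x ∈ mv m ↔ x ∈ mv π \ {p, q} := by rw [h2]
        simp only [mem_sdiff, mem_insert, mem_singleton, hx, not_false_eq_true, and_true] at this
        rw [← this, mem_mv, mem_mv]
        simp only [hM, if_neg hx]
    · intro x hx
      by_cases hx' : x = p ∨ x = q
      · simp only [hM, if_pos hx']
      · simp only [hM, if_neg hx']
        have := h4 x
        simp only [restr, mem_compl, mem_insert, mem_singleton, hx', not_false_eq_true, if_true] at this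
        exact this hx
  · intro M hM
    simp only [coe_filter, mem_sc, Set.mem_ofPred_eq] at hM
    obtain ⟨⟨⟨h1, h2⟩, h3⟩, h4⟩ := hM
    obtain ⟨e1, e2⟩ := hMp M h4 h1
    funext x
    simp only [restr, mem_compl, mem_insert, mem_singleton]
    grind
  · intro m hm
    simp only [coe_filter, mem_sc, Set.mem_ofPred_eq] at hm
    obtain ⟨⟨⟨h1, h2⟩, h3⟩, h4⟩ := hm
    rw [h.mv_contr] at h2
    have hmp : m p = p := by
      by_contra hc
      have := mem_mv.2 hc
      rw [h2] at this; simp at this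
    have hmq : m q = q := by
      by_contra hc
      have := mem_mv.2 hc
      rw [h2] at this; simp at this
    funext x
    simp only [restr, mem_compl, mem_insert, mem_singleton]
    grind

end CData

/-- The number of matchings closing up `j` given edges to a single alternating cycle. -/
def cc (j : ℕ) : ℕ := 2 ^ (j - 1) * (j - 1).factorial

lemma mv_id : mv (id : D → D) = ∅ := by ext; simp

lemma sub_id (g : D → D) : Sub id g := fun _ hx => absurd rfl hx

lemma acyc_id (π : D → D) : Acyc π id := fun T hT _ => by
  rw [mv_id] at hT; exact subset_empty.1 hT

lemma mv_nonempty_swap {π f : D → D} (hπ : ∀ x, π (π x) = x) (hf : ∀ x, f (f x) = x)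
    {p : D} (hp : f p = π p) : Cl π f {p, π p} := by
  have : f (π p) = p := by rw [← hp, hf]
  intro x hx
  simp only [mem_insert, mem_singleton] at hx ⊢
  rcases hx with rfl | rfl
  · exact ⟨Or.inr rfl, Or.inr hp⟩
  · exact ⟨Or.inl (hπ _), Or.inl this⟩

lemma sc_filter_eq_empty {π f : D → D} (hπ : ∀ x, π (π x) = x) (hf : ∀ x, f (f x) = x)
    {p : D} (hp : f p = π p) (hpm : π p ≠ p) (hc : 2 < (mv π).card) :
    (sc π).filter (Sub f) = ∅ := by
  rw [eq_empty_iff_forall_notMem]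
  intro M hM
  simp only [mem_filter, mem_sc] at hM
  obtain ⟨⟨⟨h1, h2⟩, h3⟩, h4⟩ := hM
  have hMp : M p = π p := by rw [h4 p (by rw [hp]; exact hpm), hp]
  have := h3 {p, π p} ?_ ⟨p, by simp⟩ (mv_nonempty_swap hπ h1 hMp)
  · rw [← this] at hc
    exact absurd (card_le_two (a := p) (b := π p)) (by omega)
  · intro x
    simp only [mem_insert, mem_singleton]
    rintro (rfl | rfl)
    · exact mem_mv.2 hpm
    · exact mv_closed hπ (mem_mv.2 hpm)

open scoped Classical in
lemma card_sc_of_two {π : D → D} (hπ : ∀ x, π (π x) = x) (h : (mv π).card = 2) :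
    (sc π).card = 1 := by
  rw [sc, filter_true_of_mem, card_invs, h]
  · rfl
  · intro M hM T hT hne hcl
    apply eq_of_subset_of_card_le hT
    rw [h]
    obtain ⟨x, hx⟩ := hne
    exact one_lt_card.2 ⟨x, hx, π x, (hcl x hx).1, (mem_mv.1 (hT hx)).symm⟩

lemma cc_succ {j : ℕ} (hj : 1 ≤ j) : cc (j + 1) = 2 * j * cc j := by
  obtain ⟨k, rfl⟩ := Nat.exists_eq_add_of_le' hj
  simp only [cc, Nat.add_sub_cancel, Nat.factorial_succ, pow_succ]
  ring

lemma card_sc {j : ℕ} (hj : 1 ≤ j) : ∀ {π : D → D}, (∀ x, π (π x) = x) → (mv π).card = 2 * j →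
    (sc π).card = cc j := by
  induction j, hj using Nat.le_induction with
  | base => intro π hπ h; rw [card_sc_of_two hπ h]; rfl
  | succ j hj ih =>
    intro π hπ h
    obtain ⟨p, hp⟩ : (mv π).Nonempty := card_pos.1 (by omega)
    have hp' := mem_mv.1 hp
    have hpart : (sc π).card
        = ∑ q ∈ ((mv π).erase p).erase (π p), ((sc π).filter fun M => M p = q).card := by
      refine card_eq_sum_card_fiberwise ?_
      intro M hM
      rw [mem_coe, mem_sc] at hM
      have h1 : p ∈ mv M := by rw [hM.1.2]; exact hp
      have h2 := mv_closed hM.1.1 h1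
      rw [hM.1.2] at h2
      simp only [mem_coe, mem_erase]
      refine ⟨?_, mem_mv.1 h1, h2⟩
      intro hc
      have := sc_filter_eq_empty hπ hM.1.1 hc hp' (by omega)
      rw [eq_empty_iff_forall_notMem] at this
      exact this M (by rw [mem_filter, mem_sc]; exact ⟨hM, fun _ _ => rfl⟩)
    have hterm : ∀ q ∈ ((mv π).erase p).erase (π p),
        ((sc π).filter fun M => M p = q).card = cc j := by
      intro q hq
      simp only [mem_erase, mem_mv] at hq
      have hd : CData π p q := ⟨hπ, hp', hq.2.2, hq.2.1.symm, hq.1⟩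
      have hm := hd.card_mv_contr
      rw [← ih hd.contr_invol (by omega), show (sc π).filter (fun M => M p = q)
        = (sc π).filter (Sub (Equiv.swap p q)) from ?_,
        hd.card_sc_sub_contr (swap_invol p q) (by simp)]
      · rw [filter_true_of_mem]
        intro M _ x hx
        exfalso; apply hx
        simp only [restr, mem_compl, mem_insert, mem_singleton, ite_eq_right_iff, not_or]
        rintro ⟨h1, h2⟩
        exact Equiv.swap_apply_of_ne_of_ne h1 h2
      · ext M
        simp only [mem_filter, mem_sc]
        constructor
        · rintro ⟨h1, h2⟩; exact ⟨h1, (sub_swap hd.hpq h1.1.1).2 h2⟩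
        · rintro ⟨h1, h2⟩; exact ⟨h1, (sub_swap hd.hpq h1.1.1).1 h2⟩
    rw [hpart, sum_congr rfl hterm, sum_const, card_erase_of_mem, card_erase_of_mem hp, h, cc_succ hj]
    · simp; left; omega
    · exact mem_erase.2 ⟨hp', mv_closed hπ hp⟩

open scoped Classical in
/-- Single-cycle completions of a partial matching. -/
lemma card_sc_sub (h : ℕ) : ∀ {j : ℕ} {π f : D → D}, h < j → (∀ x, π (π x) = x) →
    (∀ x, f (f x) = x) → (mv π).card = 2 * j → mv f ⊆ mv π → (mv f).card = 2 * h →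
    ((sc π).filter (Sub f)).card = if Acyc π f then cc (j - h) else 0 := by
  induction h with
  | zero =>
    intro j π f hj hπ hf hc hs h0
    have : f = id := by
      funext x
      by_contra hx
      have : x ∈ mv f := mem_mv.2 hx
      rw [card_eq_zero.1 (by omega : (mv f).card = 0)] at this
      simp at this
    subst this
    rw [if_pos (acyc_id π), filter_true_of_mem (fun M _ => sub_id M), card_sc hj hπ hc, Nat.sub_zero]
  | succ h ih =>
    intro j π f hj hπ hf hc hs hh
    obtain ⟨p, hp⟩ : (mv f).Nonempty := card_pos.1 (by omega)
    have hp' := mem_mv.1 hp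
    have hpπ := mem_mv.1 (hs hp)
    have hqπ := mem_mv.1 (hs (mv_closed hf hp))
    by_cases hpq : f p = π p
    · rw [sc_filter_eq_empty hπ hf hpq hpπ (by omega), if_neg, card_empty]
      intro hac
      have := hac {p, π p} ?_ (mv_nonempty_swap hπ hf hpq)
      · simp at this
      · intro x
        simp only [mem_insert, mem_singleton]
        rintro (rfl | rfl)
        · exact hp
        · rw [← hpq]; exact mv_closed hf hp
    · have hd : CData π p (f p) := ⟨hπ, hpπ, hqπ, hp'.symm, hpq⟩
      have hm := hd.card_mv_contr
      have hmr : mv (restr f {p, f p}ᶜ) = mv f \ {p, f p} := by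
        rw [mv_restr]; ext x; simp
      rw [hd.card_sc_sub_contr hf rfl, ih (j := j - 1) (by omega) hd.contr_invol (restr_invol hf ?_)
        (by omega) ?_ ?_]
      · simp only [hd.acyc_iff hf rfl]
        congr 2; omega
      · intro x hx
        simp only [mem_compl, mem_insert, mem_singleton] at hx ⊢
        have := hf x
        have := hf p
        grind
      · rw [hmr, hd.mv_contr]; exact sdiff_subset_sdiff hs subset_rfl
      · rw [hmr, card_sdiff_of_subset, card_pair hp'.symm, hh]
        · omega
        · intro x
          simp only [mem_insert, mem_singleton]
          rintro (rfl | rfl)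
          · exact hp
          · exact mv_closed hf hp

end Contraction

end

section
open Finset Function

section Fibres
variable {V : Type*} [Fintype V] [DecidableEq V] {r : ℕ}

/-- The points of `S` above the vertex `v`. -/
def slice (S : Finset (V × Fin r)) (v : V) : Finset (Fin r) := univ.filter fun i => (v, i) ∈ S

@[simp] lemma mem_slice {S : Finset (V × Fin r)} {v : V} {i : Fin r} :
    i ∈ slice S v ↔ (v, i) ∈ S := by simp [slice]

lemma slice_mono {S T : Finset (V × Fin r)} (h : S ⊆ T) (v : V) : slice S v ⊆ slice T v := by
  intro i; simp only [mem_slice]; exact fun hi => h hi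

lemma slice_ext {S T : Finset (V × Fin r)} (h : ∀ v, slice S v = slice T v) : S = T := by
  ext ⟨v, i⟩
  rw [← mem_slice, h, mem_slice]

lemma slice_inter (S T : Finset (V × Fin r)) (v : V) : slice (S ∩ T) v = slice S v ∩ slice T v := by
  ext i; simp

/-- The set of points with prescribed slices. -/
def ofSlices (σ : V → Finset (Fin r)) : Finset (V × Fin r) := univ.filter fun x => x.2 ∈ σ x.1

@[simp] lemma slice_ofSlices (σ : V → Finset (Fin r)) (v : V) : slice (ofSlices σ) v = σ v := by
  ext i; simp [ofSlices]

lemma card_eq_sum_slice (S : Finset (V × Fin r)) : S.card = ∑ v, (slice S v).card := by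
  rw [card_eq_sum_card_fiberwise (f := Prod.fst) (t := univ) (fun _ _ => mem_coe.2 (mem_univ _))]
  refine sum_congr rfl fun v _ => ?_
  refine card_nbij' Prod.snd (fun i => (v, i)) ?_ ?_ ?_ ?_
  · rintro ⟨w, i⟩ h; simp only [coe_filter, Set.mem_ofPred_eq] at h; obtain ⟨h, rfl⟩ := h
    simpa using h
  · intro i h; simpa using h
  · rintro ⟨w, i⟩ h; simp only [coe_filter, Set.mem_ofPred_eq] at h; obtain ⟨h, rfl⟩ := h; rfl
  · intro i h; rfl

/-- Sets with slices in prescribed families. -/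
lemma card_slices (F : V → Finset (Finset (Fin r))) :
    (univ.filter fun S : Finset (V × Fin r) => ∀ v, slice S v ∈ F v).card = ∏ v, (F v).card := by
  rw [← Fintype.card_piFinset]
  refine card_nbij' (fun S => slice S) (fun σ => ofSlices σ) ?_ ?_ ?_ ?_
  · intro S h; simpa using h
  · intro S h; simpa using h
  · intro S h; exact slice_ext fun v => by simp
  · intro S h; funext v; simp

/-- Every vertex has no or two points in `S`. -/
def TwoFib (S : Finset (V × Fin r)) : Prop := ∀ v, (slice S v).card = 0 ∨ (slice S v).card = 2

/-- Every vertex has two points in `S`. -/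
def FullTwo (S : Finset (V × Fin r)) : Prop := ∀ v, (slice S v).card = 2

lemma FullTwo.two {S : Finset (V × Fin r)} (h : FullTwo S) : TwoFib S := fun v => Or.inr (h v)

lemma FullTwo.card {S : Finset (V × Fin r)} (h : FullTwo S) : S.card = 2 * Fintype.card V := by
  rw [card_eq_sum_slice, sum_congr rfl fun v _ => h v]; simp [mul_comm]

open scoped Classical in
/-- The other point of `S` in the same fibre. -/
noncomputable def other (S : Finset (V × Fin r)) (x : V × Fin r) : V × Fin r :=
  if h : x ∈ S ∧ ∃ y ∈ S, y ≠ x ∧ y.1 = x.1 then h.2.choose else x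

lemma TwoFib.exists {S : Finset (V × Fin r)} (h : TwoFib S) {x : V × Fin r} (hx : x ∈ S) :
    ∃ y ∈ S, y ≠ x ∧ y.1 = x.1 := by
  have : (slice S x.1).card = 2 := by
    rcases h x.1 with h | h
    · rw [card_eq_zero, eq_empty_iff_forall_notMem] at h
      exact absurd (mem_slice.2 hx) (h x.2)
    · exact h
  obtain ⟨j, hj, hne⟩ := exists_mem_ne (by omega : 1 < (slice S x.1).card) x.2
  exact ⟨(x.1, j), mem_slice.1 hj, fun e => hne (by rw [← e]), rfl⟩

lemma TwoFib.unique {S : Finset (V × Fin r)} (h : TwoFib S) {x y z : V × Fin r} (hx : x ∈ S)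
    (hy : y ∈ S) (hz : z ∈ S) (hyx : y.1 = x.1) (hzx : z.1 = x.1) (h1 : y ≠ x) (h2 : z ≠ x) :
    y = z := by
  by_contra h3
  have : 2 < (slice S x.1).card := by
    rw [two_lt_card]
    refine ⟨x.2, mem_slice.2 hx, y.2, mem_slice.2 (hyx ▸ hy), z.2, mem_slice.2 (hzx ▸ hz), ?_, ?_, ?_⟩
    · exact fun e => h1 (Prod.ext hyx e.symm)
    · exact fun e => h2 (Prod.ext hzx e.symm)
    · exact fun e => h3 (Prod.ext (hyx.trans hzx.symm) e)
  rcases h x.1 with h | h <;> omega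

lemma other_of_notMem {S : Finset (V × Fin r)} {x : V × Fin r} (hx : x ∉ S) : other S x = x := by
  rw [other, dif_neg]; tauto

lemma TwoFib.other_spec {S : Finset (V × Fin r)} (h : TwoFib S) {x : V × Fin r} (hx : x ∈ S) :
    other S x ∈ S ∧ other S x ≠ x ∧ (other S x).1 = x.1 := by
  have hh : x ∈ S ∧ ∃ y ∈ S, y ≠ x ∧ y.1 = x.1 := ⟨hx, h.exists hx⟩
  rw [other, dif_pos hh]
  exact hh.2.choose_spec

lemma other_fst {S : Finset (V × Fin r)} (h : TwoFib S) (x : V × Fin r) : (other S x).1 = x.1 := by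
  by_cases hx : x ∈ S
  · exact (h.other_spec hx).2.2
  · rw [other_of_notMem hx]

lemma TwoFib.other_eq {S : Finset (V × Fin r)} (h : TwoFib S) {x y : V × Fin r} (hx : x ∈ S)
    (hy : y ∈ S) (hyx : y.1 = x.1) (hne : y ≠ x) : other S x = y :=
  have := h.other_spec hx
  h.unique hx this.1 hy this.2.2 hyx this.2.1 hne

lemma TwoFib.other_invol {S : Finset (V × Fin r)} (h : TwoFib S) (x : V × Fin r) :
    other S (other S x) = x := by
  by_cases hx : x ∈ S
  · obtain ⟨h1, h2, h3⟩ := h.other_spec hx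
    exact h.other_eq h1 hx h3.symm h2.symm
  · rw [other_of_notMem hx, other_of_notMem hx]

lemma TwoFib.mv_other {S : Finset (V × Fin r)} (h : TwoFib S) : mv (other S) = S := by
  ext x
  rw [mem_mv]
  by_cases hx : x ∈ S
  · exact iff_of_true (h.other_spec hx).2.1 hx
  · exact iff_of_false (by rw [other_of_notMem hx]; simp) hx

/-- `c` is a cycle of the pairing model. -/
structure IsCyc (c : V × Fin r → V × Fin r) : Prop where
  inv : ∀ x, c (c x) = x
  ne : (mv c).Nonempty
  two : TwoFib (mv c)
  conn : Conn (other (mv c)) c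

/-- The vertices touched by `c`. -/
def tch (c : V × Fin r → V × Fin r) : Finset V := (mv c).image Prod.fst

lemma mem_tch {c : V × Fin r → V × Fin r} {v : V} : v ∈ tch c ↔ (slice (mv c) v).card ≠ 0 := by
  rw [tch, mem_image, Finset.card_ne_zero]
  constructor
  · rintro ⟨x, hx, rfl⟩; exact ⟨x.2, mem_slice.2 hx⟩
  · rintro ⟨i, hi⟩; exact ⟨(v, i), mem_slice.1 hi, rfl⟩

lemma card_of_twoFib {c : V × Fin r → V × Fin r} (h : TwoFib (mv c)) :
    (mv c).card = 2 * (tch c).card := by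
  rw [card_eq_sum_slice, ← sum_subset (subset_univ (tch c)), sum_congr rfl (g := fun _ => 2)]
  · simp [mul_comm]
  · intro v hv
    rw [mem_tch] at hv
    exact (h v).resolve_left hv
  · intro v _ hv
    by_contra hc
    exact hv (mem_tch.2 hc)

lemma IsCyc.mem_sc {c : V × Fin r → V × Fin r} (h : IsCyc c) : c ∈ sc (other (mv c)) :=
  RegHam.mem_sc.2 ⟨⟨h.inv, by rw [h.two.mv_other]⟩, h.conn⟩

lemma isCyc_of_mem_sc {S : Finset (V × Fin r)} (hS : TwoFib S) (hne : S.Nonempty)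
    {c : V × Fin r → V × Fin r} (h : c ∈ sc (other S)) : IsCyc c ∧ mv c = S := by
  rw [RegHam.mem_sc, hS.mv_other] at h
  obtain ⟨⟨h1, h2⟩, h3⟩ := h
  exact ⟨⟨h1, h2 ▸ hne, h2 ▸ hS, h2 ▸ h3⟩, h2⟩

open scoped Classical in
/-- Cycles of length `k`. -/
noncomputable def cyc (V : Type*) [Fintype V] [DecidableEq V] (r k : ℕ) :
    Finset (V × Fin r → V × Fin r) :=
  univ.filter fun c => IsCyc c ∧ (tch c).card = k

lemma mem_cyc {k : ℕ} {c : V × Fin r → V × Fin r} : c ∈ cyc V r k ↔ IsCyc c ∧ (tch c).card = k := by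
  simp [cyc]

open scoped Classical in
lemma card_twoFib (k : ℕ) : (univ.filter fun S : Finset (V × Fin r) =>
    TwoFib S ∧ S.card = 2 * k).card = (Fintype.card V).choose k * r.choose 2 ^ k := by
  have hpart := card_eq_sum_card_fiberwise (s := univ.filter fun S : Finset (V × Fin r) =>
    TwoFib S ∧ S.card = 2 * k) (f := fun S => S.image Prod.fst) (t := powersetCard k univ) ?_
  · rw [hpart, sum_congr rfl (g := fun _ => r.choose 2 ^ k)]
    · simp
    · intro B hB
      rw [mem_powersetCard_univ] at hB
      have := card_slices (V := V) (r := r)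
        (fun v => if v ∈ B then powersetCard 2 univ else {∅})
      rw [prod_congr rfl (g := fun v => if v ∈ B then r.choose 2 else 1)] at this
      · rw [prod_ite_mem, univ_inter, prod_const, hB] at this
        rw [← this]
        congr 1
        ext S
        simp only [mem_filter, mem_univ, true_and]
        have him : ∀ v, v ∈ S.image Prod.fst ↔ (slice S v).card ≠ 0 := by
          intro v
          rw [mem_image, Finset.card_ne_zero]
          constructor
          · rintro ⟨x, hx, rfl⟩; exact ⟨x.2, mem_slice.2 hx⟩
          · rintro ⟨i, hi⟩; exact ⟨(v, i), mem_slice.1 hi, rfl⟩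
        constructor
        · rintro ⟨⟨h1, h2⟩, rfl⟩ v
          split_ifs with hv
          · rw [mem_powersetCard_univ]
            exact (h1 v).resolve_left ((him v).1 hv)
          · rw [him, not_not, card_eq_zero] at hv
            simp [hv]
        · intro h
          have hc : ∀ v, (slice S v).card = if v ∈ B then 2 else 0 := by
            intro v
            have := h v
            split_ifs at this ⊢ with hv
            · exact mem_powersetCard_univ.1 this
            · rw [mem_singleton.1 this]; rfl
          refine ⟨⟨fun v => ?_, ?_⟩, ?_⟩
          · rw [hc]; split_ifs <;> simp
          · rw [card_eq_sum_slice, sum_congr rfl fun v _ => hc v]; simp [hB, mul_comm]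
          · ext v; rw [him, hc]; split_ifs with hv <;> simp [hv]
      · intro v _; split_ifs <;> simp
  · intro S hS
    simp only [coe_filter, mem_univ, true_and, Set.mem_ofPred_eq] at hS
    rw [mem_coe, mem_powersetCard_univ]
    have := card_eq_sum_card_fiberwise (s := S) (f := Prod.fst) (t := S.image Prod.fst)
      (fun x hx => mem_coe.2 (mem_image_of_mem _ hx))
    rw [hS.2, sum_congr rfl (g := fun _ => 2)] at this
    · simp at this
      show (S.image Prod.fst).card = k
      omega
    · intro v hv
      rw [mem_image] at hv
      obtain ⟨x, hx, rfl⟩ := hv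
      have h2 : (slice S x.1).card = 2 := by
        refine (hS.1 x.1).resolve_left ?_
        rw [← ne_eq, Finset.card_ne_zero]; exact ⟨x.2, mem_slice.2 hx⟩
      rw [← h2]
      refine card_nbij' Prod.snd (fun i => (x.1, i)) ?_ ?_ ?_ ?_
      · rintro ⟨w, i⟩ h; simp only [coe_filter, Set.mem_ofPred_eq] at h; obtain ⟨h, rfl⟩ := h
        simpa using h
      · intro i h; simpa using h
      · rintro ⟨w, i⟩ h; simp only [coe_filter, Set.mem_ofPred_eq] at h; obtain ⟨h, rfl⟩ := h; rfl
      · intro i h; rfl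

/-- The number of cycles of length `k`. -/
lemma card_cyc {k : ℕ} (hk : 1 ≤ k) :
    (cyc V r k).card = (Fintype.card V).choose k * r.choose 2 ^ k * cc k := by
  classical
  have hpart := card_eq_sum_card_fiberwise (s := cyc V r k) (f := mv)
    (t := univ.filter fun S : Finset (V × Fin r) => TwoFib S ∧ S.card = 2 * k) ?_
  · rw [hpart, sum_congr rfl (g := fun _ => cc k), sum_const, card_twoFib, smul_eq_mul]
    intro S hS
    simp only [mem_filter, mem_univ, true_and] at hS
    rw [← card_sc hk hS.1.other_invol (by rw [hS.1.mv_other, hS.2])]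
    congr 1
    ext c
    rw [mem_filter, mem_cyc]
    constructor
    · rintro ⟨⟨h1, h2⟩, rfl⟩; exact h1.mem_sc
    · intro h
      obtain ⟨h1, h2⟩ := isCyc_of_mem_sc hS.1 (card_pos.1 (by omega)) h
      refine ⟨⟨h1, ?_⟩, h2⟩
      have := card_of_twoFib h1.two
      rw [h2] at this; omega
  · intro c hc
    rw [mem_coe, mem_cyc] at hc
    simp only [coe_filter, mem_univ, true_and, Set.mem_ofPred_eq]
    exact ⟨hc.1.two, by rw [card_of_twoFib hc.1.two, hc.2]⟩

end Fibres

end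

section
open Finset Function

lemma dm_odd (n : ℕ) : dm (2 * n + 1) = 0 := by
  induction n with
  | zero => rfl
  | succ n ih => rw [show 2 * (n + 1) + 1 = (2 * n + 1) + 2 by ring, dm, ih, mul_zero]

lemma even_card_mv {D : Type*} [Fintype D] [DecidableEq D] {f : D → D} (hf : ∀ x, f (f x) = x) :
    Even (mv f).card := by
  by_contra h
  obtain ⟨k, hk⟩ := Nat.not_even_iff_odd.1 h
  have := card_invs (mv f)
  rw [hk, dm_odd, card_eq_zero] at this
  have h2 : f ∈ invs (mv f) := mem_invs.2 ⟨hf, rfl⟩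
  rw [this] at h2; simp at h2

lemma card_pairs_inter {r : ℕ} {A B : Finset (Fin r)} (h : B ⊆ A) (hB : B.card ≤ 2) :
    (univ.filter fun σ : Finset (Fin r) => σ.card = 2 ∧ σ ∩ A = B).card
      = (r - A.card).choose (2 - B.card) := by
  have : r - A.card = (Aᶜ).card := by rw [card_compl, Fintype.card_fin]
  rw [this, ← card_powersetCard]
  refine card_nbij' (fun σ => σ \ A) (fun τ => τ ∪ B) ?_ ?_ ?_ ?_
  · intro σ hσ
    simp only [coe_filter, mem_univ, true_and, Set.mem_ofPred_eq] at hσ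
    simp only [mem_coe, mem_powersetCard]
    refine ⟨fun x hx => mem_compl.2 (mem_sdiff.1 hx).2, ?_⟩
    have := card_sdiff_add_card_inter σ A
    rw [hσ.1, hσ.2] at this; omega
  · intro τ hτ
    simp only [mem_coe, mem_powersetCard] at hτ
    simp only [coe_filter, mem_univ, true_and, Set.mem_ofPred_eq]
    have hd : Disjoint τ A := by
      rw [Finset.disjoint_left]; exact fun x hx => mem_compl.1 (hτ.1 hx)
    refine ⟨?_, ?_⟩
    · rw [card_union_of_disjoint (disjoint_of_subset_right h hd), hτ.2]; omega
    · rw [union_inter_distrib_right, inter_eq_left.2 h, disjoint_iff_inter_eq_empty.1 hd,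
        empty_union]
  · intro σ hσ
    simp only [coe_filter, mem_univ, true_and, Set.mem_ofPred_eq] at hσ
    show σ \ A ∪ B = σ
    rw [← hσ.2, sdiff_union_inter]
  · intro τ hτ
    simp only [mem_coe, mem_powersetCard] at hτ
    have hd : ∀ x ∈ τ, x ∉ A := fun x hx => mem_compl.1 (hτ.1 hx)
    show (τ ∪ B) \ A = τ
    ext x
    simp only [mem_sdiff, mem_union]
    have := hd x
    have := @h x
    tauto

section HamCount
variable {V : Type*} [Fintype V] [DecidableEq V] {r : ℕ}

/-- Hamilton cycles of the pairing model. -/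
noncomputable def ham (V : Type*) [Fintype V] [DecidableEq V] (r : ℕ) :
    Finset (V × Fin r → V × Fin r) := cyc V r (Fintype.card V)

lemma mem_ham {c : V × Fin r → V × Fin r} : c ∈ ham V r ↔ IsCyc c ∧ FullTwo (mv c) := by
  rw [ham, mem_cyc]
  refine and_congr_right fun h => ?_
  rw [Finset.card_eq_iff_eq_univ, eq_univ_iff_forall]
  refine forall_congr' fun v => ?_
  rw [mem_tch]
  have := h.two v
  omega

/-- Unions of edges of `g`, as sets of points. -/
def subs (g : V × Fin r → V × Fin r) : Finset (Finset (V × Fin r)) :=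
  (mv g).powerset.filter fun R => ∀ x ∈ R, g x ∈ R

lemma mem_subs {g : V × Fin r → V × Fin r} {R : Finset (V × Fin r)} :
    R ∈ subs g ↔ R ⊆ mv g ∧ ∀ x ∈ R, g x ∈ R := by simp [subs]

open scoped Classical in
/-- Hamilton cycles meeting `g` precisely in the edges on `R`. -/
noncomputable def hs (g : V × Fin r → V × Fin r) (R : Finset (V × Fin r)) :
    Finset (V × Fin r → V × Fin r) :=
  (ham V r).filter fun h => mv h ∩ mv g = R ∧ Sub (restr g R) h

/-- The edges of `g` on `R` do not close up a cycle of touched vertices. -/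
def AcycF (g : V × Fin r → V × Fin r) (R : Finset (V × Fin r)) : Prop :=
  ∀ T ⊆ R, (∀ x ∈ T, g x ∈ T) → (∀ x ∈ T, ∃ y ∈ T, y ≠ x ∧ y.1 = x.1) → T = ∅

lemma mv_restr_of_subs {g : V × Fin r → V × Fin r} {R : Finset (V × Fin r)} (hR : R ∈ subs g) :
    mv (restr g R) = R := by
  rw [mv_restr]; exact inter_eq_right.2 (mem_subs.1 hR).1

lemma acyc_other_iff {g : V × Fin r → V × Fin r} {R S : Finset (V × Fin r)} (hR : R ∈ subs g)
    (hS : TwoFib S) (hRS : R ⊆ S) : Acyc (other S) (restr g R) ↔ AcycF g R := by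
  unfold Acyc AcycF
  rw [mv_restr_of_subs hR]
  refine forall_congr' fun T => forall_congr' fun hT => ?_
  rw [← and_imp]
  refine imp_congr ?_ Iff.rfl
  constructor
  · intro h
    refine ⟨fun x hx => ?_, fun x hx => ?_⟩
    · have := (h x hx).2
      rwa [restr, if_pos (hT hx)] at this
    · have h1 := (h x hx).1
      have h2 := hS.other_spec (hRS (hT hx))
      exact ⟨_, h1, h2.2⟩
  · rintro ⟨h1, h2⟩ x hx
    obtain ⟨y, hy, hyx, hf⟩ := h2 x hx
    refine ⟨?_, ?_⟩
    · rwa [hS.other_eq (hRS (hT hx)) (hRS (hT hy)) hf hyx]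
    · rw [restr, if_pos (hT hx)]; exact h1 x hx

open scoped Classical in
/-- The possible supports of the Hamilton cycles in `hs g R`. -/
noncomputable def supps (g : V × Fin r → V × Fin r) (R : Finset (V × Fin r)) :
    Finset (Finset (V × Fin r)) :=
  univ.filter fun S => ∀ v, slice S v ∈ univ.filter fun σ : Finset (Fin r) =>
    σ.card = 2 ∧ σ ∩ slice (mv g) v = slice R v

lemma mem_supps {g : V × Fin r → V × Fin r} {R S : Finset (V × Fin r)} :
    S ∈ supps g R ↔ FullTwo S ∧ S ∩ mv g = R := by
  simp only [supps, mem_filter, mem_univ, true_and, FullTwo, forall_and, and_congr_right_iff]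
  intro _
  constructor
  · intro h; exact slice_ext fun v => by rw [slice_inter, h]
  · rintro rfl v; rw [slice_inter]

lemma card_supps {g : V × Fin r → V × Fin r} {R : Finset (V × Fin r)} (hR : R ⊆ mv g)
    (h2 : ∀ v, (slice R v).card ≤ 2) :
    (supps g R).card = ∏ v, (r - (slice (mv g) v).card).choose (2 - (slice R v).card) := by
  rw [supps, card_slices]
  exact prod_congr rfl fun v _ => card_pairs_inter (slice_mono hR v) (h2 v)

lemma card_supps_le (g : V × Fin r → V × Fin r) (R : Finset (V × Fin r)) :
    (supps g R).card ≤ r.choose 2 ^ Fintype.card V := by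
  rw [supps, card_slices, ← card_univ, ← prod_const]
  refine prod_le_prod' fun v _ => ?_
  have : r.choose 2 = (powersetCard 2 (univ : Finset (Fin r))).card := by simp
  rw [this]
  refine card_le_card fun σ => ?_
  simp only [mem_filter, mem_univ, true_and, mem_powersetCard_univ]
  exact fun h => h.1

open scoped Classical in
lemma card_hs_eq_sum [Nonempty V] (g : V × Fin r → V × Fin r) (R : Finset (V × Fin r)) :
    (hs g R).card = ∑ S ∈ supps g R, ((sc (other S)).filter (Sub (restr g R))).card := by
  rw [card_eq_sum_card_fiberwise (f := mv) (t := supps g R)]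
  · refine sum_congr rfl fun S hS => ?_
    rw [mem_supps] at hS
    congr 1
    ext h
    simp only [hs, mem_filter, mem_ham]
    constructor
    · rintro ⟨⟨⟨h1, h2⟩, h3, h4⟩, rfl⟩
      exact ⟨h1.mem_sc, h4⟩
    · rintro ⟨h1, h2⟩
      have hne : S.Nonempty := by
        rw [← card_pos, hS.1.card]; have := Fintype.card_pos (α := V); omega
      obtain ⟨h3, h4⟩ := isCyc_of_mem_sc hS.1.two hne h1
      exact ⟨⟨⟨h3, h4 ▸ hS.1⟩, h4 ▸ hS.2, h2⟩, h4⟩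
  · intro h hh
    simp only [hs, coe_filter, mem_ham, Set.mem_ofPred_eq] at hh
    rw [mem_coe, mem_supps]
    exact ⟨hh.1.2, hh.2.1⟩

lemma card_subs_even {g : V × Fin r → V × Fin r} (hg : ∀ x, g (g x) = x)
    {R : Finset (V × Fin r)} (hR : R ∈ subs g) : R.card = 2 * (R.card / 2) := by
  have := even_card_mv (restr_invol hg (mem_subs.1 hR).2)
  rw [mv_restr_of_subs hR] at this
  obtain ⟨k, hk⟩ := this; omega

open scoped Classical in
lemma card_hs [Nonempty V] {g : V × Fin r → V × Fin r} (hg : ∀ x, g (g x) = x)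
    {R : Finset (V × Fin r)} (hR : R ∈ subs g) (h2 : ∀ v, (slice R v).card ≤ 2)
    (hlt : R.card < 2 * Fintype.card V) :
    (hs g R).card = (∏ v, (r - (slice (mv g) v).card).choose (2 - (slice R v).card)) *
      if AcycF g R then cc (Fintype.card V - R.card / 2) else 0 := by
  have he := card_subs_even hg hR
  rw [card_hs_eq_sum, ← card_supps (mem_subs.1 hR).1 h2, ← smul_eq_mul, ← sum_const]
  refine sum_congr rfl fun S hS => ?_
  rw [mem_supps] at hS
  have hRS : R ⊆ S := by rw [← hS.2]; exact inter_subset_left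
  rw [card_sc_sub (R.card / 2) (j := Fintype.card V) (by omega) hS.1.two.other_invol
    (restr_invol hg (mem_subs.1 hR).2) (by rw [hS.1.two.mv_other, hS.1.card])
    (by rwa [hS.1.two.mv_other, mv_restr_of_subs hR]) (by rw [mv_restr_of_subs hR, ← he])]
  simp only [acyc_other_iff hR hS.1.two hRS]

lemma card_hs_le [Nonempty V] {g : V × Fin r → V × Fin r} (hg : ∀ x, g (g x) = x)
    {R : Finset (V × Fin r)} (hR : R ∈ subs g) :
    (hs g R).card ≤ r.choose 2 ^ Fintype.card V * cc (Fintype.card V - R.card / 2) := by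
  classical
  have he := card_subs_even hg hR
  rw [card_hs_eq_sum]
  refine le_trans ?_ (Nat.mul_le_mul_right _ (card_supps_le g R))
  rw [← smul_eq_mul, ← sum_const]
  refine sum_le_sum fun S hS => ?_
  rw [mem_supps] at hS
  have hRS : R ⊆ S := by rw [← hS.2]; exact inter_subset_left
  have hle := card_le_card hRS
  rw [hS.1.card] at hle
  rcases hle.lt_or_eq with hlt | heq
  · rw [card_sc_sub (R.card / 2) (j := Fintype.card V) (by omega) hS.1.two.other_invol
      (restr_invol hg (mem_subs.1 hR).2) (by rw [hS.1.two.mv_other, hS.1.card])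
      (by rwa [hS.1.two.mv_other, mv_restr_of_subs hR]) (by rw [mv_restr_of_subs hR, ← he])]
    split_ifs <;> simp
  · have hRS' : R = S := eq_of_subset_of_card_le hRS (by rw [heq, hS.1.card])
    have : cc (Fintype.card V - R.card / 2) = 1 := by
      rw [heq, Nat.mul_div_cancel_left _ two_pos, Nat.sub_self]; rfl
    rw [this, card_le_one]
    have key : ∀ m ∈ (sc (other S)).filter (Sub (restr g R)), m = restr g R := by
      intro m hm
      rw [mem_filter, RegHam.mem_sc, hS.1.two.mv_other] at hm
      funext x
      by_cases hx : restr g R x = x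
      · rw [hx]
        by_contra hc
        have h1 : x ∈ mv m := mem_mv.2 hc
        rw [hm.1.1.2, ← hRS', ← mv_restr_of_subs hR] at h1
        exact mem_mv.1 h1 hx
      · exact hm.2 x hx
    intro a ha b hb
    rw [key a ha, key b hb]

/-- The matchings containing `g` and a Hamilton cycle in `hs g R`. -/
lemma card_invs_sub_both {g h : V × Fin r → V × Fin r} (hg : ∀ x, g (g x) = x)
    {R : Finset (V × Fin r)} (hR : R ∈ subs g) (hh : h ∈ hs g R) :
    ((invs univ).filter fun M => Sub g M ∧ Sub h M).card
      = dm (r * Fintype.card V - (2 * Fintype.card V + (mv g).card - R.card)) := by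
  classical
  simp only [hs, mem_filter, mem_ham] at hh
  obtain ⟨⟨h1, h2⟩, h3, h4⟩ := hh
  have hR' := mem_subs.1 hR
  have hagree : ∀ x, g x ≠ x → h x ≠ x → h x = g x := by
    intro x hx1 hx2
    have hxR : x ∈ R := by rw [← h3]; exact mem_inter.2 ⟨mem_mv.2 hx2, mem_mv.2 hx1⟩
    have := h4 x
    rw [restr, if_pos hxR] at this
    exact this hx1
  have hclose : ∀ x, g x ≠ x → h x = x → h (g x) = g x := by
    intro x hx1 hx2
    by_contra hc
    have hm : g x ∈ mv g := mv_closed hg (mem_mv.2 hx1)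
    have hxR : g x ∈ R := by rw [← h3]; exact mem_inter.2 ⟨mem_mv.2 hc, hm⟩
    have := hR'.2 _ hxR
    rw [hg, ← h3] at this
    exact mem_mv.1 (mem_inter.1 this).1 hx2
  have hclose' : ∀ x, h x ≠ x → g x = x → g (h x) = h x := by
    intro x hx1 hx2
    by_contra hc
    have hm : h x ∈ mv h := mv_closed h1.inv (mem_mv.2 hx1)
    have e := hagree _ hc (mem_mv.1 hm)
    rw [h1.inv] at e
    apply hc
    have := hg (h x)
    rw [← e, hx2] at this
    exact absurd this.symm hx1
  set u : V × Fin r → V × Fin r := fun x => if g x ≠ x then g x else h x with hu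
  have huinv : ∀ x, u (u x) = x := by
    intro x
    have a1 := hg x
    have a2 := h1.inv x
    have a3 := hclose x
    have a4 := hclose' x
    have a5 := hagree x
    simp only [hu]
    grind
  have hmv : mv u = mv h ∪ mv g := by
    ext x
    have := hagree x
    simp only [mem_mv, mem_union, hu]
    grind
  have hsub : ∀ M, (Sub g M ∧ Sub h M) ↔ Sub u M := by
    intro M
    constructor
    · rintro ⟨s1, s2⟩ x hx
      have := s1 x
      have := s2 x
      simp only [hu] at hx ⊢
      grind
    · intro s
      refine ⟨fun x hx => ?_, fun x hx => ?_⟩ <;>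
      · have s1 := s x
        have s2 := hagree x
        simp only [hu] at s1
        grind
  have hc : (mv u).card = 2 * Fintype.card V + (mv g).card - R.card := by
    have := card_union_add_card_inter (mv h) (mv g)
    rw [h3, h2.card] at this
    rw [hmv]; omega
  simp only [hsub]
  rw [card_invs_sub huinv (subset_univ _), card_invs, card_sdiff_of_subset (subset_univ _), hc,
    card_univ, Fintype.card_prod, Fintype.card_fin, mul_comm r]

/-- Joint count of matchings containing `g` together with a Hamilton cycle in them. -/
lemma sum_ham_sub {g : V × Fin r → V × Fin r} (hg : ∀ x, g (g x) = x) :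
    ∑ M ∈ (invs univ).filter (Sub g), ((ham V r).filter fun h => Sub h M).card
      = ∑ R ∈ subs g, (hs g R).card *
        dm (r * Fintype.card V - (2 * Fintype.card V + (mv g).card - R.card)) := by
  classical
  have h1 : ∑ M ∈ (invs univ).filter (Sub g), ((ham V r).filter fun h => Sub h M).card
      = ∑ h ∈ ham V r, ((invs univ).filter fun M => Sub g M ∧ Sub h M).card := by
    simp only [card_filter, sum_filter]
    rw [← sum_comm, ← sum_filter]
    simp only [sum_filter]
    refine sum_congr rfl fun M _ => ?_
    split_ifs with hgM <;> simp [hgM]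
  have h2 : ∑ h ∈ ham V r, ((invs univ).filter fun M => Sub g M ∧ Sub h M).card
      = ∑ h ∈ ham V r, ∑ R ∈ subs g, if h ∈ hs g R then
        ((invs univ).filter fun M => Sub g M ∧ Sub h M).card else 0 := by
    refine sum_congr rfl fun h hh => ?_
    rcases Nat.eq_zero_or_pos ((invs univ).filter fun M => Sub g M ∧ Sub h M).card with h0 | hpos
    · simp [h0]
    · obtain ⟨M, hM⟩ := card_pos.1 hpos
      simp only [mem_filter, mem_invs] at hM
      obtain ⟨⟨m1, m2⟩, m3, m4⟩ := hM
      have hh' := (mem_ham.1 hh).1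
      rw [sum_eq_single (mv h ∩ mv g), if_pos]
      · simp only [hs, mem_filter, hh, true_and]
        intro x hx
        rw [restr] at hx ⊢
        split_ifs at hx ⊢ with hc
        · rw [← m3 x hx, ← m4 x (mem_mv.1 (mem_inter.1 hc).1)]
        · exact absurd rfl hx
      · intro R _ hne
        rw [if_neg]
        simp only [hs, mem_filter, not_and]
        intro _ e; exact absurd e.symm hne
      · intro hc
        exfalso; apply hc
        rw [mem_subs]
        refine ⟨inter_subset_right, fun x hx => ?_⟩
        rw [mem_inter] at hx ⊢
        refine ⟨?_, mv_closed hg hx.2⟩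
        rw [← m3 x (mem_mv.1 hx.2), m4 x (mem_mv.1 hx.1)]
        exact mv_closed hh'.inv hx.1
  rw [h1, h2, sum_comm]
  refine sum_congr rfl fun R hR => ?_
  rw [← sum_filter]
  have : (ham V r).filter (fun h => h ∈ hs g R) = hs g R := by
    ext h; simp only [mem_filter]; exact ⟨fun h => h.2, fun h => ⟨(mem_filter.1 h).1, h⟩⟩
  rw [this, sum_congr rfl fun h hh => card_invs_sub_both hg hR hh, sum_const, smul_eq_mul]

end HamCount

end

section
open Finset Function

section Labelling
variable {D : Type*} [Fintype D] [DecidableEq D]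

/-- A cyclic labelling of the alternating cycle formed by `π` and `c`. -/
structure Labelling (π c : D → D) (k : ℕ) (x : ℕ → D) : Prop where
  per : ∀ i, x (i + k) = x i
  step : ∀ i, c (π (x i)) = x (i + 1)
  inj : ∀ i < k, ∀ j < k, x i = x j → i = j
  disj : ∀ i j, x i ≠ π (x j)
  mem : ∀ i, x i ∈ mv π
  cover : ∀ y ∈ mv π, ∃ i < k, y = x i ∨ y = π (x i)

lemma exists_labelling {π c : D → D} (hπ : ∀ x, π (π x) = x) (hc : ∀ x, c (c x) = x)
    (hmv : mv c = mv π) (hconn : Conn π c) (x0 : D) (hx0 : x0 ∈ mv π) :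
    ∃ k x, 2 * k = (mv π).card ∧ 0 < k ∧ Labelling π c k x := by
  set ρ : D → D := fun x => c (π x) with hρ
  have hinj : Injective ρ := by
    intro a b h
    have : π a = π b := by rw [← hc (π a), ← hc (π b)]; exact congrArg c h
    rw [← hπ a, this, hπ]
  have hper : x0 ∈ periodicPts ρ := hinj.mem_periodicPts x0
  set k := minimalPeriod ρ x0 with hk
  have hkpos : 0 < k := minimalPeriod_pos_of_mem_periodicPts hper
  set x : ℕ → D := fun i => ρ^[i] x0 with hx
  have hstep : ∀ i, c (π (x i)) = x (i + 1) := fun i => by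
    simp only [hx, iterate_succ_apply']; rfl
  have hxper : ∀ i, x (i + k) = x i := fun i => iterate_add_minimalPeriod_eq
  have hxinj : ∀ i < k, ∀ j < k, x i = x j → i = j := fun i hi j hj h =>
    iterate_injOn_Iio_minimalPeriod (Set.mem_Iio.2 hi) (Set.mem_Iio.2 hj) h
  have hcmv : ∀ y ∈ mv π, c y ≠ y := fun y hy => mem_mv.1 (hmv ▸ hy)
  have hmem : ∀ i, x i ∈ mv π := by
    intro i
    induction i with
    | zero => exact hx0
    | succ i ih =>
      rw [← hstep]
      have := mv_closed hc (x := π (x i)) (by rw [hmv]; exact mv_closed hπ ih)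
      rwa [hmv] at this
  have hback : ∀ i, c (x (i + 1)) = π (x i) := fun i => by rw [← hstep, hc]
  have hdisj : ∀ n i j, i ≤ j → j - i ≤ n → x i ≠ π (x j) ∧ x j ≠ π (x i) := by
    intro n
    induction n using Nat.strong_induction_on with
    | _ n ih =>
    intro i j hij hn
    have hsym : x i = π (x j) → x j = π (x i) := fun e => by rw [e, hπ]
    suffices x i ≠ π (x j) by
      refine ⟨this, fun e => this ?_⟩
      rw [e, hπ]
    intro e
    rcases Nat.lt_or_ge (j - i) 2 with h | h
    · rcases Nat.eq_or_lt_of_le hij with rfl | hlt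
      · exact mem_mv.1 (hmem i) e.symm
      · obtain rfl : j = i + 1 := by omega
        have e2 := hsym e
        have := hback i
        rw [← e2] at this
        exact hcmv _ (hmem _) this
    · have e2 := hsym e
      obtain ⟨j, rfl⟩ : ∃ j', j = j' + 1 := ⟨j - 1, by omega⟩
      have e3 : x (i + 1) = π (x j) := by rw [← hback j, e2, hstep]
      exact (ih (n - 2) (by omega) (i + 1) j (by omega) (by omega)).1 e3
  have hd : ∀ i j, x i ≠ π (x j) := by
    intro i j
    rcases le_total i j with h | h
    · exact (hdisj _ i j h le_rfl).1
    · exact (hdisj _ j i h le_rfl).2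
  set T := (range k).image x ∪ (range k).image (fun i => π (x i)) with hT
  have hmod : ∀ i, ∃ j < k, x i = x j := by
    intro i
    refine ⟨i % k, Nat.mod_lt _ hkpos, ?_⟩
    exact (iterate_mod_minimalPeriod_eq).symm
  have hmemT1 : ∀ i, x i ∈ T := fun i => by
    obtain ⟨j, hj, e⟩ := hmod i
    rw [e]; exact mem_union_left _ (mem_image_of_mem _ (mem_range.2 hj))
  have hmemT2 : ∀ i, π (x i) ∈ T := fun i => by
    obtain ⟨j, hj, e⟩ := hmod i
    rw [e]; exact mem_union_right _ (mem_image_of_mem (fun i => π (x i)) (mem_range.2 hj))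
  have hTeq : T = mv π := by
    apply hconn
    · intro y hy
      rcases mem_union.1 hy with hy | hy <;> obtain ⟨i, _, rfl⟩ := mem_image.1 hy
      · exact hmem i
      · exact mv_closed hπ (hmem i)
    · exact ⟨x 0, hmemT1 0⟩
    · intro y hy
      rcases mem_union.1 hy with hy | hy <;> obtain ⟨i, _, rfl⟩ := mem_image.1 hy
      · refine ⟨hmemT2 i, ?_⟩
        have : c (x i) = π (x (i + k - 1)) := by
          rw [← hback, show i + k - 1 + 1 = i + k by omega, hxper]
        rw [this]; exact hmemT2 _
      · simp only [hπ, hstep]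
        exact ⟨hmemT1 i, hmemT1 _⟩
  refine ⟨k, x, ?_, hkpos, hxper, hstep, hxinj, hd, hmem, ?_⟩
  · rw [← hTeq, hT, card_union_of_disjoint, card_image_of_injOn, card_image_of_injOn, card_range]
    · ring
    · intro i hi j hj e
      simp only [coe_range, Set.mem_Iio] at hi hj
      apply hxinj i hi j hj
      rw [← hπ (x i), ← hπ (x j)]; exact congrArg π e
    · intro i hi j hj e
      simp only [coe_range, Set.mem_Iio] at hi hj
      exact hxinj i hi j hj e
    · rw [Finset.disjoint_left]
      intro y h1 h2
      obtain ⟨i, _, rfl⟩ := mem_image.1 h1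
      obtain ⟨j, _, e⟩ := mem_image.1 h2
      exact hd i j e.symm
  · intro y hy
    rw [← hTeq] at hy
    rcases mem_union.1 hy with hy | hy <;> obtain ⟨i, hi, rfl⟩ := mem_image.1 hy
    · exact ⟨i, mem_range.1 hi, Or.inl rfl⟩
    · exact ⟨i, mem_range.1 hi, Or.inr rfl⟩

end Labelling

section Trace

lemma pow_apply_eq_sum_paths (M : Matrix Bool Bool ℝ) (k : ℕ) (a b : Bool) :
    (M ^ k) a b = ∑ p : Fin (k + 1) → Bool,
      if p 0 = a ∧ p (Fin.last k) = b then ∏ i : Fin k, M (p i.castSucc) (p i.succ) else 0 := by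
  induction k generalizing a with
  | zero =>
    rw [pow_zero, Matrix.one_apply, ← (Equiv.funUnique (Fin 1) Bool).symm.sum_comp]
    simp only [Fintype.sum_bool]
    cases a <;> cases b <;> simp
  | succ k ih =>
    rw [pow_succ', Matrix.mul_apply, ← (Fin.consEquiv fun _ => Bool).sum_comp, Fintype.sum_prod_type]
    simp only [ih, mul_sum, Fin.consEquiv_apply]
    rw [sum_comm]
    have : ∀ (y : Bool) (p : Fin (k + 1) → Bool),
        (if (Fin.cons y p : Fin (k + 2) → Bool) 0 = a ∧
          (Fin.cons y p : Fin (k + 2) → Bool) (Fin.last (k + 1)) = b then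
          ∏ i : Fin (k + 1), M ((Fin.cons y p : Fin (k + 2) → Bool) i.castSucc)
            ((Fin.cons y p : Fin (k + 2) → Bool) i.succ) else 0)
        = if y = a ∧ p (Fin.last k) = b then
          M y (p 0) * ∏ i : Fin k, M (p i.castSucc) (p i.succ) else 0 := by
      intro y p
      rw [Fin.prod_univ_succ]
      simp only [Fin.cons_zero, Fin.castSucc_zero, Fin.cons_succ, ← Fin.succ_last,
        ← Fin.succ_castSucc]
    simp only [this]
    rw [sum_comm]
    conv_rhs => rw [sum_comm]
    simp only [Fintype.sum_bool]
    rw [← sum_add_distrib]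
    refine sum_congr rfl fun p _ => ?_
    cases a <;> cases p 0 <;> by_cases h : p (Fin.last k) = b <;> simp [h]

lemma trace_pow_eq_sum_paths (M : Matrix Bool Bool ℝ) (k : ℕ) :
    (M ^ k).trace = ∑ p : Fin (k + 1) → Bool,
      if p 0 = p (Fin.last k) then ∏ i : Fin k, M (p i.castSucc) (p i.succ) else 0 := by
  rw [Matrix.trace]
  simp only [Matrix.diag_apply, pow_apply_eq_sum_paths]
  rw [sum_comm]
  refine sum_congr rfl fun p _ => ?_
  simp only [Fintype.sum_bool]
  cases p 0 <;> cases p (Fin.last k) <;> simp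

/-- The transfer matrix. -/
def tm (w : ℕ → ℝ) : Matrix Bool Bool ℝ := fun a b => w (a.toNat + b.toNat)

lemma trace_tm_pow (w : ℕ → ℝ) {α β : ℝ} (h1 : α + β = w 0 + w 2)
    (h2 : α * β = w 0 * w 2 - w 1 ^ 2) (k : ℕ) : (tm w ^ k).trace = α ^ k + β ^ k := by
  have hsq : tm w ^ 2 = (α + β) • tm w - (α * β) • 1 := by
    rw [h1, h2, pow_two]
    ext a b
    rw [Matrix.mul_apply, Fintype.sum_bool]
    cases a <;> cases b <;> simp [tm] <;> ring
  induction k using Nat.twoStepInduction with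
  | zero => simp; norm_num
  | one => simp [Matrix.trace, tm]; linarith
  | more k ih1 ih2 =>
    rw [pow_add, hsq, mul_sub, Matrix.mul_smul, Matrix.mul_smul, mul_one, ← pow_succ,
      Matrix.trace_sub, Matrix.trace_smul, Matrix.trace_smul, ih1, ih2]
    simp only [smul_eq_mul]; ring

end Trace

section CycleSum
variable {V : Type*} [Fintype V] [DecidableEq V] {r : ℕ}

lemma sum_subs_cyc {c : V × Fin r → V × Fin r} (hc : IsCyc c) (w : ℕ → ℝ) :
    ∑ R ∈ subs c, ∏ v ∈ tch c, w (slice R v).card = (tm w ^ (tch c).card).trace := by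
  obtain ⟨x0, hx0⟩ := hc.ne
  set π := other (mv c) with hπ
  have hπmv : mv π = mv c := hc.two.mv_other
  obtain ⟨k, x, hk, hkpos, L⟩ := exists_labelling hc.two.other_invol hc.inv hπmv.symm hc.conn x0
    (by rw [hπmv]; exact hx0)
  have hkt : (tch c).card = k := by
    have := card_of_twoFib hc.two
    rw [hπmv] at hk; omega
  have hπinv : ∀ y, π (π y) = y := hc.two.other_invol
  have hπfst : ∀ y, (π y).1 = y.1 := other_fst hc.two
  have hxm : ∀ i, x i ∈ mv c := fun i => hπmv ▸ L.mem i
  have hπxm : ∀ i, π (x i) ∈ mv c := fun i => by rw [← hπmv]; exact mv_closed hπinv (L.mem i)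
  have hfst : ∀ i < k, ∀ j < k, (x i).1 = (x j).1 → i = j := by
    intro i hi j hj e
    apply L.inj i hi j hj
    by_contra hne
    exact L.disj i j (hc.two.other_eq (hxm j) (hxm i) e hne).symm
  have htch : tch c = (range k).image fun i => (x i).1 := by
    ext v
    simp only [tch, mem_image, mem_range]
    constructor
    · rintro ⟨y, hy, rfl⟩
      obtain ⟨i, hi, rfl | rfl⟩ := L.cover y (by rw [hc.two.mv_other]; exact hy)
      · exact ⟨i, hi, rfl⟩
      · exact ⟨i, hi, (hπfst _).symm⟩
    · rintro ⟨i, hi, rfl⟩; exact ⟨_, hxm i, rfl⟩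
  have hslice : ∀ R ∈ subs c, ∀ i, (slice R (x i).1).card
      = (decide (x i ∈ R)).toNat + (decide (x (i + 1) ∈ R)).toNat := by
    intro R hR i
    rw [mem_subs] at hR
    have hiff : x (i + 1) ∈ R ↔ π (x i) ∈ R := by
      rw [← L.step]
      constructor
      · intro h; have := hR.2 _ h; rwa [hc.inv] at this
      · exact hR.2 _
    have hsl : slice R (x i).1 = (if x i ∈ R then {(x i).2} else ∅) ∪
        (if π (x i) ∈ R then {(π (x i)).2} else ∅) := by
      ext j
      rw [mem_slice, mem_union]
      constructor
      · intro h
        by_cases e : ((x i).1, j) = x i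
        · left
          have : x i ∈ R := e ▸ h
          rw [if_pos this, mem_singleton]; exact (Prod.ext_iff.1 e).2
        · right
          have := hc.two.other_eq (hxm i) (hR.1 h) rfl e
          rw [← hπ] at this
          rw [this, if_pos h, mem_singleton]
      · rintro (h | h)
        · split_ifs at h with h'
          · rw [mem_singleton] at h; rw [h]; exact h'
          · simp at h
        · split_ifs at h with h'
          · rw [mem_singleton] at h; rw [h, ← hπfst (x i)]; exact h'
          · simp at h
    have hne : (x i).2 ≠ (π (x i)).2 := fun e => L.disj i i (Prod.ext (hπfst _).symm e)
    rw [hsl, card_union_of_disjoint]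
    · simp only [hiff]
      by_cases h1 : x i ∈ R <;> by_cases h2 : π (x i) ∈ R <;> simp [h1, h2]
    · split_ifs <;> simp [hne]
  rw [hkt, trace_pow_eq_sum_paths, ← sum_filter]
  refine sum_nbij' (fun R => fun i : Fin (k + 1) => decide (x i ∈ R))
    (fun p => (mv c).filter fun y => ∃ i : Fin k, (p i.castSucc = true ∧ y = x i) ∨
      (p i.succ = true ∧ y = π (x i))) ?_ ?_ ?_ ?_ ?_
  · intro R hR
    simp only [mem_filter, mem_univ, true_and, Fin.val_zero, Fin.val_last]
    have := L.per 0
    rw [zero_add] at this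
    exact decide_eq_decide.2 (by rw [this])
  · intro p hp
    simp only [mem_filter, mem_univ, true_and] at hp
    rw [mem_subs]
    refine ⟨filter_subset _ _, ?_⟩
    intro y hy
    rw [mem_filter] at hy ⊢
    refine ⟨mv_closed hc.inv hy.1, ?_⟩
    obtain ⟨i, ⟨h1, rfl⟩ | ⟨h1, rfl⟩⟩ := hy.2
    · rcases Nat.eq_zero_or_pos i.val with h0 | hpos
      · refine ⟨⟨k - 1, by omega⟩, Or.inr ⟨?_, ?_⟩⟩
        · have : (⟨k - 1, by omega⟩ : Fin k).succ = Fin.last k := by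
            ext; simp; omega
          rw [this, ← hp, ← h1]; congr 1; ext; simp [h0]
        · simp only
          rw [h0, ← L.per 0, ← hc.inv (π (x (k - 1))), L.step]; congr 2; omega
      · refine ⟨⟨i.val - 1, by omega⟩, Or.inr ⟨?_, ?_⟩⟩
        · rw [← h1]; congr 1; ext; simp; omega
        · simp only
          rw [← hc.inv (π (x (i.val - 1))), L.step]; congr 2; omega
    · rw [L.step]
      rcases Nat.lt_or_ge (i.val + 1) k with h | h
      · refine ⟨⟨i.val + 1, h⟩, Or.inl ⟨?_, rfl⟩⟩
        rw [← h1]; congr 1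
      · refine ⟨⟨0, hkpos⟩, Or.inl ⟨?_, ?_⟩⟩
        · have : i.succ = Fin.last k := by ext; simp; omega
          rw [this, ← hp] at h1
          rw [← h1]; congr 1
        · simp only; rw [← L.per 0]; congr 1; omega
  · intro R hR
    have hR' := mem_subs.1 hR
    ext y
    rw [mem_filter]
    constructor
    · rintro ⟨h1, i, ⟨h2, rfl⟩ | ⟨h2, rfl⟩⟩
      · simpa using h2
      · have h2 : x (i.val + 1) ∈ R := by simpa using h2
        have := hR'.2 _ h2
        rwa [← L.step, hc.inv] at this
    · intro hy
      refine ⟨hR'.1 hy, ?_⟩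
      obtain ⟨i, hi, rfl | rfl⟩ := L.cover y (by rw [hc.two.mv_other]; exact hR'.1 hy)
      · exact ⟨⟨i, hi⟩, Or.inl ⟨by simpa using hy, rfl⟩⟩
      · refine ⟨⟨i, hi⟩, Or.inr ⟨?_, rfl⟩⟩
        have := hR'.2 _ hy
        rw [L.step] at this
        simpa using this
  · intro p hp
    simp only [mem_filter, mem_univ, true_and] at hp
    funext i
    rw [Bool.eq_iff_iff, decide_eq_true_iff, mem_filter]
    constructor
    · rintro ⟨-, j, ⟨h2, e⟩ | ⟨h2, e⟩⟩
      · rcases Nat.lt_or_ge i.val k with h | h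
        · have := L.inj _ h _ j.2 e
          rw [← h2]; congr 1; ext; simpa using this
        · have hi : i = Fin.last k := by ext; simp; omega
          have hik : x i = x 0 := by rw [hi, ← L.per 0]; simp
          rw [hik] at e
          have := L.inj _ hkpos _ j.2 e
          rw [hi, ← hp, ← h2]; congr 1; ext; simpa using this
      · exact absurd e (L.disj _ _)
    · intro h
      refine ⟨hxm _, ?_⟩
      rcases Nat.lt_or_ge i.val k with hi | hi
      · exact ⟨⟨i, hi⟩, Or.inl ⟨by rw [← h]; congr 1, rfl⟩⟩
      · have hi : i = Fin.last k := by ext; simp; omega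
        have hik : x i = x 0 := by rw [hi, ← L.per 0]; simp
        refine ⟨⟨0, hkpos⟩, Or.inl ⟨?_, hik⟩⟩
        rw [hi, ← hp] at h
        rw [← h]; congr 1
  · intro R hR
    rw [htch, prod_image, prod_range]
    · refine prod_congr rfl fun i _ => ?_
      rw [hslice R hR]; rfl
    · intro i hi j hj e
      exact hfst i (by simpa using hi) j (by simpa using hj) e

end CycleSum

end

section
open Finset Function

section Esymm
variable {ι : Type*} [DecidableEq ι]

/-- Elementary symmetric sums. -/
def es (p : ι → ℝ) (A : Finset ι) (i : ℕ) : ℝ := ∑ B ∈ powersetCard i A, ∏ c ∈ B, p c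

lemma es_zero (p : ι → ℝ) (A : Finset ι) : es p A 0 = 1 := by simp [es]

lemma es_insert (p : ι → ℝ) {A : Finset ι} {c : ι} (hc : c ∉ A) (i : ℕ) :
    es p (insert c A) (i + 1) = es p A (i + 1) + p c * es p A i := by
  have hnot : ∀ B ∈ powersetCard i A, c ∉ B := fun B hB h => hc ((mem_powersetCard.1 hB).1 h)
  rw [es, powersetCard_succ_insert hc, sum_union, es, sum_image, es, mul_sum]
  · congr 1
    exact sum_congr rfl fun B hB => by rw [prod_insert (hnot B hB)]
  · intro B hB B' hB' e
    rw [← erase_insert (hnot B hB), ← erase_insert (hnot B' hB')]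
    exact congrArg (fun x => erase x c) e
  · rw [Finset.disjoint_left]
    intro B hB hB'
    obtain ⟨B', _, rfl⟩ := mem_image.1 hB'
    exact hc ((mem_powersetCard.1 hB).1 (mem_insert_self _ _))

/-- Bonferroni inequalities. -/
lemma bonferroni (p : ι → ℝ) (A : Finset ι) (hp : ∀ c ∈ A, 0 ≤ p c ∧ p c ≤ 1) :
    ∀ J : ℕ, 0 ≤ (-1) ^ J * (∏ c ∈ A, (1 - p c) - ∑ i ∈ range J, (-1) ^ i * es p A i) ∧
      (-1) ^ J * (∏ c ∈ A, (1 - p c) - ∑ i ∈ range J, (-1) ^ i * es p A i) ≤ es p A J := by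
  induction A using Finset.induction_on with
  | empty =>
    intro J
    have : ∀ i, es p (∅ : Finset ι) (i + 1) = 0 := fun i => by
      rw [es, powersetCard_eq_empty.2 (by simp)]; simp
    cases J with
    | zero => simp [es_zero]
    | succ J => rw [sum_range_succ']; simp [es_zero, this]
  | insert c A hc ih =>
    have ih := ih fun x hx => hp x (mem_insert_of_mem hx)
    have hpA : ∀ x ∈ A, 0 ≤ p x := fun x hx => (hp x (mem_insert_of_mem hx)).1
    obtain ⟨hc0, hc1⟩ := hp c (mem_insert_self _ _)
    intro J
    cases J with
    | zero =>
      have := ih 0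
      simp only [pow_zero, range_zero, sum_empty, sub_zero, one_mul, es_zero, prod_insert hc] at this ⊢
      exact ⟨mul_nonneg (by linarith) this.1, mul_le_one₀ (by linarith) this.1 this.2⟩
    | succ J =>
      have key : (∏ x ∈ insert c A, (1 - p x)) - ∑ i ∈ range (J + 1), (-1) ^ i * es p (insert c A) i
          = ((∏ x ∈ A, (1 - p x)) - ∑ i ∈ range (J + 1), (-1) ^ i * es p A i)
            - p c * ((∏ x ∈ A, (1 - p x)) - ∑ i ∈ range J, (-1) ^ i * es p A i) := by
        rw [prod_insert hc, sum_range_succ' _ J, sum_range_succ' _ J]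
        simp only [es_insert p hc, es_zero, mul_add, sum_add_distrib]
        have : ∑ x ∈ range J, (-1 : ℝ) ^ (x + 1) * (p c * es p A x)
            = - (p c * ∑ x ∈ range J, (-1) ^ x * es p A x) := by
          rw [mul_sum, ← sum_neg_distrib]
          exact sum_congr rfl fun x _ => by ring
        rw [this]; ring
      rw [key, es_insert p hc]
      have h1 := ih (J + 1)
      have h2 := ih J
      set a := (∏ x ∈ A, (1 - p x)) - ∑ i ∈ range (J + 1), (-1) ^ i * es p A i
      set b := (∏ x ∈ A, (1 - p x)) - ∑ i ∈ range J, (-1) ^ i * es p A i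
      have e : (-1 : ℝ) ^ (J + 1) * (a - p c * b) = (-1) ^ (J + 1) * a + p c * ((-1) ^ J * b) := by
        ring
      rw [e]
      exact ⟨add_nonneg h1.1 (mul_nonneg hc0 h2.1),
        add_le_add h1.2 (mul_le_mul_of_nonneg_left h2.2 hc0)⟩

lemma bonferroni_abs (p : ι → ℝ) (A : Finset ι) (hp : ∀ c ∈ A, 0 ≤ p c ∧ p c ≤ 1) (J : ℕ) :
    |∏ c ∈ A, (1 - p c) - ∑ i ∈ range J, (-1) ^ i * es p A i| ≤ es p A J := by
  obtain ⟨h1, h2⟩ := bonferroni p A hp J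
  have := abs_of_nonneg h1
  rw [abs_mul, abs_pow, abs_neg, abs_one, one_pow, one_mul] at this
  rw [this]; exact h2

lemma pow_mul_es_le {p : ι → ℝ} {A : Finset ι} (hp : ∀ c ∈ A, 0 ≤ p c) {t : ℝ} (ht : 0 ≤ t)
    (i : ℕ) : t ^ i * es p A i ≤ Real.exp (t * ∑ c ∈ A, p c) := by
  have h1 : t ^ i * es p A i = ∑ B ∈ powersetCard i A, ∏ c ∈ B, (t * p c) := by
    rw [es, mul_sum]
    refine sum_congr rfl fun B hB => ?_
    rw [prod_mul_distrib, prod_const, (mem_powersetCard.1 hB).2]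
  have h2 : ∑ B ∈ powersetCard i A, ∏ c ∈ B, (t * p c) ≤ ∑ B ∈ A.powerset, ∏ c ∈ B, (t * p c) := by
    refine sum_le_sum_of_subset_of_nonneg (fun B hB => mem_powerset.2 (mem_powersetCard.1 hB).1) ?_
    intro B hB _
    exact prod_nonneg fun c hc => mul_nonneg ht (hp c (mem_powerset.1 hB hc))
  rw [h1]
  refine h2.trans ?_
  rw [← prod_one_add, mul_sum, Real.exp_sum]
  refine prod_le_prod (fun c hc => ?_) fun c _ => ?_
  · have := mul_nonneg ht (hp c hc); linarith
  · rw [add_comm]; exact Real.add_one_le_exp _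

end Esymm

end

section
open Finset Function

section Families
variable {V : Type*} [Fintype V] [DecidableEq V] {r : ℕ}

open scoped Classical in
/-- Cycles of length at most `m`. -/
noncomputable def cycs (V : Type*) [Fintype V] [DecidableEq V] (r m : ℕ) :
    Finset (V × Fin r → V × Fin r) :=
  univ.filter fun c => IsCyc c ∧ (tch c).card ≤ m

lemma mem_cycs {m : ℕ} {c : V × Fin r → V × Fin r} :
    c ∈ cycs V r m ↔ IsCyc c ∧ (tch c).card ≤ m := by
  simp [cycs]

lemma IsCyc.tch_pos {c : V × Fin r → V × Fin r} (hc : IsCyc c) : 0 < (tch c).card := by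
  obtain ⟨x, hx⟩ := hc.ne
  exact card_pos.2 ⟨x.1, mem_image_of_mem _ hx⟩

/-- Total weight of the matchings containing all members of `A`. -/
def wt (ω : (V × Fin r → V × Fin r) → ℝ) (A : Finset (V × Fin r → V × Fin r)) : ℝ :=
  ∑ M ∈ (invs univ).filter (fun M => ∀ c ∈ A, Sub c M), ω M

/-- The touched vertices of a family. -/
def tchs (A : Finset (V × Fin r → V × Fin r)) : Finset V := A.biUnion tch

/-- The total length of a family. -/
def tot (A : Finset (V × Fin r → V × Fin r)) : ℕ := ∑ c ∈ A, (tch c).card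

/-- A fibre-disjoint family. -/
def Disj (A : Finset (V × Fin r → V × Fin r)) : Prop :=
  ∀ c ∈ A, ∀ c' ∈ A, c ≠ c' → Disjoint (tch c) (tch c')

lemma card_tchs_lt_tot {A : Finset (V × Fin r → V × Fin r)} (h : ¬ Disj A) :
    (tchs A).card + 1 ≤ tot A := by
  unfold Disj at h
  push Not at h
  obtain ⟨c, hc, c', hc', hne, hd⟩ := h
  have hc'' : c' ∈ A.erase c := mem_erase.2 ⟨hne.symm, hc'⟩
  have h1 : tchs A = tch c ∪ (tch c' ∪ ((A.erase c).erase c').biUnion tch) := by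
    rw [← biUnion_insert, ← biUnion_insert, insert_erase hc'', insert_erase hc, tchs]
  have h2 : tot A = (tch c).card + ((tch c').card + ∑ x ∈ (A.erase c).erase c', (tch x).card) := by
    rw [add_sum_erase (A.erase c) (fun x => (tch x).card) hc'',
      add_sum_erase A (fun x => (tch x).card) hc, tot]
  have h3 := card_union_add_card_inter (tch c) (tch c')
  have h4 : 0 < (tch c ∩ tch c').card := by
    rw [card_pos, ← not_disjoint_iff_nonempty_inter]; exact hd
  have h5 := card_biUnion_le (s := (A.erase c).erase c') (t := tch)
  rw [h1, h2, ← union_assoc]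
  have h6 := card_union_le (tch c ∪ tch c') (((A.erase c).erase c').biUnion tch)
  omega

lemma two_le_slice {A : Finset (V × Fin r → V × Fin r)} (hA : ∀ c ∈ A, IsCyc c) {v : V}
    (hv : v ∈ tchs A) : 2 ≤ (slice (A.biUnion mv) v).card := by
  obtain ⟨c, hc, hvc⟩ := mem_biUnion.1 hv
  rw [mem_tch] at hvc
  have h1 := ((hA c hc).two v).resolve_left hvc
  have h2 := card_le_card (slice_mono (subset_biUnion_of_mem mv hc) v)
  omega

lemma excess {A : Finset (V × Fin r → V × Fin r)} (hA : ∀ c ∈ A, IsCyc c) (h : ¬ Disj A)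
    {M : V × Fin r → V × Fin r} (hM : ∀ c ∈ A, Sub c M) :
    2 * (tchs A).card + 1 ≤ (A.biUnion mv).card := by
  by_contra hlt
  have hsum : ∑ v ∈ tchs A, (slice (A.biUnion mv) v).card ≤ ∑ v ∈ tchs A, 2 := by
    have : ∑ v ∈ tchs A, (slice (A.biUnion mv) v).card ≤ (A.biUnion mv).card := by
      rw [card_eq_sum_slice]
      exact sum_le_sum_of_subset (subset_univ _)
    rw [sum_const, smul_eq_mul]; omega
  have hall : ∀ v ∈ tchs A, (slice (A.biUnion mv) v).card = 2 := by
    intro v hv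
    by_contra hne
    have h2 := two_le_slice hA hv
    have := sum_lt_sum (s := tchs A) (f := fun _ => 2)
      (g := fun v => (slice (A.biUnion mv) v).card)
      (fun v hv => two_le_slice hA hv) ⟨v, hv, by omega⟩
    omega
  have hslice : ∀ c ∈ A, ∀ v ∈ tch c, slice (mv c) v = slice (A.biUnion mv) v := by
    intro c hc v hv
    apply eq_of_subset_of_card_le (slice_mono (subset_biUnion_of_mem mv hc) v)
    rw [hall v (mem_biUnion.2 ⟨c, hc, hv⟩), ((hA c hc).two v).resolve_left (mem_tch.1 hv)]
  have key : ∀ c ∈ A, ∀ c' ∈ A, ¬ Disjoint (tch c) (tch c') → mv c ⊆ mv c' := by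
    intro c hc c' hc' hd
    have hcl : Cl (other (mv c)) c (mv c ∩ mv c') := by
      intro x hx
      rw [mem_inter] at hx
      have hcx := mv_closed (hA c hc).inv hx.1
      refine ⟨?_, ?_⟩
      · have h1 := (hA c hc).two.other_spec hx.1
        refine mem_inter.2 ⟨h1.1, ?_⟩
        have hv : x.1 ∈ tch c := mem_image_of_mem _ hx.1
        have hv' : x.1 ∈ tch c' := mem_image_of_mem _ hx.2
        have h2 : (other (mv c) x).2 ∈ slice (mv c) x.1 := by
          rw [mem_slice, ← h1.2.2]; exact h1.1
        rw [hslice c hc _ hv, ← hslice c' hc' _ hv', mem_slice, ← h1.2.2] at h2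
        exact h2
      · refine mem_inter.2 ⟨hcx, ?_⟩
        have := mv_closed (hA c' hc').inv hx.2
        rwa [← hM c' hc' x (mem_mv.1 hx.2), hM c hc x (mem_mv.1 hx.1)] at this
    have hne : (mv c ∩ mv c').Nonempty := by
      rw [not_disjoint_iff] at hd
      obtain ⟨v, hv, hv'⟩ := hd
      have e := hslice c hc v hv
      rw [← hslice c' hc' v hv'] at e
      obtain ⟨x, hx, rfl⟩ := mem_image.1 hv
      have : x.2 ∈ slice (mv c) x.1 := mem_slice.2 hx
      rw [e, mem_slice] at this
      exact ⟨x, mem_inter.2 ⟨hx, this⟩⟩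
    have := (hA c hc).conn _ (by rw [(hA c hc).two.mv_other]; exact inter_subset_left) hne hcl
    rw [(hA c hc).two.mv_other] at this
    rw [← this]; exact inter_subset_right
  unfold Disj at h
  push Not at h
  obtain ⟨c, hc, c', hc', hne, hd⟩ := h
  have h1 := subset_antisymm (key c hc c' hc' hd) (key c' hc' c hc fun h => hd h.symm)
  apply hne
  funext x
  by_cases hx : c x = x
  · rw [hx]
    have : x ∉ mv c' := by rw [← h1]; simpa using hx
    simpa using (not_not.1 (fun h => this (mem_mv.2 h))).symm
  · have hx' : c' x ≠ x := mem_mv.1 (h1 ▸ mem_mv.2 hx)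
    rw [← hM c hc x hx, hM c' hc' x hx']

/-- A compatible family is equivalent to a single involution. -/
lemma exists_glue {A : Finset (V × Fin r → V × Fin r)} (hA : ∀ c ∈ A, IsCyc c)
    {M : V × Fin r → V × Fin r} (hMi : M ∈ invs univ) (hM : ∀ c ∈ A, Sub c M) :
    ∃ g : V × Fin r → V × Fin r, (∀ x, g (g x) = x) ∧ mv g = A.biUnion mv ∧
      ∀ ω, wt ω A = wt ω {g} := by
  rw [mem_invs] at hMi
  have hMU : ∀ x ∈ A.biUnion mv, M x ∈ A.biUnion mv := by
    intro x hx
    obtain ⟨c, hc, hx⟩ := mem_biUnion.1 hx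
    rw [hM c hc x (mem_mv.1 hx)]
    exact mem_biUnion.2 ⟨c, hc, mv_closed (hA c hc).inv hx⟩
  refine ⟨restr M (A.biUnion mv), restr_invol hMi.1 hMU, ?_, ?_⟩
  · rw [mv_restr, hMi.2, univ_inter]
  · intro ω
    unfold wt
    congr 1
    ext M'
    simp only [mem_filter, mem_singleton, forall_eq]
    refine and_congr_right fun hM' => ?_
    constructor
    · intro h x hx
      rw [restr] at hx ⊢
      split_ifs at hx ⊢ with hU
      · obtain ⟨c, hc, hx⟩ := mem_biUnion.1 hU
        rw [h c hc x (mem_mv.1 hx), hM c hc x (mem_mv.1 hx)]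
      · exact absurd rfl hx
    · intro h c hc x hx
      have hU : x ∈ A.biUnion mv := mem_biUnion.2 ⟨c, hc, mem_mv.2 hx⟩
      have := h x
      rw [restr, if_pos hU, hM c hc x hx] at this
      exact this hx

/-- Number of families supported on given vertices. -/
def nfam (r v : ℕ) : ℕ := 2 ^ ∑ j ∈ range (r * v + 1), (r * v).choose j * dm j

lemma card_families_le (𝒜 : Finset (Finset (V × Fin r → V × Fin r)))
    (h𝒜 : ∀ A ∈ 𝒜, ∀ c ∈ A, IsCyc c) (B : Finset V) :
    (𝒜.filter fun A => tchs A = B).card ≤ nfam r B.card := by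
  classical
  set S : Finset (V × Fin r) := B ×ˢ univ with hS
  have hcardS : S.card = r * B.card := by rw [hS, card_product, card_univ, Fintype.card_fin, mul_comm]
  set W : Finset (V × Fin r → V × Fin r) := S.powerset.biUnion invs with hW
  have hWc : W.card ≤ ∑ j ∈ range (r * B.card + 1), (r * B.card).choose j * dm j := by
    refine card_biUnion_le.trans ?_
    rw [sum_congr rfl fun T _ => card_invs T, sum_powerset_apply_card (fun j => dm j), hcardS]
    simp
  have : (𝒜.filter fun A => tchs A = B) ⊆ W.powerset := by
    intro A hA
    rw [mem_filter] at hA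
    rw [mem_powerset]
    intro c hc
    rw [hW, mem_biUnion]
    refine ⟨mv c, ?_, mem_invs.2 ⟨(h𝒜 A hA.1 c hc).inv, rfl⟩⟩
    rw [mem_powerset]
    intro x hx
    rw [hS, mem_product]
    refine ⟨?_, mem_univ _⟩
    rw [← hA.2]
    exact mem_biUnion.2 ⟨c, hc, mem_image_of_mem _ hx⟩
  refine (card_le_card this).trans ?_
  rw [card_powerset]
  exact Nat.pow_le_pow_right two_pos hWc

lemma card_tchs_le {m i : ℕ} {A : Finset (V × Fin r → V × Fin r)}
    (hA : A ∈ powersetCard i (cycs V r m)) : (tchs A).card ≤ i * m := by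
  rw [mem_powersetCard] at hA
  refine card_biUnion_le.trans ?_
  rw [← hA.2, ← smul_eq_mul, ← sum_const]
  exact sum_le_sum fun c hc => (mem_cycs.1 (hA.1 hc)).2

lemma sum_families_le [Nonempty V] {m i : ℕ} {𝒜 : Finset (Finset (V × Fin r → V × Fin r))}
    (h𝒜 : 𝒜 ⊆ powersetCard i (cycs V r m)) {f : Finset (V × Fin r → V × Fin r) → ℝ} {C : ℝ}
    (hC : 0 ≤ C)
    (hf : ∀ A ∈ 𝒜, f A ≤ C * ((Fintype.card V : ℝ) ^ ((tchs A).card + 1))⁻¹) :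
    ∑ A ∈ 𝒜, f A ≤ C * (∑ v ∈ range (i * m + 1), nfam r v) * (Fintype.card V : ℝ)⁻¹ := by
  classical
  have hn : (0 : ℝ) < Fintype.card V := by exact_mod_cast Fintype.card_pos
  generalize hndef : (Fintype.card V : ℝ) = n at *
  have h1 : ∑ A ∈ 𝒜, f A ≤ ∑ A ∈ 𝒜, C * (n ^ ((tchs A).card + 1))⁻¹ := sum_le_sum hf
  refine h1.trans ?_
  have hmaps : ∀ A ∈ 𝒜, tchs A ∈ univ.filter fun B : Finset V => B.card ≤ i * m := by
    intro A hA
    rw [mem_filter]; exact ⟨mem_univ _, card_tchs_le (h𝒜 hA)⟩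
  rw [← sum_fiberwise_of_maps_to hmaps]
  have h2 : ∀ B ∈ univ.filter (fun B : Finset V => B.card ≤ i * m),
      ∑ A ∈ 𝒜.filter (fun A => tchs A = B), C * (n ^ ((tchs A).card + 1))⁻¹
        ≤ nfam r B.card * (C * (n ^ (B.card + 1))⁻¹) := by
    intro B _
    rw [sum_congr rfl (g := fun _ => C * (n ^ (B.card + 1))⁻¹), sum_const, nsmul_eq_mul]
    · refine mul_le_mul_of_nonneg_right ?_ (by positivity)
      exact_mod_cast card_families_le 𝒜 (fun A hA c hc =>
        (mem_cycs.1 ((mem_powersetCard.1 (h𝒜 hA)).1 hc)).1) B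
    · intro A hA
      rw [(mem_filter.1 hA).2]
  refine (sum_le_sum h2).trans ?_
  have hmaps2 : ∀ B ∈ univ.filter (fun B : Finset V => B.card ≤ i * m), B.card ∈ range (i * m + 1) := by
    intro B hB; rw [mem_range]; have := (mem_filter.1 hB).2; omega
  rw [← sum_fiberwise_of_maps_to hmaps2]
  push_cast
  rw [mul_sum, sum_mul]
  refine sum_le_sum fun v hv => ?_
  rw [sum_congr rfl (g := fun _ => nfam r v * (C * (n ^ (v + 1))⁻¹)), sum_const, nsmul_eq_mul]
  · have h3 : ((univ.filter (fun B : Finset V => B.card ≤ i * m)).filter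
        (fun B => B.card = v)).card ≤ (Fintype.card V).choose v := by
      rw [← card_univ, ← card_powersetCard]
      refine card_le_card fun B hB => ?_
      rw [mem_powersetCard_univ]; exact (mem_filter.1 hB).2
    have h4 : ((Fintype.card V).choose v : ℝ) ≤ n ^ v := by
      rw [← hndef]; exact_mod_cast Nat.choose_le_pow _ _
    have h5 : (((univ.filter (fun B : Finset V => B.card ≤ i * m)).filter
        (fun B => B.card = v)).card : ℝ) ≤ n ^ v := le_trans (by exact_mod_cast h3) h4
    calc _ ≤ n ^ v * (nfam r v * (C * (n ^ (v + 1))⁻¹)) :=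
          mul_le_mul_of_nonneg_right h5 (by positivity)
      _ = C * nfam r v * n⁻¹ := by
          rw [pow_succ]; field_simp
  · intro B hB
    rw [(mem_filter.1 hB).2]

end Families

end

section
open Finset Function Filter Topology

/-- Asymptotic independence hypotheses for a sequence of weights on perfect matchings. -/
structure PHyp (r : ℕ) (F : Filter ℕ) (ω : ∀ n, (Fin n × Fin r → Fin n × Fin r) → ℝ)
    (ℓ : ℕ → ℝ) : Prop where
  le_atTop : F ≤ atTop
  nonneg : ∀ n M, 0 ≤ ω n M
  rate_nonneg : ∀ k, 0 ≤ ℓ k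
  bound : ∀ l, ∃ C : ℝ, 0 ≤ C ∧ ∀ᶠ n in F, ∀ g : Fin n × Fin r → Fin n × Fin r,
    (∀ x, g (g x) = x) → (mv g).card = 2 * l → wt (ω n) {g} ≤ C * ((n : ℝ) ^ l)⁻¹
  lim : ∀ K, ∀ ε : ℝ, 0 < ε → ∀ᶠ n in F, ∀ A : Finset (Fin n × Fin r → Fin n × Fin r),
    (∀ c ∈ A, IsCyc c) → Disj A → tot A = K →
      |(n : ℝ) ^ K * wt (ω n) A - ∏ c ∈ A, ℓ (tch c).card| ≤ ε

section Counting
variable {V : Type*} [Fintype V] [DecidableEq V] {r : ℕ}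

lemma sum_cycs (m : ℕ) (f : ℕ → ℝ) :
    ∑ c ∈ cycs V r m, f (tch c).card = ∑ k ∈ Icc 1 m, ((cyc V r k).card : ℝ) * f k := by
  classical
  have hmaps : ∀ c ∈ cycs V r m, (tch c).card ∈ Icc 1 m := fun c hc =>
    mem_Icc.2 ⟨(mem_cycs.1 hc).1.tch_pos, (mem_cycs.1 hc).2⟩
  rw [← sum_fiberwise_of_maps_to hmaps]
  refine sum_congr rfl fun k hk => ?_
  have : (cycs V r m).filter (fun c => (tch c).card = k) = cyc V r k := by
    ext c
    rw [mem_filter, mem_cycs, mem_cyc]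
    have := (mem_Icc.1 hk).2
    constructor
    · rintro ⟨⟨h1, h2⟩, h3⟩; exact ⟨h1, h3⟩
    · rintro ⟨h1, h3⟩; exact ⟨⟨h1, by omega⟩, h3⟩
  rw [this, sum_congr rfl (g := fun _ => f k), sum_const, nsmul_eq_mul]
  intro c hc
  rw [(mem_cyc.1 hc).2]

/-- Expected-count constants. -/
noncomputable def lamc (r k : ℕ) : ℝ := ((r : ℝ) * (r - 1)) ^ k / (2 * k)

lemma tendsto_card_cyc (r : ℕ) {k : ℕ} (hk : 1 ≤ k) :
    Tendsto (fun n : ℕ => ((cyc (Fin n) r k).card : ℝ) * ((n : ℝ) ^ k)⁻¹) atTop (𝓝 (lamc r k)) := by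
  have h1 : Tendsto (fun n : ℕ => (n.choose k : ℝ) * ((n : ℝ) ^ k)⁻¹) atTop (𝓝 ((k.factorial : ℝ)⁻¹)) := by
    have h2 := (isEquivalent_choose k).mul
      (Asymptotics.IsEquivalent.refl (u := fun n : ℕ => ((n : ℝ) ^ k)⁻¹) (l := atTop))
    refine h2.symm.tendsto_nhds ?_
    refine tendsto_const_nhds.congr' ?_
    filter_upwards [eventually_gt_atTop 0] with n hn
    have : (n : ℝ) ≠ 0 := by exact_mod_cast hn.ne'
    simp only [Pi.mul_apply]
    field_simp
  have h3 := h1.mul_const (((r.choose 2 : ℕ) : ℝ) ^ k * cc k)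
  have e : ((k.factorial : ℝ)⁻¹) * (((r.choose 2 : ℕ) : ℝ) ^ k * cc k) = lamc r k := by
    obtain ⟨j, rfl⟩ := Nat.exists_eq_add_of_le' hk
    rw [Nat.cast_choose_two, lamc, cc, Nat.factorial_succ]
    simp only [Nat.add_sub_cancel]
    push_cast
    have : (j.factorial : ℝ) ≠ 0 := by exact_mod_cast j.factorial_ne_zero
    have : (j : ℝ) + 1 ≠ 0 := by positivity
    rw [div_pow]
    field_simp
    ring
  rw [e] at h3
  refine h3.congr fun n => ?_
  rw [card_cyc hk, Fintype.card_fin]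
  push_cast
  ring

lemma tendsto_sum_cycs (r m : ℕ) (f : ℕ → ℝ) :
    Tendsto (fun n : ℕ => ∑ c ∈ cycs (Fin n) r m, f (tch c).card * ((n : ℝ) ^ (tch c).card)⁻¹) atTop
      (𝓝 (∑ k ∈ Icc 1 m, f k * lamc r k)) := by
  have : Tendsto (fun n : ℕ => ∑ k ∈ Icc 1 m, f k * (((cyc (Fin n) r k).card : ℝ) * ((n : ℝ) ^ k)⁻¹))
      atTop (𝓝 (∑ k ∈ Icc 1 m, f k * lamc r k)) :=
    tendsto_finsetSum _ fun k hk => (tendsto_card_cyc r (mem_Icc.1 hk).1).const_mul _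
  refine this.congr fun n => ?_
  rw [sum_cycs m (fun k => f k * ((n : ℝ) ^ k)⁻¹)]
  exact sum_congr rfl fun k _ => by ring

end Counting

section Wt
variable {V : Type*} [Fintype V] [DecidableEq V] {r : ℕ}

/-- Weighted factorial moments. -/
def fmom (ω : (V × Fin r → V × Fin r) → ℝ) (p : ℕ → ℝ) (cs : Finset (V × Fin r → V × Fin r))
    (i : ℕ) : ℝ := ∑ A ∈ powersetCard i cs, (∏ c ∈ A, p (tch c).card) * wt ω A

open scoped Classical in
/-- Weighted expectation of the product over contained cycles. -/
noncomputable def eprod (ω : (V × Fin r → V × Fin r) → ℝ) (p : ℕ → ℝ)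
    (cs : Finset (V × Fin r → V × Fin r)) : ℝ :=
  ∑ M ∈ invs univ, ω M * ∏ c ∈ cs.filter (fun c => Sub c M), (1 - p (tch c).card)

lemma wt_nonneg {ω : (V × Fin r → V × Fin r) → ℝ} (h : ∀ M, 0 ≤ ω M) (A) : 0 ≤ wt ω A :=
  sum_nonneg fun M _ => h M

open scoped Classical in
lemma fmom_eq (ω : (V × Fin r → V × Fin r) → ℝ) (p : ℕ → ℝ)
    (cs : Finset (V × Fin r → V × Fin r)) (i : ℕ) :
    fmom ω p cs i = ∑ M ∈ invs univ, ω M *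
      es (fun c => p (tch c).card) (cs.filter fun c => Sub c M) i := by
  have h1 : ∀ M, es (fun c => p (tch c).card) (cs.filter fun c => Sub c M) i
      = ∑ A ∈ powersetCard i cs, if ∀ c ∈ A, Sub c M then ∏ c ∈ A, p (tch c).card else 0 := by
    intro M
    rw [es, ← sum_filter]
    refine sum_congr ?_ fun _ _ => rfl
    ext A
    simp only [mem_powersetCard, mem_filter, subset_iff]
    constructor
    · rintro ⟨h, hc⟩; exact ⟨⟨fun x hx => (h hx).1, hc⟩, fun c hc => (h hc).2⟩
    · rintro ⟨⟨h, hc⟩, h'⟩; exact ⟨fun x hx => ⟨h hx, h' x hx⟩, hc⟩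
  simp only [h1, mul_sum]
  rw [sum_comm, fmom]
  refine sum_congr rfl fun A _ => ?_
  rw [wt, sum_filter, mul_sum]
  refine sum_congr rfl fun M _ => ?_
  split_ifs <;> ring

lemma eprod_approx {ω : (V × Fin r → V × Fin r) → ℝ} (hω : ∀ M, 0 ≤ ω M) {p : ℕ → ℝ}
    (hp : ∀ k, 0 ≤ p k ∧ p k ≤ 1) (cs : Finset (V × Fin r → V × Fin r)) (J : ℕ) :
    |eprod ω p cs - ∑ i ∈ range J, (-1) ^ i * fmom ω p cs i| ≤ fmom ω p cs J := by
  classical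
  have : eprod ω p cs - ∑ i ∈ range J, (-1) ^ i * fmom ω p cs i =
      ∑ M ∈ invs univ, ω M * (∏ c ∈ cs.filter (fun c => Sub c M), (1 - p (tch c).card) -
        ∑ i ∈ range J, (-1) ^ i * es (fun c => p (tch c).card) (cs.filter fun c => Sub c M) i) := by
    simp only [mul_sub, sum_sub_distrib, mul_sum]
    congr 1
    rw [sum_comm]
    refine sum_congr rfl fun i _ => ?_
    rw [fmom_eq, mul_sum]
    refine sum_congr rfl fun M _ => ?_
    rw [mul_left_comm]
  rw [this, fmom_eq]
  refine (abs_sum_le_sum_abs _ _).trans (sum_le_sum fun M _ => ?_)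
  rw [abs_mul, abs_of_nonneg (hω M)]
  refine mul_le_mul_of_nonneg_left ?_ (hω M)
  have := bonferroni_abs (fun c : V × Fin r → V × Fin r => p (tch c).card)
    (cs.filter fun c => Sub c M) (fun c _ => hp _) J
  convert this

/-- Comparison of the weighted expectation with the independent product. -/
lemma eprod_sub_prod {ω : (V × Fin r → V × Fin r) → ℝ} (hω : ∀ M, 0 ≤ ω M) {p : ℕ → ℝ}
    (hp : ∀ k, 0 ≤ p k ∧ p k ≤ 1) (cs : Finset (V × Fin r → V × Fin r))
    {b : (V × Fin r → V × Fin r) → ℝ} (hb : ∀ c ∈ cs, 0 ≤ b c ∧ b c ≤ 1) (J : ℕ) :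
    |eprod ω p cs - ∏ c ∈ cs, (1 - b c)| ≤
      ∑ i ∈ range (J + 1), |fmom ω p cs i - es b cs i| + 2 * es b cs J := by
  have h1 := abs_le.1 (eprod_approx hω hp cs J)
  have h2 := abs_le.1 (bonferroni_abs b cs hb J)
  have h3 : |∑ i ∈ range J, (-1) ^ i * fmom ω p cs i - ∑ i ∈ range J, (-1) ^ i * es b cs i| ≤
      ∑ i ∈ range J, |fmom ω p cs i - es b cs i| := by
    rw [← sum_sub_distrib]
    refine (abs_sum_le_sum_abs _ _).trans (sum_le_sum fun i _ => ?_)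
    rw [← mul_sub, abs_mul, abs_pow, abs_neg, abs_one, one_pow, one_mul]
  have h3 := abs_le.1 h3
  have h4 := le_abs_self (fmom ω p cs J - es b cs J)
  rw [sum_range_succ, abs_le]
  constructor <;> linarith

end Wt

end

section
open Finset Function Filter Topology

section
variable {r : ℕ} {F : Filter ℕ} {ω : ∀ n, (Fin n × Fin r → Fin n × Fin r) → ℝ} {ℓ : ℕ → ℝ}

/-- A uniform version of `PHyp.bound` over families that are not disjoint. -/
lemma PHyp.wt_not_disj (h : PHyp r F ω ℓ) (m i : ℕ) : ∃ C : ℝ, 0 ≤ C ∧ ∀ᶠ n in F,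
    ∀ A ∈ powersetCard i (cycs (Fin n) r m), ¬ Disj A →
      wt (ω n) A ≤ C * ((n : ℝ) ^ ((tchs A).card + 1))⁻¹ := by
  choose C hC0 hC using h.bound
  refine ⟨∑ l ∈ range (i * m + 1), C l, sum_nonneg fun l _ => hC0 l, ?_⟩
  have hall : ∀ᶠ n in F, ∀ l ∈ range (i * m + 1), ∀ g : Fin n × Fin r → Fin n × Fin r,
      (∀ x, g (g x) = x) → (mv g).card = 2 * l → wt (ω n) {g} ≤ C l * ((n : ℝ) ^ l)⁻¹ :=
    (eventually_all_finset _).2 fun l _ => hC l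
  filter_upwards [hall, h.le_atTop (eventually_ge_atTop 1)] with n hn hn1 A hA hdis
  have hCs : 0 ≤ ∑ l ∈ range (i * m + 1), C l := sum_nonneg fun l _ => hC0 l
  have hAc : ∀ c ∈ A, IsCyc c := fun c hc => (mem_cycs.1 ((mem_powersetCard.1 hA).1 hc)).1
  have hn1' : (1 : ℝ) ≤ n := by exact_mod_cast hn1
  by_cases hM : ∃ M ∈ invs (univ : Finset (Fin n × Fin r)), ∀ c ∈ A, Sub c M
  · obtain ⟨M, hMi, hM⟩ := hM
    obtain ⟨g, hgi, hgm, hg⟩ := exists_glue hAc hMi hM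
    obtain ⟨l, hl⟩ := (even_card_mv hgi).two_dvd
    have h1 := excess hAc hdis hM
    rw [← hgm, hl] at h1
    have h2 : 2 * l ≤ 2 * (i * m) := by
      rw [← hl, hgm]
      refine card_biUnion_le.trans ?_
      rw [← (mem_powersetCard.1 hA).2, mul_left_comm, ← smul_eq_mul, ← sum_const]
      refine sum_le_sum fun c hc => ?_
      rw [card_of_twoFib (hAc c hc).two]
      have := (mem_cycs.1 ((mem_powersetCard.1 hA).1 hc)).2
      omega
    have hl' : l ∈ range (i * m + 1) := by rw [mem_range]; omega
    rw [hg]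
    refine (hn l hl' g hgi hl).trans ?_
    refine mul_le_mul (single_le_sum (fun l _ => hC0 l) hl') ?_ (by positivity) hCs
    exact inv_anti₀ (by positivity) (pow_le_pow_right₀ hn1' (by omega))
  · have : wt (ω n) A = 0 := by
      rw [wt, sum_eq_zero]
      intro M hM'
      rw [mem_filter] at hM'
      exact absurd ⟨M, hM'⟩ hM
    rw [this]; positivity

lemma prod_pow_tot {V : Type*} [Fintype V] [DecidableEq V]
    (A : Finset (V × Fin r → V × Fin r)) (x : ℝ) :
    ∏ c ∈ A, (x ^ (tch c).card)⁻¹ = (x ^ tot A)⁻¹ := by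
  rw [prod_inv_distrib, tot, prod_pow_eq_pow_sum]

lemma PHyp.tendsto_fmom (h : PHyp r F ω ℓ) {p : ℕ → ℝ} (hp : ∀ k, 0 ≤ p k ∧ p k ≤ 1) (m i : ℕ) :
    Tendsto (fun n : ℕ => |fmom (ω n) p (cycs (Fin n) r m) i -
      es (fun c => p (tch c).card * ℓ (tch c).card * ((n : ℝ) ^ (tch c).card)⁻¹)
        (cycs (Fin n) r m) i|) F (𝓝 0) := by
  obtain ⟨C, hC0, hC⟩ := h.wt_not_disj m i
  set L : ℝ := 1 + ∑ k ∈ Icc 1 m, ℓ k with hL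
  have hL1 : 1 ≤ L := by
    have : 0 ≤ ∑ k ∈ Icc 1 m, ℓ k := sum_nonneg fun k _ => h.rate_nonneg k
    rw [hL]; linarith
  have hLk : ∀ k ∈ Icc 1 m, ℓ k ≤ L := fun k hk => by
    have := single_le_sum (f := ℓ) (fun k _ => h.rate_nonneg k) hk
    rw [hL]; linarith
  set N : ℝ := ∑ v ∈ range (i * m + 1), (nfam r v : ℝ) with hN
  have hlimS := (tendsto_sum_cycs r m (fun _ => 1)).mono_left h.le_atTop
  set B : ℝ := ∑ k ∈ Icc 1 m, 1 * lamc r k with hB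
  have hinv : Tendsto (fun n : ℕ => (C + L ^ i) * N * (n : ℝ)⁻¹) F (𝓝 0) := by
    have := (tendsto_inv_atTop_nhds_zero_nat (𝕜 := ℝ)).mono_left h.le_atTop
    simpa using this.const_mul ((C + L ^ i) * N)
  rw [Metric.tendsto_nhds]
  intro δ hδ
  set ε : ℝ := δ / 2 / Real.exp (B + 1) with hε
  have hε0 : 0 < ε := by positivity
  have hall : ∀ᶠ n in F, ∀ K ∈ range (i * m + 1), ∀ A : Finset (Fin n × Fin r → Fin n × Fin r),
      (∀ c ∈ A, IsCyc c) → Disj A → tot A = K →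
      |(n : ℝ) ^ K * wt (ω n) A - ∏ c ∈ A, ℓ (tch c).card| ≤ ε :=
    (eventually_all_finset _).2 fun K _ => h.lim K ε hε0
  filter_upwards [hC, hall, h.le_atTop (eventually_ge_atTop 1),
    hlimS.eventually_le_const (show B < B + 1 by linarith),
    hinv.eventually_lt_const (show 0 < δ / 2 by positivity)] with n hCn hn hn1 hSn hNn
  have hn1' : (1 : ℝ) ≤ n := by exact_mod_cast hn1
  have hn0 : (0 : ℝ) < n := by linarith
  rw [Real.dist_0_eq_abs, abs_abs]
  set cs := cycs (Fin n) r m with hcs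
  have hmem : ∀ A ∈ powersetCard i cs, ∀ c ∈ A, IsCyc c ∧ (tch c).card ∈ Icc 1 m := by
    intro A hA c hc
    have := mem_cycs.1 ((mem_powersetCard.1 hA).1 hc)
    exact ⟨this.1, mem_Icc.2 ⟨this.1.tch_pos, this.2⟩⟩
  have hpp : ∀ A : Finset (Fin n × Fin r → Fin n × Fin r),
      0 ≤ ∏ c ∈ A, p (tch c).card ∧ ∏ c ∈ A, p (tch c).card ≤ 1 := fun A =>
    ⟨prod_nonneg fun c _ => (hp _).1, prod_le_one (fun c _ => (hp _).1) fun c _ => (hp _).2⟩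
  set b : (Fin n × Fin r → Fin n × Fin r) → ℝ :=
    fun c => p (tch c).card * ℓ (tch c).card * ((n : ℝ) ^ (tch c).card)⁻¹ with hb
  have hbA : ∀ A : Finset (Fin n × Fin r → Fin n × Fin r), ∏ c ∈ A, b c =
      (∏ c ∈ A, p (tch c).card) * (∏ c ∈ A, ℓ (tch c).card) * ((n : ℝ) ^ tot A)⁻¹ := by
    intro A
    rw [hb, prod_mul_distrib, prod_mul_distrib, prod_pow_tot]
  have hdiff : fmom (ω n) p cs i - es b cs i = ∑ A ∈ powersetCard i cs,
      ((∏ c ∈ A, p (tch c).card) * wt (ω n) A - ∏ c ∈ A, b c) := by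
    rw [sum_sub_distrib, fmom, es]
  rw [hdiff]
  refine (abs_sum_le_sum_abs _ _).trans_lt ?_
  classical
  rw [← sum_filter_add_sum_filter_not (powersetCard i cs) (fun A => Disj A)]
  have hpart1 : ∑ A ∈ (powersetCard i cs).filter (fun A => Disj A),
      |(∏ c ∈ A, p (tch c).card) * wt (ω n) A - ∏ c ∈ A, b c| ≤ δ / 2 := by
    have h1 : ∀ A ∈ (powersetCard i cs).filter (fun A => Disj A),
        |(∏ c ∈ A, p (tch c).card) * wt (ω n) A - ∏ c ∈ A, b c| ≤
          ε * ∏ c ∈ A, (1 * ((n : ℝ) ^ (tch c).card)⁻¹) := by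
      intro A hA
      rw [mem_filter] at hA
      have htot : tot A ∈ range (i * m + 1) := by
        rw [mem_range, Nat.lt_succ_iff, tot, ← (mem_powersetCard.1 hA.1).2, ← smul_eq_mul, ← sum_const]
        exact sum_le_sum fun c hc => (mem_Icc.1 (hmem A hA.1 c hc).2).2
      have h2 := hn _ htot A (fun c hc => (hmem A hA.1 c hc).1) hA.2 rfl
      have e : (∏ c ∈ A, p (tch c).card) * wt (ω n) A - ∏ c ∈ A, b c =
          (∏ c ∈ A, p (tch c).card) * (((n : ℝ) ^ tot A)⁻¹ *
            ((n : ℝ) ^ tot A * wt (ω n) A - ∏ c ∈ A, ℓ (tch c).card)) := by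
        rw [hbA]; field_simp
      simp only [one_mul]
      rw [e, abs_mul, abs_mul, abs_of_nonneg (hpp A).1, abs_of_pos (show 0 < ((n : ℝ) ^ tot A)⁻¹ by positivity),
        prod_pow_tot, mul_comm ε]
      calc _ ≤ 1 * (((n : ℝ) ^ tot A)⁻¹ * ε) := by
            refine mul_le_mul (hpp A).2 (mul_le_mul_of_nonneg_left h2 (by positivity))
              (by positivity) zero_le_one
        _ = _ := one_mul _
    refine (sum_le_sum h1).trans ?_
    rw [← mul_sum]
    have h3 : ∑ A ∈ (powersetCard i cs).filter (fun A => Disj A),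
        ∏ c ∈ A, (1 * ((n : ℝ) ^ (tch c).card)⁻¹) ≤
        es (fun c => 1 * ((n : ℝ) ^ (tch c).card)⁻¹) cs i :=
      sum_le_sum_of_subset_of_nonneg (filter_subset _ _)
        fun A _ _ => prod_nonneg fun c _ => by positivity
    have h4 := pow_mul_es_le (p := fun c : Fin n × Fin r → Fin n × Fin r => 1 * ((n : ℝ) ^ (tch c).card)⁻¹)
      (A := cs) (fun c _ => by positivity) zero_le_one i
    rw [one_pow, one_mul, one_mul] at h4
    have h5 := h3.trans (h4.trans (Real.exp_le_exp.2 hSn))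
    calc _ ≤ ε * Real.exp (B + 1) := mul_le_mul_of_nonneg_left h5 hε0.le
      _ = δ / 2 := by rw [hε]; field_simp
  have hpart2 : ∑ A ∈ (powersetCard i cs).filter (fun A => ¬ Disj A),
      |(∏ c ∈ A, p (tch c).card) * wt (ω n) A - ∏ c ∈ A, b c| < δ / 2 := by
    have : Nonempty (Fin n) := ⟨⟨0, hn1⟩⟩
    refine lt_of_le_of_lt (sum_families_le (m := m) (i := i) (filter_subset _ _)
      (C := C + L ^ i) (by positivity) ?_) ?_
    · intro A hA
      rw [mem_filter] at hA
      rw [Fintype.card_fin, add_mul]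
      refine (abs_sub _ _).trans (add_le_add ?_ ?_)
      · rw [abs_mul, abs_of_nonneg (hpp A).1, abs_of_nonneg (wt_nonneg (h.nonneg n) A)]
        exact (mul_le_of_le_one_left (wt_nonneg (h.nonneg n) A) (hpp A).2).trans (hCn A hA.1 hA.2)
      · have hl0 : 0 ≤ ∏ c ∈ A, ℓ (tch c).card := prod_nonneg fun c _ => h.rate_nonneg _
        have hl1 : ∏ c ∈ A, ℓ (tch c).card ≤ L ^ i := by
          rw [← (mem_powersetCard.1 hA.1).2, ← prod_const]
          exact prod_le_prod (fun c _ => h.rate_nonneg _) fun c hc => hLk _ (hmem A hA.1 c hc).2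
        rw [hbA, abs_of_nonneg (mul_nonneg (mul_nonneg (hpp A).1 hl0) (by positivity))]
        refine mul_le_mul ((mul_le_of_le_one_left hl0 (hpp A).2).trans hl1) ?_ (by positivity)
          (by positivity)
        exact inv_anti₀ (by positivity) (pow_le_pow_right₀ hn1' (card_tchs_lt_tot hA.2))
    · rw [Fintype.card_fin]
      convert hNn using 3
      rw [hN]; push_cast; rfl
  linarith

end

end

section
open Finset Function Filter Topology

section
variable {r : ℕ} {F : Filter ℕ} {ω : ∀ n, (Fin n × Fin r → Fin n × Fin r) → ℝ} {ℓ : ℕ → ℝ}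

lemma exp_neg_div_le {x : ℝ} (h1 : x < 1) : Real.exp (-(x / (1 - x))) ≤ 1 - x := by
  have hx : 0 < 1 - x := by linarith
  rw [Real.exp_neg]
  have h2 : x / (1 - x) = (1 - x)⁻¹ - 1 := by field_simp; ring
  have h3 := Real.add_one_le_exp (x / (1 - x))
  rw [h2] at h3 ⊢
  have h4 : (1 - x)⁻¹ ≤ Real.exp ((1 - x)⁻¹ - 1) := by linarith
  calc _ ≤ ((1 - x)⁻¹)⁻¹ := inv_anti₀ (by positivity) h4
    _ = 1 - x := inv_inv _

/-- Products over a vanishing array with convergent sums. -/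
lemma tendsto_prod_one_sub {ι : ℕ → Type*} (s : ∀ n, Finset (ι n)) (b : ∀ n, ι n → ℝ) {Λ : ℝ}
    {e : ℕ → ℝ} (he : Tendsto e F (𝓝 0)) (hb : ∀ᶠ n in F, ∀ c ∈ s n, 0 ≤ b n c ∧ b n c ≤ e n)
    (hΛ : Tendsto (fun n => ∑ c ∈ s n, b n c) F (𝓝 Λ)) :
    Tendsto (fun n => ∏ c ∈ s n, (1 - b n c)) F (𝓝 (Real.exp (-Λ))) := by
  have hup : Tendsto (fun n => Real.exp (-∑ c ∈ s n, b n c)) F (𝓝 (Real.exp (-Λ))) :=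
    (Real.continuous_exp.tendsto _).comp hΛ.neg
  have hlo : Tendsto (fun n => Real.exp (-((∑ c ∈ s n, b n c) * (1 - e n)⁻¹))) F
      (𝓝 (Real.exp (-Λ))) := by
    have h1 : Tendsto (fun n => (1 - e n)⁻¹) F (𝓝 1) := by
      have := (he.const_sub 1).inv₀ (by norm_num)
      simpa using this
    have h2 := (hΛ.mul h1).neg
    rw [mul_one] at h2
    exact (Real.continuous_exp.tendsto _).comp h2
  have hlt := he.eventually_lt_const (show (0 : ℝ) < 1 by norm_num)
  refine tendsto_of_tendsto_of_tendsto_of_le_of_le' hlo hup ?_ ?_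
  · filter_upwards [hb, hlt] with n hn hn1
    rw [sum_mul, ← sum_neg_distrib, Real.exp_sum]
    refine prod_le_prod (fun _ _ => (Real.exp_pos _).le) fun c hc => ?_
    obtain ⟨h0, h1⟩ := hn c hc
    refine le_trans (Real.exp_le_exp.2 ?_) (exp_neg_div_le (by linarith : b n c < 1))
    rw [neg_le_neg_iff, div_eq_mul_inv]
    exact mul_le_mul_of_nonneg_left (inv_anti₀ (by linarith) (by linarith)) h0
  · filter_upwards [hb, hlt] with n hn hn1
    rw [← sum_neg_distrib, Real.exp_sum]
    refine prod_le_prod (fun c hc => ?_) fun c hc => ?_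
    · have := hn c hc; linarith
    · have := Real.add_one_le_exp (-b n c); linarith

/-- Poisson limit for short cycles. -/
theorem PHyp.tendsto_eprod (h : PHyp r F ω ℓ) {p : ℕ → ℝ} (hp : ∀ k, 0 ≤ p k ∧ p k ≤ 1) (m : ℕ) :
    Tendsto (fun n : ℕ => eprod (ω n) p (cycs (Fin n) r m)) F
      (𝓝 (Real.exp (-∑ k ∈ Icc 1 m, p k * ℓ k * lamc r k))) := by
  set Λ := ∑ k ∈ Icc 1 m, p k * ℓ k * lamc r k with hΛ
  set b : ∀ n : ℕ, (Fin n × Fin r → Fin n × Fin r) → ℝ := fun n c =>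
    p (tch c).card * ℓ (tch c).card * ((n : ℝ) ^ (tch c).card)⁻¹ with hb
  have hsum : Tendsto (fun n => ∑ c ∈ cycs (Fin n) r m, b n c) F (𝓝 Λ) :=
    (tendsto_sum_cycs r m (fun k => p k * ℓ k)).mono_left h.le_atTop
  set L : ℝ := ∑ k ∈ Icc 1 m, ℓ k with hL
  have hL0 : 0 ≤ L := sum_nonneg fun k _ => h.rate_nonneg k
  have he : Tendsto (fun n : ℕ => L * (n : ℝ)⁻¹) F (𝓝 0) := by
    simpa using ((tendsto_inv_atTop_nhds_zero_nat (𝕜 := ℝ)).mono_left h.le_atTop).const_mul L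
  have hbe : ∀ᶠ n in F, ∀ c ∈ cycs (Fin n) r m, 0 ≤ b n c ∧ b n c ≤ L * (n : ℝ)⁻¹ := by
    filter_upwards [h.le_atTop (eventually_ge_atTop 1)] with n hn c hc
    have hn' : (1 : ℝ) ≤ n := by exact_mod_cast hn
    have hk := (mem_cycs.1 hc).1.tch_pos
    have hk' : (tch c).card ∈ Icc 1 m := mem_Icc.2 ⟨hk, (mem_cycs.1 hc).2⟩
    have hl0 := h.rate_nonneg (tch c).card
    have hpk := hp (tch c).card
    refine ⟨mul_nonneg (mul_nonneg hpk.1 hl0) (by positivity), ?_⟩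
    refine mul_le_mul ?_ ?_ (by positivity) hL0
    · exact (mul_le_of_le_one_left hl0 hpk.2).trans
        (single_le_sum (f := ℓ) (fun k _ => h.rate_nonneg k) hk')
    · exact inv_anti₀ (by linarith) (le_self_pow₀ hn' (by omega))
  have hprod := tendsto_prod_one_sub (fun n => cycs (Fin n) r m) b he hbe hsum
  suffices hdiff : Tendsto (fun n => eprod (ω n) p (cycs (Fin n) r m) -
      ∏ c ∈ cycs (Fin n) r m, (1 - b n c)) F (𝓝 0) by
    simpa using hdiff.add hprod
  rw [Metric.tendsto_nhds]
  intro δ hδ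
  obtain ⟨J, hJ⟩ := exists_pow_lt_of_lt_one
    (show 0 < δ / 2 / (2 * Real.exp (2 * (Λ + 1))) by positivity) (show (1 / 2 : ℝ) < 1 by norm_num)
  have hsum2 : Tendsto (fun n => ∑ i ∈ range (J + 1), |fmom (ω n) p (cycs (Fin n) r m) i -
      es (b n) (cycs (Fin n) r m) i|) F (𝓝 0) := by
    have := tendsto_finsetSum (range (J + 1)) fun i _ => h.tendsto_fmom hp m i
    simpa using this
  filter_upwards [hbe, he.eventually_le_const (show (0 : ℝ) < 1 by norm_num),
    hsum.eventually_le_const (show Λ < Λ + 1 by linarith),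
    hsum2.eventually_lt_const (show 0 < δ / 2 by positivity)] with n hn1 hn2 hn3 hn4
  rw [Real.dist_0_eq_abs]
  refine (eprod_sub_prod (h.nonneg n) hp _ (fun c hc => ⟨(hn1 c hc).1, (hn1 c hc).2.trans hn2⟩)
    J).trans_lt ?_
  have h5 := pow_mul_es_le (fun c hc => (hn1 c hc).1) (zero_le_two) J
  have h6 := h5.trans (Real.exp_le_exp.2 (mul_le_mul_of_nonneg_left hn3 zero_le_two))
  have h7 : 2 * es (b n) (cycs (Fin n) r m) J < δ / 2 := by
    rw [lt_div_iff₀ (by positivity)] at hJ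
    have e : es (b n) (cycs (Fin n) r m) J =
        (1 / 2) ^ J * (2 ^ J * es (b n) (cycs (Fin n) r m) J) := by
      rw [← mul_assoc, ← mul_pow]; norm_num
    have h8 : es (b n) (cycs (Fin n) r m) J ≤ (1 / 2) ^ J * Real.exp (2 * (Λ + 1)) := by
      rw [e]; exact mul_le_mul_of_nonneg_left h6 (by positivity)
    linarith
  linarith

end

end

section
open Finset Function Filter Topology

/-- Sizes for which perfect matchings of the points exist. -/
def flt (r : ℕ) : Filter ℕ := atTop ⊓ 𝓟 {n | Even (r * n)}

lemma flt_le (r : ℕ) : flt r ≤ atTop := inf_le_left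

lemma eventually_even (r : ℕ) : ∀ᶠ n in flt r, Even (r * n) :=
  (mem_inf_of_right (mem_principal_self _) : {n | Even (r * n)} ∈ flt r)

lemma dm_pos {N : ℕ} (h : Even N) : 0 < dm N := by
  obtain ⟨a, rfl⟩ := h
  induction a with
  | zero => simp [dm]
  | succ a ih =>
    rw [show a + 1 + (a + 1) = a + a + 2 by ring, dm]
    positivity

lemma cc_pos (j : ℕ) : 0 < cc j := by unfold cc; positivity

lemma tendsto_div_affine {s : ℕ} (hs : 1 ≤ s) (a : ℝ) :
    Tendsto (fun n : ℕ => (n : ℝ) / (s * n - a)) atTop (𝓝 (s : ℝ)⁻¹) := by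
  have hs0 : (s : ℝ) ≠ 0 := by positivity
  have h1 : Tendsto (fun n : ℕ => (s : ℝ) - a * (n : ℝ)⁻¹) atTop (𝓝 (s - a * 0)) :=
    ((tendsto_inv_atTop_nhds_zero_nat (𝕜 := ℝ)).const_mul a).const_sub _
  rw [mul_zero, sub_zero] at h1
  refine (h1.inv₀ hs0).congr' ?_
  filter_upwards [eventually_ge_atTop 1] with n hn
  have hn0 : (n : ℝ) ≠ 0 := by positivity
  have : (s : ℝ) - a * (n : ℝ)⁻¹ = (s * n - a) / n := by field_simp
  rw [this, inv_div]

lemma tendsto_dm {s : ℕ} (hs : 1 ≤ s) (l : ℕ) :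
    Tendsto (fun n : ℕ => (n : ℝ) ^ l * dm (s * n - 2 * l) / dm (s * n)) (flt s)
      (𝓝 ((s : ℝ) ^ l)⁻¹) := by
  induction l with
  | zero =>
    refine (tendsto_const_nhds (x := (1 : ℝ))).congr' ?_ |>.trans (by simp)
    filter_upwards [eventually_even s] with n hn
    have : (dm (s * n) : ℝ) ≠ 0 := by exact_mod_cast (dm_pos hn).ne'
    simp [this]
  | succ l ih =>
    have h := ih.mul ((tendsto_div_affine hs (2 * l + 1 : ℝ)).mono_left (flt_le s))
    rw [← mul_inv, ← pow_succ] at h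
    refine h.congr' ?_
    filter_upwards [(flt_le s) (eventually_ge_atTop (2 * l + 2))] with n hn
    have hle : 2 * l + 2 ≤ s * n := hn.trans (Nat.le_mul_of_pos_left n hs)
    obtain ⟨k, hk⟩ := Nat.exists_eq_add_of_le' hle
    have e1 : s * n - 2 * l = k + 2 := by omega
    have e2 : s * n - 2 * (l + 1) = k := by omega
    have e3 : (s : ℝ) * n - (2 * l + 1) = k + 1 := by
      have : ((s * n : ℕ) : ℝ) = k + (2 * l + 2) := by rw [hk]; push_cast; ring
      push_cast at this; linarith
    rw [e1, e2, e3, dm]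
    push_cast
    have : (k : ℝ) + 1 ≠ 0 := by positivity
    field_simp
    ring

lemma tendsto_cc (j : ℕ) :
    Tendsto (fun n : ℕ => (n : ℝ) ^ j * cc (n - j) / cc n) atTop (𝓝 ((2 : ℝ) ^ j)⁻¹) := by
  induction j with
  | zero =>
    refine (tendsto_const_nhds (x := (1 : ℝ))).congr ?_ |>.trans (by simp)
    intro n
    have : (cc n : ℝ) ≠ 0 := by exact_mod_cast (cc_pos n).ne'
    simp [this]
  | succ j ih =>
    have h := ih.mul (tendsto_div_affine (s := 2) (by norm_num) (2 * j + 2 : ℝ))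
    push_cast at h
    rw [← mul_inv, ← pow_succ] at h
    refine h.congr' ?_
    filter_upwards [eventually_ge_atTop (j + 2)] with n hn
    obtain ⟨k, rfl⟩ := Nat.exists_eq_add_of_le' hn
    have e1 : k + (j + 2) - j = k + 2 := by omega
    have e2 : k + (j + 2) - (j + 1) = k + 1 := by omega
    have e3 : (2 : ℝ) * ((k + (j + 2) : ℕ) : ℝ) - (2 * j + 2) = 2 * (k + 1) := by push_cast; ring
    have e4 : cc (k + 2) = 2 * (k + 1) * cc (k + 1) := by
      simp only [cc, Nat.add_sub_cancel, show k + 2 - 1 = k + 1 by omega, Nat.factorial_succ, pow_succ]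
      ring
    rw [e1, e2, e3, e4]
    have : (k : ℝ) + 1 ≠ 0 := by positivity
    push_cast
    field_simp
    ring

lemma tendsto_cc_dm {s : ℕ} (hs : 1 ≤ s) {j l : ℕ} (hj : j ≤ l) :
    Tendsto (fun n : ℕ => (n : ℝ) ^ l * (cc (n - j) * dm (s * n - 2 * (l - j))) /
      (cc n * dm (s * n))) (flt s) (𝓝 (((2 : ℝ) ^ j)⁻¹ * ((s : ℝ) ^ (l - j))⁻¹)) := by
  refine (((tendsto_cc j).mono_left (flt_le s)).mul (tendsto_dm hs (l - j))).congr fun n => ?_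
  rw [div_mul_div_comm]
  congr 1
  have : (n : ℝ) ^ l = n ^ j * n ^ (l - j) := by rw [← pow_add]; congr 1; omega
  rw [this]; ring

end

section
open Finset Function Filter Topology

section
variable {V : Type*} [Fintype V] [DecidableEq V] {r : ℕ}

open scoped Classical in
/-- The union of a fibre-disjoint family. -/
noncomputable def glue (A : Finset (V × Fin r → V × Fin r)) : V × Fin r → V × Fin r :=
  fun x => if h : ∃ c ∈ A, c x ≠ x then h.choose x else x

variable {A : Finset (V × Fin r → V × Fin r)}

lemma fst_mem_tch {c : V × Fin r → V × Fin r} {x : V × Fin r} (h : c x ≠ x) : x.1 ∈ tch c :=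
  mem_image_of_mem _ (mem_mv.2 h)

lemma glue_eq (hd : Disj A) {c : V × Fin r → V × Fin r} (hc : c ∈ A) {x : V × Fin r}
    (hx : c x ≠ x) : glue A x = c x := by
  have h : ∃ c ∈ A, c x ≠ x := ⟨c, hc, hx⟩
  rw [glue, dif_pos h]
  by_cases he : h.choose = c
  · rw [he]
  · exact absurd (fst_mem_tch hx) (disjoint_left.1 (hd _ h.choose_spec.1 c hc he)
      (fst_mem_tch h.choose_spec.2))

lemma glue_eq_self {x : V × Fin r} (h : ∀ c ∈ A, c x = x) : glue A x = x := by
  rw [glue, dif_neg]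
  push Not
  exact h

lemma mv_glue (hd : Disj A) : mv (glue A) = A.biUnion mv := by
  ext x
  rw [mem_mv, mem_biUnion]
  constructor
  · intro h
    by_contra hc
    push Not at hc
    exact h (glue_eq_self fun c hcA => by simpa using hc c hcA)
  · rintro ⟨c, hc, hx⟩
    rw [mem_mv] at hx
    rwa [glue_eq hd hc hx]

lemma glue_invol (hA : ∀ c ∈ A, IsCyc c) (hd : Disj A) (x : V × Fin r) :
    glue A (glue A x) = x := by
  by_cases h : ∃ c ∈ A, c x ≠ x
  · obtain ⟨c, hc, hx⟩ := h
    rw [glue_eq hd hc hx, glue_eq hd hc, (hA c hc).inv]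
    rw [(hA c hc).inv]; exact hx.symm
  · push Not at h
    rw [glue_eq_self h, glue_eq_self h]

lemma wt_glue (hd : Disj A) (ω : (V × Fin r → V × Fin r) → ℝ) : wt ω A = wt ω {glue A} := by
  unfold wt
  congr 1
  ext M
  simp only [mem_filter, mem_singleton, forall_eq]
  refine and_congr_right fun _ => ⟨fun h x hx => ?_, fun h c hc x hx => ?_⟩
  · obtain ⟨c, hc, hx'⟩ := mem_biUnion.1 (mv_glue hd ▸ mem_mv.2 hx)
    rw [mem_mv] at hx'
    rw [glue_eq hd hc hx', h c hc x hx']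
  · rw [← glue_eq hd hc hx]
    exact h x (by rwa [glue_eq hd hc hx])

lemma card_mv_glue (hA : ∀ c ∈ A, IsCyc c) (hd : Disj A) : (mv (glue A)).card = 2 * tot A := by
  rw [mv_glue hd, card_biUnion, tot, mul_sum]
  · exact sum_congr rfl fun c hc => card_of_twoFib (hA c hc).two
  · intro c hc c' hc' hne
    refine disjoint_left.2 fun x hx hx' => ?_
    exact disjoint_left.1 (hd c hc c' hc' hne) (fst_mem_tch (mem_mv.1 hx)) (fst_mem_tch (mem_mv.1 hx'))

/-- The slices of a fibre-disjoint union. -/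
lemma slice_glue (hd : Disj A) {c : V × Fin r → V × Fin r} (hc : c ∈ A) {v : V} (hv : v ∈ tch c) :
    slice (mv (glue A)) v = slice (mv c) v := by
  rw [mv_glue hd]
  ext i
  rw [mem_slice, mem_slice, mem_biUnion]
  refine ⟨fun ⟨c', hc', h⟩ => ?_, fun h => ⟨c, hc, h⟩⟩
  by_cases he : c' = c
  · rwa [← he]
  · exact absurd hv (disjoint_left.1 (hd c' hc' c hc he) (fst_mem_tch (mem_mv.1 h)))

lemma slice_glue_of_notMem (hd : Disj A) {v : V} (hv : v ∉ tchs A) :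
    slice (mv (glue A)) v = ∅ := by
  rw [eq_empty_iff_forall_notMem]
  intro i hi
  rw [mem_slice, mv_glue hd, mem_biUnion] at hi
  obtain ⟨c, hc, h⟩ := hi
  exact hv (mem_biUnion.2 ⟨c, hc, fst_mem_tch (mem_mv.1 h)⟩)

lemma card_tchs (hd : Disj A) : (tchs A).card = tot A := by
  rw [tchs, card_biUnion hd, tot]

lemma wt_const_singleton {g : V × Fin r → V × Fin r} (hg : ∀ x, g (g x) = x) (a : ℝ) :
    wt (fun _ => a) {g} = dm (r * Fintype.card V - (mv g).card) * a := by
  rw [wt]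
  have : (invs univ).filter (fun M => ∀ c ∈ ({g} : Finset _), Sub c M) = (invs univ).filter (Sub g) := by
    ext M; simp
  rw [this, sum_const, nsmul_eq_mul, card_invs_sub hg (subset_univ _), card_invs, card_sdiff,
    inter_univ, card_univ, Fintype.card_prod, Fintype.card_fin, mul_comm r]

/-- Uniform weights on perfect matchings. -/
noncomputable def wP (r n : ℕ) : (Fin n × Fin r → Fin n × Fin r) → ℝ :=
  fun _ => ((dm (r * n) : ℝ))⁻¹

theorem pHyp_wP {r : ℕ} (hr : 1 ≤ r) :
    PHyp r (flt r) (wP r) (fun k => ((r : ℝ) ^ k)⁻¹) where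
  le_atTop := flt_le r
  nonneg n M := by unfold wP; positivity
  rate_nonneg k := by positivity
  bound l := by
    refine ⟨((r : ℝ) ^ l)⁻¹ + 1, by positivity, ?_⟩
    filter_upwards [(tendsto_dm hr l).eventually_le_const (show ((r : ℝ) ^ l)⁻¹ < ((r : ℝ) ^ l)⁻¹ + 1 by linarith),
      (flt_le r) (eventually_ge_atTop 1)] with n hn hn1 g hg hgl
    unfold wP
    have : (0 : ℝ) < n := by exact_mod_cast hn1
    rw [wt_const_singleton hg, hgl, Fintype.card_fin, ← div_eq_mul_inv, ← div_eq_mul_inv,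
      le_div_iff₀ (by positivity)]
    refine le_trans (le_of_eq ?_) hn
    ring
  lim K ε hε := by
    have h := (Metric.tendsto_nhds.1 (tendsto_dm hr K)) ε hε
    filter_upwards [h] with n hn A hA hd htot
    unfold wP
    rw [wt_glue hd, wt_const_singleton (glue_invol hA hd), card_mv_glue hA hd, htot,
      prod_pow_tot, htot, Fintype.card_fin]
    rw [Real.dist_eq] at hn
    refine le_trans (le_of_eq ?_) hn.le
    congr 2
    ring

end

end

section
open Finset Function Filter Topology

section
variable {V : Type*} [Fintype V] [DecidableEq V] {r : ℕ} {A : Finset (V × Fin r → V × Fin r)}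

lemma mem_mv_of_fst (hd : Disj A) {c : V × Fin r → V × Fin r} (hc : c ∈ A) {x : V × Fin r}
    (hx : x ∈ mv (glue A)) (hv : x.1 ∈ tch c) : x ∈ mv c := by
  have : x.2 ∈ slice (mv (glue A)) x.1 := mem_slice.2 hx
  rw [slice_glue hd hc hv] at this
  exact mem_slice.1 this

lemma acycF_glue (hA : ∀ c ∈ A, IsCyc c) (hd : Disj A) {R : Finset (V × Fin r)}
    (hR : R ∈ subs (glue A)) : AcycF (glue A) R ↔ ∀ c ∈ A, R ∩ mv c ≠ mv c := by
  rw [mem_subs] at hR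
  constructor
  · intro h c hc he
    have hsub : mv c ⊆ R := inter_eq_right.1 he
    have := h (mv c) hsub (fun x hx => ?_) fun x hx => ?_
    · exact (hA c hc).ne.ne_empty this
    · rw [glue_eq hd hc (mem_mv.1 hx)]
      exact mv_closed (hA c hc).inv hx
    · have := (hA c hc).two.other_spec hx
      exact ⟨_, this.1, this.2.1, this.2.2⟩
  · intro h T hT hcl hpart
    by_contra hne
    obtain ⟨x, hx⟩ := nonempty_iff_ne_empty.2 hne
    have hxg := hR.1 (hT hx)
    rw [mv_glue hd, mem_biUnion] at hxg
    obtain ⟨c, hc, hxc⟩ := hxg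
    have h1 : T ∩ mv c = mv (other (mv c)) := by
      refine (hA c hc).conn _ ?_ ⟨x, mem_inter.2 ⟨hx, hxc⟩⟩ ?_
      · rw [(hA c hc).two.mv_other]; exact inter_subset_right
      · intro y hy
        obtain ⟨hyT, hyc⟩ := mem_inter.1 hy
        constructor
        · obtain ⟨z, hz, hzy, hz1⟩ := hpart y hyT
          have hzc : z ∈ mv c := mem_mv_of_fst hd hc (hR.1 (hT hz))
            (hz1 ▸ fst_mem_tch (mem_mv.1 hyc))
          rw [(hA c hc).two.other_eq hyc hzc hz1 hzy]
          exact mem_inter.2 ⟨hz, hzc⟩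
        · have := hcl y hyT
          rw [glue_eq hd hc (mem_mv.1 hyc)] at this
          exact mem_inter.2 ⟨this, mv_closed (hA c hc).inv hyc⟩
    rw [(hA c hc).two.mv_other] at h1
    exact h c hc (inter_eq_right.2 ((inter_eq_right.1 h1).trans hT))

lemma slice_inter_mv (hd : Disj A) {c : V × Fin r → V × Fin r} (hc : c ∈ A)
    {R : Finset (V × Fin r)} (hR : R ⊆ mv (glue A)) {v : V} (hv : v ∈ tch c) :
    slice (R ∩ mv c) v = slice R v := by
  ext i
  simp only [mem_slice, mem_inter, and_iff_left_iff_imp]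
  exact fun h => mem_mv_of_fst hd hc (hR h) hv

open scoped Classical in
lemma sum_subs_glue (hA : ∀ c ∈ A, IsCyc c) (hd : Disj A) (w : ℕ → ℝ) :
    ∑ R ∈ (subs (glue A)).filter (AcycF (glue A)), ∏ v ∈ tchs A, w (slice R v).card =
      ∏ c ∈ A, ∑ R ∈ (subs c).filter (fun R => R ≠ mv c), ∏ v ∈ tch c, w (slice R v).card := by
  rw [prod_sum]
  have hmvd : ∀ c ∈ A, ∀ c' ∈ A, c ≠ c' → Disjoint (mv c) (mv c') := by
    intro c hc c' hc' hne
    exact disjoint_left.2 fun x hx hx' => disjoint_left.1 (hd c hc c' hc' hne)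
      (fst_mem_tch (mem_mv.1 hx)) (fst_mem_tch (mem_mv.1 hx'))
  refine sum_bij' (fun R _ => fun c _ => R ∩ mv c) (fun p _ => A.attach.biUnion fun c => p c.1 c.2)
    ?_ ?_ ?_ ?_ ?_
  · intro R hR
    rw [mem_filter] at hR
    have hac := (acycF_glue hA hd hR.1).1 hR.2
    rw [mem_subs] at hR
    rw [Finset.mem_pi]
    intro c hc
    rw [mem_filter, mem_subs]
    refine ⟨⟨inter_subset_right, fun x hx => ?_⟩, hac c hc⟩
    obtain ⟨hxR, hxc⟩ := mem_inter.1 hx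
    have := hR.1.2 x hxR
    rw [glue_eq hd hc (mem_mv.1 hxc)] at this
    exact mem_inter.2 ⟨this, mv_closed (hA c hc).inv hxc⟩
  · intro p hp
    rw [Finset.mem_pi] at hp
    have hp1 : ∀ c (hc : c ∈ A), p c hc ⊆ mv c ∧ (∀ x ∈ p c hc, c x ∈ p c hc) ∧ p c hc ≠ mv c := by
      intro c hc
      have := mem_filter.1 (hp c hc)
      rw [mem_subs] at this
      exact ⟨this.1.1, this.1.2, this.2⟩
    have hsub : (A.attach.biUnion fun c => p c.1 c.2) ∈ subs (glue A) := by
      rw [mem_subs]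
      constructor
      · intro x hx
        obtain ⟨c, _, hx⟩ := mem_biUnion.1 hx
        rw [mv_glue hd]
        exact mem_biUnion.2 ⟨c.1, c.2, (hp1 _ _).1 hx⟩
      · intro x hx
        obtain ⟨c, hc, hx⟩ := mem_biUnion.1 hx
        rw [glue_eq hd c.2 (mem_mv.1 ((hp1 _ _).1 hx))]
        exact mem_biUnion.2 ⟨c, hc, (hp1 _ _).2.1 x hx⟩
    rw [mem_filter]
    refine ⟨hsub, (acycF_glue hA hd hsub).2 fun c hc he => (hp1 c hc).2.2 ?_⟩
    apply subset_antisymm (hp1 c hc).1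
    intro x hx
    have : x ∈ A.attach.biUnion fun c => p c.1 c.2 := inter_eq_right.1 he hx
    obtain ⟨c', _, hx'⟩ := mem_biUnion.1 this
    by_cases hcc : c = c'.1
    · subst hcc; exact hx'
    · exact absurd ((hp1 _ _).1 hx') (disjoint_left.1 (hmvd c hc c'.1 c'.2 hcc) hx)
  · intro R hR
    rw [mem_filter, mem_subs] at hR
    ext x
    rw [mem_biUnion]
    constructor
    · rintro ⟨c, _, h⟩; exact (mem_inter.1 h).1
    · intro hx
      have := hR.1.1 hx
      rw [mv_glue hd, mem_biUnion] at this
      obtain ⟨c, hc, hxc⟩ := this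
      exact ⟨⟨c, hc⟩, mem_attach _ _, mem_inter.2 ⟨hx, hxc⟩⟩
  · intro p hp
    rw [Finset.mem_pi] at hp
    funext c hc
    have hp1 : ∀ c (hc : c ∈ A), p c hc ⊆ mv c := fun c hc =>
      (mem_subs.1 (mem_filter.1 (hp c hc)).1).1
    ext x
    rw [mem_inter, mem_biUnion]
    constructor
    · rintro ⟨⟨c', _, hx'⟩, hx⟩
      by_cases hcc : c = c'.1
      · subst hcc; exact hx'
      · exact absurd (hp1 _ _ hx') (disjoint_left.1 (hmvd c hc c'.1 c'.2 hcc) hx)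
    · intro hx
      exact ⟨⟨⟨c, hc⟩, mem_attach _ _, hx⟩, hp1 c hc hx⟩
  · intro R hR
    rw [mem_filter, mem_subs] at hR
    rw [tchs, prod_biUnion hd, ← prod_attach A]
    refine prod_congr rfl fun c _ => prod_congr rfl fun v hv => ?_
    rw [slice_inter_mv hd c.2 hR.1.1 hv]

/-- The cycle transfer-matrix sum without the full term. -/
lemma sum_subs_ne {c : V × Fin r → V × Fin r} (hc : IsCyc c) (w : ℕ → ℝ) {α β : ℝ}
    (h1 : α + β = w 0 + w 2) (h2 : α * β = w 0 * w 2 - w 1 ^ 2) :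
    ∑ R ∈ (subs c).filter (fun R => R ≠ mv c), ∏ v ∈ tch c, w (slice R v).card =
      α ^ (tch c).card + β ^ (tch c).card - w 2 ^ (tch c).card := by
  classical
  have hmem : mv c ∈ subs c := mem_subs.2 ⟨subset_rfl, fun x hx => mv_closed hc.inv hx⟩
  have h3 := sum_subs_cyc hc w
  rw [trace_tm_pow w h1 h2, ← add_sum_erase _ _ hmem] at h3
  have h4 : ∏ v ∈ tch c, w (slice (mv c) v).card = w 2 ^ (tch c).card := by
    rw [← prod_const]
    refine prod_congr rfl fun v hv => ?_
    rw [(hc.two v).resolve_left (mem_tch.1 hv)]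
  rw [filter_ne', ← h3, h4]
  ring

end

end

section
open Finset Function Filter Topology

section
variable {V : Type*} [Fintype V] [DecidableEq V] {r : ℕ}

/-- The number of Hamilton cycles contained in a matching. -/
noncomputable def ycnt (M : V × Fin r → V × Fin r) : ℕ := ((ham V r).filter fun h => Sub h M).card

lemma card_ham {n : ℕ} (hn : 1 ≤ n) (r : ℕ) : (ham (Fin n) r).card = r.choose 2 ^ n * cc n := by
  rw [ham, Fintype.card_fin, card_cyc hn, Fintype.card_fin, Nat.choose_self, one_mul]

/-- Size-biased weights. -/
noncomputable def wQ (r n : ℕ) : (Fin n × Fin r → Fin n × Fin r) → ℝ :=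
  fun M => (ycnt M : ℝ) / ((ham (Fin n) r).card * dm (r * n - 2 * n))

/-- The normalized weight of a set of common edges. -/
noncomputable def rho (s l n j : ℕ) : ℝ :=
  (n : ℝ) ^ l * (cc (n - j) * dm (s * n - 2 * (l - j))) / (cc n * dm (s * n))

lemma card_le_of_subs {g : V × Fin r → V × Fin r} {R : Finset (V × Fin r)} (hR : R ∈ subs g) :
    R.card ≤ (mv g).card := card_le_card (mem_subs.1 hR).1

lemma card_subs_le (g : V × Fin r → V × Fin r) : (subs g).card ≤ 2 ^ (mv g).card := by
  rw [← card_powerset]; exact card_filter_le _ _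

variable {s : ℕ} {n : ℕ}

lemma pow_mul_wt_wQ (hr : r = s + 2) (hn : 1 ≤ n) {g : Fin n × Fin r → Fin n × Fin r}
    (hg : ∀ x, g (g x) = x) {l : ℕ} (hl : (mv g).card = 2 * l) :
    (n : ℝ) ^ l * wt (wQ r n) {g} = ∑ R ∈ subs g, ((hs g R).card : ℝ) *
      ((n : ℝ) ^ l * dm (s * n - 2 * (l - R.card / 2)) /
        (((r.choose 2 : ℕ) : ℝ) ^ n * (cc n * dm (s * n)))) := by
  have h1 : (invs univ).filter (fun M => ∀ c ∈ ({g} : Finset _), Sub c M) = (invs univ).filter (Sub g) := by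
    ext M; simp
  have h2 := sum_ham_sub hg
  rw [wt, h1]
  unfold wQ
  rw [← sum_div]
  have h3 : ∑ M ∈ (invs univ).filter (Sub g), (ycnt M : ℝ) =
      ∑ R ∈ subs g, ((hs g R).card : ℝ) * dm (s * n - 2 * (l - R.card / 2)) := by
    unfold ycnt
    rw [← Nat.cast_sum, h2, Nat.cast_sum]
    refine sum_congr rfl fun R hR => ?_
    have he := card_subs_even hg hR
    have hle := card_le_of_subs hR
    have hsn : r * n = s * n + 2 * n := by rw [hr]; ring
    rw [Fintype.card_fin, hl, Nat.cast_mul]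
    congr 3
    omega
  have hd : r * n - 2 * n = s * n := by
    have hsn : r * n = s * n + 2 * n := by rw [hr]; ring
    omega
  rw [h3, card_ham hn, hd, sum_div, mul_sum]
  refine sum_congr rfl fun R _ => ?_
  push_cast
  ring

theorem wQ_bound (hr : r = s + 2) (hs1 : 1 ≤ s) (l : ℕ) :
    ∃ C : ℝ, 0 ≤ C ∧ ∀ᶠ n in flt s, ∀ g : Fin n × Fin r → Fin n × Fin r,
    (∀ x, g (g x) = x) → (mv g).card = 2 * l → wt (wQ r n) {g} ≤ C * ((n : ℝ) ^ l)⁻¹ := by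
  refine ⟨2 ^ (2 * l) * 2, by positivity, ?_⟩
  have hall : ∀ᶠ n in flt s, ∀ j ∈ range (l + 1), rho s l n j ≤ 2 := by
    refine (eventually_all_finset _).2 fun j hj => ?_
    have hj' : j ≤ l := by rw [mem_range] at hj; omega
    refine (tendsto_cc_dm hs1 hj').eventually_le_const ?_
    have h1 : ((2 : ℝ) ^ j)⁻¹ ≤ 1 := inv_le_one_of_one_le₀ (one_le_pow₀ (by norm_num))
    have h2 : ((s : ℝ) ^ (l - j))⁻¹ ≤ 1 :=
      inv_le_one_of_one_le₀ (one_le_pow₀ (by exact_mod_cast hs1))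
    calc _ ≤ (1 : ℝ) * 1 := mul_le_mul h1 h2 (by positivity) zero_le_one
      _ < 2 := by norm_num
  filter_upwards [hall, (flt_le s) (eventually_ge_atTop 1)] with n hn hn1 g hg hl
  have hn0 : (0 : ℝ) < n := by exact_mod_cast hn1
  rw [← div_eq_mul_inv, le_div_iff₀ (by positivity), mul_comm, pow_mul_wt_wQ hr hn1 hg hl]
  have : Nonempty (Fin n) := ⟨⟨0, hn1⟩⟩
  have hc0 : 0 < ((r.choose 2 : ℕ) : ℝ) := by
    exact_mod_cast Nat.choose_pos (by omega)
  have hccn : (0 : ℝ) < cc n := by exact_mod_cast cc_pos n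
  have hb : ∀ R ∈ subs g, ((hs g R).card : ℝ) *
      ((n : ℝ) ^ l * dm (s * n - 2 * (l - R.card / 2)) /
        (((r.choose 2 : ℕ) : ℝ) ^ n * (cc n * dm (s * n)))) ≤ 2 := by
    intro R hR
    have hj : R.card / 2 ∈ range (l + 1) := by
      have := card_le_of_subs hR
      rw [mem_range]; omega
    refine le_trans ?_ (hn _ hj)
    have h3 := card_hs_le hg hR
    rw [Fintype.card_fin] at h3
    have h3' : ((hs g R).card : ℝ) ≤ ((r.choose 2 : ℕ) : ℝ) ^ n * cc (n - R.card / 2) := by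
      exact_mod_cast h3
    refine (mul_le_mul_of_nonneg_right h3' (by positivity)).trans (le_of_eq ?_)
    rw [rho]
    field_simp
  refine (sum_le_sum hb).trans ?_
  rw [sum_const, nsmul_eq_mul]
  refine mul_le_mul_of_nonneg_right ?_ zero_le_two
  have := card_subs_le g
  rw [hl] at this
  exact_mod_cast this

open scoped Classical in
lemma pow_mul_wt_wQ_glue (hr : r = s + 2) (hn : 1 ≤ n) {A : Finset (Fin n × Fin r → Fin n × Fin r)}
    (hA : ∀ c ∈ A, IsCyc c) (hd : Disj A) (hlt : tot A < n) :
    (n : ℝ) ^ tot A * wt (wQ r n) A = ∑ R ∈ (subs (glue A)).filter (AcycF (glue A)),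
      (∏ v ∈ tchs A, ((s.choose (2 - (slice R v).card) : ℕ) : ℝ) / ((r.choose 2 : ℕ) : ℝ)) *
        rho s (tot A) n (R.card / 2) := by
  have hg := glue_invol hA hd
  have : Nonempty (Fin n) := ⟨⟨0, hn⟩⟩
  have hc0 : 0 < ((r.choose 2 : ℕ) : ℝ) := by
    exact_mod_cast Nat.choose_pos (by omega)
  rw [wt_glue hd, pow_mul_wt_wQ hr hn hg (card_mv_glue hA hd), sum_filter]
  refine sum_congr rfl fun R hR => ?_
  have hsl : ∀ v ∈ tchs A, (slice (mv (glue A)) v).card = 2 := by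
    intro v hv
    obtain ⟨c, hc, hvc⟩ := mem_biUnion.1 hv
    rw [slice_glue hd hc hvc, ((hA c hc).two v).resolve_left (mem_tch.1 hvc)]
  have hsl0 : ∀ v, v ∉ tchs A → slice (mv (glue A)) v = ∅ := fun v hv =>
    slice_glue_of_notMem hd hv
  have hRs : ∀ v, (slice R v).card ≤ (slice (mv (glue A)) v).card := fun v =>
    card_le_card (slice_mono (mem_subs.1 hR).1 v)
  have h2 : ∀ v, (slice R v).card ≤ 2 := by
    intro v
    by_cases hv : v ∈ tchs A
    · rw [← hsl v hv]; exact hRs v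
    · have := hRs v
      rw [hsl0 v hv, card_empty] at this; omega
  have hRc := card_le_of_subs hR
  rw [card_mv_glue hA hd] at hRc
  rw [card_hs hg hR h2 (by rw [Fintype.card_fin]; omega), Fintype.card_fin]
  split_ifs with hac
  · have hprod : ((∏ v, (r - (slice (mv (glue A)) v).card).choose (2 - (slice R v).card) : ℕ) : ℝ) =
        ((r.choose 2 : ℕ) : ℝ) ^ n *
          ∏ v ∈ tchs A, ((s.choose (2 - (slice R v).card) : ℕ) : ℝ) / ((r.choose 2 : ℕ) : ℝ) := by
      have hcn : ((r.choose 2 : ℕ) : ℝ) ^ n = ∏ v : Fin n, ((r.choose 2 : ℕ) : ℝ) := by simp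
      have hite : ∏ v ∈ tchs A, ((s.choose (2 - (slice R v).card) : ℕ) : ℝ) / ((r.choose 2 : ℕ) : ℝ) =
          ∏ v, if v ∈ tchs A then ((s.choose (2 - (slice R v).card) : ℕ) : ℝ) / ((r.choose 2 : ℕ) : ℝ)
            else 1 := by
        rw [prod_ite_mem, univ_inter]
      rw [hite, hcn, ← prod_mul_distrib, Nat.cast_prod]
      refine prod_congr rfl fun v _ => ?_
      split_ifs with hv
      · rw [hsl v hv, show r - 2 = s by omega]
        field_simp
      · have := hRs v
        rw [hsl0 v hv, card_empty] at this
        rw [hsl0 v hv, card_empty, show (slice R v).card = 0 by omega, mul_one]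
        rfl
    push_cast at hprod ⊢
    rw [hprod, rho]
    field_simp
  · simp

end

end

section
open Finset Function Filter Topology

section
variable {V : Type*} [Fintype V] [DecidableEq V] {r s : ℕ}

/-- Cycle rates under the size-biased weights. -/
noncomputable def lQ (s k : ℕ) : ℝ := (((s : ℝ) + 1) ^ k + (-1) ^ k - 1) / (((s : ℝ) + 2) * (s + 1)) ^ k

lemma lQ_nonneg (hs : 1 ≤ s) (k : ℕ) : 0 ≤ lQ s k := by
  unfold lQ
  refine div_nonneg ?_ (by positivity)
  have hs' : (1 : ℝ) ≤ s := by exact_mod_cast hs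
  rcases Nat.eq_zero_or_pos k with rfl | hk
  · norm_num
  · have h1 : (2 : ℝ) ≤ ((s : ℝ) + 1) ^ k :=
      le_trans (by linarith) (le_self_pow₀ (by linarith : (1 : ℝ) ≤ s + 1) (by omega))
    have h2 : (-1 : ℝ) ≤ (-1) ^ k := by
      rcases neg_one_pow_eq_or ℝ k with h | h <;> rw [h] <;> norm_num
    linarith

open scoped Classical in
lemma sum_rho_lim (hr : r = s + 2) (hs : 1 ≤ s) {A : Finset (V × Fin r → V × Fin r)}
    (hA : ∀ c ∈ A, IsCyc c) (hd : Disj A) :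
    ∑ R ∈ (subs (glue A)).filter (AcycF (glue A)),
      (∏ v ∈ tchs A, ((s.choose (2 - (slice R v).card) : ℕ) : ℝ) / ((r.choose 2 : ℕ) : ℝ)) *
        (((2 : ℝ) ^ (R.card / 2))⁻¹ * ((s : ℝ) ^ (tot A - R.card / 2))⁻¹) =
      ∏ c ∈ A, lQ s (tch c).card := by
  have hs0 : (0 : ℝ) < s := by exact_mod_cast hs
  set y : ℝ := Real.sqrt (s / 2) with hy
  have hy2 : y ^ 2 = s / 2 := Real.sq_sqrt (by positivity)
  set w : ℕ → ℝ := fun d => ((s.choose (2 - d) : ℕ) : ℝ) / ((r.choose 2 : ℕ) : ℝ) * (s : ℝ)⁻¹ * y ^ d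
    with hw
  have hB : ((r.choose 2 : ℕ) : ℝ) = (s + 2) * (s + 1) / 2 := by
    rw [Nat.cast_choose_two, hr]; push_cast; ring
  have h1 : ((s : ℝ) + 1) / ((s + 2) * (s + 1)) + (-1) / ((s + 2) * (s + 1)) = w 0 + w 2 := by
    simp only [hw, hB, hy2, Nat.sub_zero, Nat.sub_self, Nat.choose_zero_right, Nat.cast_choose_two]
    push_cast
    field_simp
    ring
  have h2 : ((s : ℝ) + 1) / ((s + 2) * (s + 1)) * ((-1) / ((s + 2) * (s + 1))) =
      w 0 * w 2 - w 1 ^ 2 := by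
    simp only [hw, hB, mul_pow, pow_one, hy2, Nat.sub_zero, Nat.sub_self, Nat.choose_zero_right,
      Nat.cast_choose_two, show 2 - 1 = 1 from rfl, Nat.choose_one_right]
    push_cast
    field_simp
    ring
  have h3 : w 2 = 1 / (((s : ℝ) + 2) * (s + 1)) := by
    simp only [hw, hB, hy2, Nat.sub_self, Nat.choose_zero_right]
    push_cast
    field_simp
  have key := sum_subs_glue hA hd w
  rw [prod_congr rfl fun c hc => sum_subs_ne (hA c hc) w h1 h2] at key
  have hl : ∀ c ∈ A, (((s : ℝ) + 1) / ((s + 2) * (s + 1))) ^ (tch c).card +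
      ((-1) / (((s : ℝ) + 2) * (s + 1))) ^ (tch c).card - w 2 ^ (tch c).card = lQ s (tch c).card := by
    intro c _
    rw [h3, lQ, div_pow, div_pow, div_pow, one_pow]
    ring
  rw [prod_congr rfl hl] at key
  rw [← key]
  refine sum_congr rfl fun R hR => ?_
  have hR := (mem_filter.1 hR).1
  have he := card_subs_even (glue_invol hA hd) hR
  have hRc := card_le_of_subs hR
  rw [card_mv_glue hA hd] at hRc
  simp only [hw]
  rw [prod_mul_distrib, prod_mul_distrib, prod_const, card_tchs hd, prod_pow_eq_pow_sum]
  have hsum : ∑ v ∈ tchs A, (slice R v).card = R.card := by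
    rw [card_eq_sum_slice]
    refine sum_subset (subset_univ _) fun v _ hv => ?_
    have := card_le_card (slice_mono (mem_subs.1 hR).1 v)
    rw [slice_glue_of_notMem hd hv, card_empty] at this
    omega
  rw [hsum, mul_assoc]
  congr 1
  generalize hj : R.card / 2 = j at *
  rw [he, pow_mul, hy2, inv_pow]
  obtain ⟨t, ht⟩ := Nat.exists_eq_add_of_le (show j ≤ tot A by omega)
  rw [ht, Nat.add_sub_cancel_left, pow_add, div_pow]
  field_simp

lemma coef_mem (hr : r = s + 2) (B : Finset V) (R : Finset (V × Fin r)) :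
    0 ≤ ∏ v ∈ B, ((s.choose (2 - (slice R v).card) : ℕ) : ℝ) / ((r.choose 2 : ℕ) : ℝ) ∧
    ∏ v ∈ B, ((s.choose (2 - (slice R v).card) : ℕ) : ℝ) / ((r.choose 2 : ℕ) : ℝ) ≤ 1 := by
  refine ⟨prod_nonneg fun _ _ => by positivity, prod_le_one (fun _ _ => by positivity) fun v _ => ?_⟩
  refine div_le_one_of_le₀ ?_ (by positivity)
  norm_cast
  have h : ∀ e ≤ 2, s.choose e ≤ r.choose 2 := by
    intro e he
    have h2 : r.choose 2 = s.choose 2 + 2 * s + 1 := by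
      rw [hr, Nat.choose_succ_succ' (s + 1) 1, Nat.choose_succ_succ' s 1, Nat.choose_one_right,
        Nat.choose_one_right]
      ring
    interval_cases e
    · rw [Nat.choose_zero_right]; omega
    · rw [Nat.choose_one_right]; omega
    · omega
  exact h _ (Nat.sub_le _ _)

theorem pHyp_wQ (hr : r = s + 2) (hs : 1 ≤ s) : PHyp r (flt s) (wQ r) (lQ s) where
  le_atTop := flt_le s
  nonneg n M := by unfold wQ; positivity
  rate_nonneg k := lQ_nonneg hs k
  bound l := wQ_bound hr hs l
  lim K ε hε := by
    have hε' : 0 < ε / 2 ^ (2 * K) := by positivity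
    have hall : ∀ᶠ n in flt s, ∀ j ∈ range (K + 1),
        |rho s K n j - ((2 : ℝ) ^ j)⁻¹ * ((s : ℝ) ^ (K - j))⁻¹| ≤ ε / 2 ^ (2 * K) := by
      refine (eventually_all_finset _).2 fun j hj => ?_
      have hj' : j ≤ K := by rw [mem_range] at hj; omega
      filter_upwards [(Metric.tendsto_nhds.1 (tendsto_cc_dm hs hj')) _ hε'] with n hn
      rw [Real.dist_eq] at hn
      exact hn.le
    filter_upwards [hall, (flt_le s) (eventually_ge_atTop (K + 1))] with n hn hn1 A hA hd htot
    classical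
    subst htot
    rw [pow_mul_wt_wQ_glue hr (by omega) hA hd (by omega), ← sum_rho_lim hr hs hA hd,
      ← sum_sub_distrib]
    refine (abs_sum_le_sum_abs _ _).trans ?_
    have hb : ∀ R ∈ (subs (glue A)).filter (AcycF (glue A)),
        |(∏ v ∈ tchs A, ((s.choose (2 - (slice R v).card) : ℕ) : ℝ) / ((r.choose 2 : ℕ) : ℝ)) *
          rho s (tot A) n (R.card / 2) -
        (∏ v ∈ tchs A, ((s.choose (2 - (slice R v).card) : ℕ) : ℝ) / ((r.choose 2 : ℕ) : ℝ)) *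
        (((2 : ℝ) ^ (R.card / 2))⁻¹ * ((s : ℝ) ^ (tot A - R.card / 2))⁻¹)| ≤
          ε / 2 ^ (2 * tot A) := by
      intro R hR
      have hRc := card_le_of_subs (mem_filter.1 hR).1
      rw [card_mv_glue hA hd] at hRc
      obtain ⟨h0, h1⟩ := coef_mem hr (tchs A) R
      rw [← mul_sub, abs_mul, abs_of_nonneg h0]
      refine (mul_le_of_le_one_left (abs_nonneg _) h1).trans (hn _ ?_)
      rw [mem_range]; omega
    refine (sum_le_sum hb).trans ?_
    rw [sum_const, nsmul_eq_mul]
    have h1 : (((subs (glue A)).filter (AcycF (glue A))).card : ℝ) ≤ 2 ^ (2 * tot A) := by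
      have := (card_filter_le (subs (glue A)) (AcycF (glue A))).trans (card_subs_le _)
      rw [card_mv_glue hA hd] at this
      exact_mod_cast this
    calc _ ≤ 2 ^ (2 * tot A) * (ε / 2 ^ (2 * tot A)) := mul_le_mul_of_nonneg_right h1 hε'.le
      _ = ε := by field_simp

end

end

section
open Finset Function Filter Topology

section
open MeasureTheory

lemma Gamma_half_eq_dm (m : ℕ) : Real.Gamma (m + 1 / 2) * 2 ^ m = dm (2 * m) * √Real.pi := by
  induction m with
  | zero => simp only [Nat.cast_zero, zero_add, Real.Gamma_one_half_eq, dm]; simp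
  | succ m ih =>
    rw [show ((m + 1 : ℕ) : ℝ) + 1 / 2 = (m + 1 / 2) + 1 by push_cast; ring,
      Real.Gamma_add_one (by positivity), show 2 * (m + 1) = 2 * m + 2 by ring, dm, pow_succ]
    push_cast
    linear_combination (2 * (m : ℝ) + 1) * ih

/-- The integrand of the Beta integral. -/
noncomputable def bint (i m : ℕ) (t : ℝ) : ℝ := t ^ i * (1 - t) ^ m * (√(1 - t))⁻¹

lemma bint_eq {i m : ℕ} {t : ℝ} (ht : t ∈ Set.Ioo (0 : ℝ) 1) :
    bint i m t = t ^ ((i + 1 : ℝ) - 1) * (1 - t) ^ ((m + 1 / 2 : ℝ) - 1) := by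
  have h1 : 0 < 1 - t := by linarith [ht.2]
  rw [bint, show ((i + 1 : ℝ) - 1) = i by ring, Real.rpow_natCast,
    show (m + 1 / 2 : ℝ) - 1 = m + (-(1 / 2)) by ring, Real.rpow_add h1, Real.rpow_natCast,
    Real.rpow_neg h1.le, Real.sqrt_eq_rpow]
  ring

lemma integrable_bint_and (i m : ℕ) : IntegrableOn (bint i m) (Set.Ioo 0 1) ∧
    ∫ t in Set.Ioo (0 : ℝ) 1, bint i m t = ProbabilityTheory.beta (i + 1) (m + 1 / 2) := by
  have hα : (0 : ℝ) < i + 1 := by positivity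
  have hβ : (0 : ℝ) < m + 1 / 2 := by positivity
  have hB := ProbabilityTheory.beta_pos hα hβ
  have h := ProbabilityTheory.lintegral_betaPDF_eq_one hα hβ
  rw [ProbabilityTheory.lintegral_betaPDF] at h
  set B := ProbabilityTheory.beta (i + 1) (m + 1 / 2)
  have h2 : ∫⁻ t in Set.Ioo (0 : ℝ) 1, ENNReal.ofReal (B⁻¹ * bint i m t) = 1 := by
    rw [← h]
    refine setLIntegral_congr_fun measurableSet_Ioo fun t ht => ?_
    rw [bint_eq ht]
    congr 1
    ring
  have hmeas : Measurable (bint i m) := by unfold bint; fun_prop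
  have hnn : 0 ≤ᵐ[volume.restrict (Set.Ioo (0 : ℝ) 1)] fun t => B⁻¹ * bint i m t := by
    refine (ae_restrict_iff' measurableSet_Ioo).2 (ae_of_all _ fun t ht => ?_)
    have h1 : 0 < 1 - t := by linarith [ht.2]
    have h2 := ht.1
    show (0 : ℝ) ≤ B⁻¹ * bint i m t
    unfold bint
    positivity
  have hIoo : ∫ t in Set.Ioo (0 : ℝ) 1, B⁻¹ * bint i m t = 1 := by
    rw [integral_eq_lintegral_of_nonneg_ae hnn (by fun_prop), h2]; simp
  constructor
  · by_contra hni
    have : ∫ t in Set.Ioo (0 : ℝ) 1, B⁻¹ * bint i m t = 0 := by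
      rw [integral_const_mul, integral_undef hni, mul_zero]
    rw [hIoo] at this; norm_num at this
  · rw [integral_const_mul] at hIoo
    field_simp at hIoo
    exact hIoo

lemma cc_mul_dm (i m : ℕ) : (cc (i + 1) * dm (2 * m) : ℝ) =
    dm (2 * (m + i + 1)) / 2 * ∫ t in Set.Ioo (0 : ℝ) 1, bint i m t := by
  rw [(integrable_bint_and i m).2, ProbabilityTheory.beta,
    show (i + 1 + (m + 1 / 2) : ℝ) = ((m + i + 1 : ℕ) : ℝ) + 1 / 2 by push_cast; ring,
    Real.Gamma_nat_eq_factorial]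
  have h1 := Gamma_half_eq_dm m
  have h2 := Gamma_half_eq_dm (m + i + 1)
  have h3 : 0 < Real.Gamma (((m + i + 1 : ℕ) : ℝ) + 1 / 2) := Real.Gamma_pos_of_pos (by positivity)
  have hpi : 0 < √Real.pi := by positivity
  have h4 : ((dm (2 * (m + i + 1)) : ℕ) : ℝ) =
      Real.Gamma (((m + i + 1 : ℕ) : ℝ) + 1 / 2) * 2 ^ (m + i + 1) / √Real.pi := by
    rw [h2]; field_simp
  have h5 : ((dm (2 * m) : ℕ) : ℝ) = Real.Gamma (m + 1 / 2) * 2 ^ m / √Real.pi := by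
    rw [h1]; field_simp
  rw [h4, h5, cc]
  push_cast at h3 ⊢
  field_simp
  ring
end

end

section
open Finset Function Filter Topology

section
open MeasureTheory
variable {V : Type*} [Fintype V] [DecidableEq V] {r : ℕ}

lemma acycF_of_ne {h : V × Fin r → V × Fin r} (hh : IsCyc h) {R : Finset (V × Fin r)}
    (hR : R ∈ subs h) (hne : R ≠ mv h) : AcycF h R := by
  classical
  have hd : Disj ({h} : Finset (V × Fin r → V × Fin r)) := by
    intro c hc c' hc' hcc
    rw [mem_singleton] at hc hc'
    exact absurd (hc.trans hc'.symm) hcc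
  have hg : glue {h} = h := by
    funext x
    by_cases hx : h x = x
    · rw [hx, glue_eq_self]; simpa using hx
    · exact glue_eq hd (mem_singleton_self h) hx
  have := (acycF_glue (A := {h}) (by simpa using hh) hd (R := R) (by rwa [hg])).2 (by
    intro c hc
    rw [mem_singleton] at hc
    subst hc
    rw [inter_eq_left.2 (mem_subs.1 hR).1]
    exact hne)
  rwa [hg] at this

lemma hs_self {h : V × Fin r → V × Fin r} (hh : h ∈ ham V r) : hs h (mv h) = {h} := by
  ext g
  rw [hs, mem_filter, mem_singleton]
  have hR : restr h (mv h) = h := by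
    funext x
    by_cases hx : h x = x <;> simp [restr, hx]
  rw [hR]
  have hf := (mem_ham.1 hh).2.card
  constructor
  · rintro ⟨h1, h2, h3⟩
    have h4 := (mem_ham.1 h1).2.card
    have h5 : mv h = mv g := eq_of_subset_of_card_le (inter_eq_right.1 h2) (by omega)
    funext x
    by_cases hx : h x = x
    · have : x ∉ mv g := by rw [← h5, mem_mv]; simpa using hx
      rw [hx]; simpa using this
    · exact h3 x hx
  · rintro rfl
    exact ⟨hh, by simp, fun x _ => rfl⟩

lemma sum_ycnt {n : ℕ} (s : ℕ) (hr : r = s + 2) :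
    ∑ M ∈ invs (univ : Finset (Fin n × Fin r)), (ycnt M : ℝ) = (ham (Fin n) r).card * dm (s * n) := by
  classical
  have : ∑ M ∈ invs (univ : Finset (Fin n × Fin r)), ycnt M = (ham (Fin n) r).card * dm (s * n) := by
    unfold ycnt
    simp only [card_filter]
    rw [sum_comm, ← smul_eq_mul, ← sum_const]
    refine sum_congr rfl fun h hh => ?_
    rw [mem_ham] at hh
    rw [← card_filter, card_invs_sub hh.1.inv (subset_univ _), card_invs, card_sdiff_of_subset
      (subset_univ _), card_univ, hh.2.card, Fintype.card_prod, Fintype.card_fin, Fintype.card_fin, hr]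
    congr 1
    rw [mul_add, mul_comm s, mul_comm 2, Nat.add_sub_cancel]
  exact_mod_cast this

lemma sum_ycnt_sq {n : ℕ} (hn : 1 ≤ n) (s : ℕ) (hr : r = s + 2) :
    ∑ M ∈ invs (univ : Finset (Fin n × Fin r)), ycnt M * ycnt M =
    ∑ h ∈ ham (Fin n) r, (dm (s * n) + ∑ R ∈ (subs h).filter (fun R => R ≠ mv h),
      (∏ v, s.choose (2 - (slice R v).card)) * cc (n - R.card / 2) *
        dm (s * n - 2 * (n - R.card / 2))) := by
  classical
  have : Nonempty (Fin n) := ⟨⟨0, hn⟩⟩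
  have h0 : ∑ M ∈ invs (univ : Finset (Fin n × Fin r)), ycnt M * ycnt M =
      ∑ h ∈ ham (Fin n) r, ∑ M ∈ (invs univ).filter (Sub h), ycnt M := by
    simp only [sum_filter]
    rw [sum_comm]
    refine sum_congr rfl fun M _ => ?_
    rw [← sum_filter, sum_const, smul_eq_mul]
    rfl
  rw [h0]
  refine sum_congr rfl fun h hh => ?_
  have hh' := mem_ham.1 hh
  have hcard := hh'.2.card
  rw [Fintype.card_fin] at hcard
  have hsub := sum_ham_sub (r := r) hh'.1.inv
  have hmem : mv h ∈ subs h := mem_subs.2 ⟨subset_rfl, fun x hx => mv_closed hh'.1.inv hx⟩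
  have hrn : r * n = s * n + 2 * n := by rw [hr]; ring
  unfold ycnt
  rw [hsub, ← add_sum_erase _ _ hmem, hs_self hh, card_singleton, one_mul, Fintype.card_fin, filter_ne',
    hcard]
  congr 1
  · congr 1; omega
  · refine sum_congr rfl fun R hR => ?_
    obtain ⟨hne, hR⟩ := mem_erase.1 hR
    have hlt : R.card < 2 * n := by
      rw [← hcard]
      exact card_lt_card (lt_of_le_of_ne (mem_subs.1 hR).1 hne)
    have he := card_subs_even hh'.1.inv hR
    have h2 : ∀ v, (slice R v).card ≤ 2 := fun v => by
      rw [← hh'.2 v]; exact card_le_card (slice_mono (mem_subs.1 hR).1 v)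
    rw [card_hs hh'.1.inv hR h2 (by rwa [Fintype.card_fin]), if_pos (acycF_of_ne hh'.1 hR hne),
      Fintype.card_fin]
    congr 2
    · refine prod_congr rfl fun v _ => ?_
      rw [hh'.2 v, show r - 2 = s by omega]
    · omega

/-- The larger eigenvalue of the transfer matrix. -/
noncomputable def ap (s : ℕ) (x : ℝ) : ℝ :=
  ((1 + s.choose 2 * x) + √((1 + s.choose 2 * x) ^ 2 + 2 * (s * (s + 1)) * x)) / 2

/-- The smaller eigenvalue of the transfer matrix. -/
noncomputable def am (s : ℕ) (x : ℝ) : ℝ :=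
  ((1 + s.choose 2 * x) - √((1 + s.choose 2 * x) ^ 2 + 2 * (s * (s + 1)) * x)) / 2

lemma ap_add_am (s : ℕ) (x : ℝ) : ap s x + am s x = 1 + s.choose 2 * x := by
  unfold ap am; ring

lemma ap_mul_am (s : ℕ) {x : ℝ} (hx : 0 ≤ x) : ap s x * am s x = - (s * (s + 1) * x / 2) := by
  have := Real.sq_sqrt (x := (1 + s.choose 2 * x) ^ 2 + 2 * (s * (s + 1)) * x) (by positivity)
  unfold ap am; linear_combination (-1/4) * this

/-- The base weight in the moment integrals. -/
noncomputable def bw (a : ℕ) (t : ℝ) : ℝ := (1 - t) ^ a * (t * √(1 - t))⁻¹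

lemma bint_eq_bw {i a : ℕ} (hi : 1 ≤ i) (hia : i ≤ a) {t : ℝ} (ht : t ∈ Set.Ioo (0 : ℝ) 1) :
    bint (i - 1) (a - i) t = bw a t * (t / (1 - t)) ^ i := by
  have h1 : 0 < 1 - t := by linarith [ht.2]
  have h2 := ht.1
  obtain ⟨j, rfl⟩ := Nat.exists_eq_add_of_le' hi
  obtain ⟨b, rfl⟩ := Nat.exists_eq_add_of_le' hia
  rw [bint, bw, Nat.add_sub_cancel, Nat.add_sub_cancel, div_pow, pow_add (1 - t) b, pow_succ t]
  field_simp

theorem moment_sum {n a s : ℕ} (hn : 1 ≤ n) (hs1 : 1 ≤ s) (hr : r = s + 2) (ha : s * n = 2 * a)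
    {h : Fin n × Fin r → Fin n × Fin r} (hh : h ∈ ham (Fin n) r) :
    IntegrableOn (fun t => bw a t * (ap s (t / (1 - t)) ^ n + am s (t / (1 - t)) ^ n - 1)) (Set.Ioo 0 1) ∧
    ((∑ R ∈ (subs h).filter (fun R => R ≠ mv h), (∏ v, s.choose (2 - (slice R v).card)) *
      cc (n - R.card / 2) * dm (s * n - 2 * (n - R.card / 2)) : ℕ) : ℝ) =
    dm (s * n) * (1 / 2 * ∫ t in Set.Ioo (0 : ℝ) 1,
      bw a t * (ap s (t / (1 - t)) ^ n + am s (t / (1 - t)) ^ n - 1)) := by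
  classical
  have hh' := mem_ham.1 hh
  have hcard := hh'.2.card
  rw [Fintype.card_fin] at hcard
  have hfun : Set.EqOn (fun t => bw a t * (ap s (t / (1 - t)) ^ n + am s (t / (1 - t)) ^ n - 1))
      (fun t => ∑ R ∈ (subs h).filter (fun R => R ≠ mv h), bw a t *
        ∏ v, ((s.choose (2 - (slice R v).card) : ℕ) : ℝ) * √(t / (1 - t)) ^ (2 - (slice R v).card))
      (Set.Ioo 0 1) := by
    intro t ht
    have hx : 0 < t / (1 - t) := div_pos ht.1 (by linarith [ht.2])
    have := sum_subs_ne hh'.1 (fun d => ((s.choose (2 - d) : ℕ) : ℝ) * √(t / (1 - t)) ^ (2 - d))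
      (α := ap s (t / (1 - t))) (β := am s (t / (1 - t)))
      (by rw [ap_add_am]; simp [Real.sq_sqrt hx.le]; ring)
      (by
        rw [ap_mul_am s hx.le]
        simp [Real.sq_sqrt hx.le, Nat.cast_choose_two, mul_pow]
        ring)
    have ht : tch h = univ := by
      rw [eq_univ_iff_forall]; intro v; rw [mem_tch, hh'.2 v]; norm_num
    rw [ht] at this
    simp only [card_univ, Fintype.card_fin, Nat.sub_self, Nat.choose_zero_right, Nat.cast_one, pow_zero,
      mul_one, one_pow] at this
    simp only
    rw [← this, mul_sum]
  have hterm : ∀ R ∈ (subs h).filter (fun R => R ≠ mv h),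
      IntegrableOn (fun t => bw a t * ∏ v, ((s.choose (2 - (slice R v).card) : ℕ) : ℝ) *
        √(t / (1 - t)) ^ (2 - (slice R v).card)) (Set.Ioo 0 1) ∧
      (((∏ v, s.choose (2 - (slice R v).card)) *
        cc (n - R.card / 2) * dm (s * n - 2 * (n - R.card / 2)) : ℕ) : ℝ) =
      dm (s * n) * (1 / 2 * ∫ t in Set.Ioo (0 : ℝ) 1, bw a t *
        ∏ v, ((s.choose (2 - (slice R v).card) : ℕ) : ℝ) * √(t / (1 - t)) ^ (2 - (slice R v).card)) := by
    intro R hR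
    obtain ⟨hR, hne⟩ := mem_filter.1 hR
    have hlt : R.card < 2 * n := by
      rw [← hcard]
      exact card_lt_card (lt_of_le_of_ne (mem_subs.1 hR).1 hne)
    have he := card_subs_even hh'.1.inv hR
    have h2 : ∀ v, (slice R v).card ≤ 2 := fun v => by
      rw [← hh'.2 v]; exact card_le_card (slice_mono (mem_subs.1 hR).1 v)
    simp only [prod_mul_distrib]
    by_cases h0 : ∏ v, s.choose (2 - (slice R v).card) = 0
    · have h0' : ∏ v, ((s.choose (2 - (slice R v).card) : ℕ) : ℝ) = 0 := by exact_mod_cast h0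
      simp [h0, h0']
    · set i := n - R.card / 2 with hi
      have hi1 : 1 ≤ i := by omega
      have hsum := card_eq_sum_slice R
      have hia : i ≤ a := by
        rcases hs1.eq_or_lt with h1 | h1
        · have h3 : ∀ v, 1 ≤ (slice R v).card := by
            intro v
            by_contra hv
            refine h0 (prod_eq_zero (mem_univ v) ?_)
            rw [← h1, show (slice R v).card = 0 by omega]
            rfl
          have h4 : n ≤ R.card := by
            rw [hsum]
            have := card_nsmul_le_sum univ (fun v => (slice R v).card) 1 fun v _ => h3 v
            simpa using this
          rw [← h1] at ha
          omega
        · have : 2 * n ≤ s * n := Nat.mul_le_mul_right n h1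
          omega
      have hpow : ∀ t ∈ Set.Ioo (0 : ℝ) 1, ∏ v, √(t / (1 - t)) ^ (2 - (slice R v).card) =
          (t / (1 - t)) ^ i := by
        intro t ht
        have hx : 0 < t / (1 - t) := div_pos ht.1 (by linarith [ht.2])
        rw [prod_pow_eq_pow_sum]
        have h5 : ∑ v : Fin n, (2 - (slice R v).card) = 2 * i := by
          have : ∑ v : Fin n, (2 - (slice R v).card) + R.card = 2 * n := by
            rw [hsum, ← sum_add_distrib, sum_congr rfl fun v _ => Nat.sub_add_cancel (h2 v)]
            simp [mul_comm]
          omega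
        rw [h5, pow_mul, Real.sq_sqrt hx.le]
      have hc : Set.EqOn (fun t => bw a t * ((∏ v, ((s.choose (2 - (slice R v).card) : ℕ) : ℝ)) *
          ∏ v, √(t / (1 - t)) ^ (2 - (slice R v).card)))
          (fun t => (∏ v, ((s.choose (2 - (slice R v).card) : ℕ) : ℝ)) * bint (i - 1) (a - i) t)
          (Set.Ioo 0 1) := by
        intro t ht
        simp only
        rw [hpow t ht, bint_eq_bw hi1 hia ht]; ring
      refine ⟨(integrableOn_congr_fun hc measurableSet_Ioo).2
        ((integrable_bint_and _ _).1.const_mul _), ?_⟩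
      rw [setIntegral_congr_fun measurableSet_Ioo hc, integral_const_mul]
      have h6 := cc_mul_dm (i - 1) (a - i)
      rw [Nat.sub_add_cancel hi1, show a - i + (i - 1) + 1 = a by omega] at h6
      rw [ha, show 2 * a - 2 * i = 2 * (a - i) by omega]
      push_cast
      rw [mul_assoc, h6]
      ring
  refine ⟨(integrableOn_congr_fun hfun measurableSet_Ioo).2
    (integrable_finsetSum _ fun R hR => (hterm R hR).1), ?_⟩
  rw [setIntegral_congr_fun measurableSet_Ioo hfun, integral_finsetSum _ fun R hR => (hterm R hR).1,
    mul_sum, mul_sum, Nat.cast_sum]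
  exact sum_congr rfl fun R hR => (hterm R hR).2
end

end

section
open Finset Function Filter Topology

section
open MeasureTheory
variable {r : ℕ}

/-- The expected number of Hamilton cycles of a uniform matching. -/
noncomputable def EY (r n : ℕ) : ℝ := ∑ M ∈ invs univ, wP r n M * ycnt M

/-- The expected number of Hamilton cycles of a size-biased matching. -/
noncomputable def EQ (r n : ℕ) : ℝ := ∑ M ∈ invs univ, wQ r n M * ycnt M

theorem EY_eq' {n s : ℕ} (hr : r = s + 2) :
    EY r n = (ham (Fin n) r).card * dm (s * n) / dm (r * n) := by
  unfold EY wP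
  rw [← mul_sum, sum_ycnt s hr]
  ring

theorem EY_eq {n a s : ℕ} (hn : 1 ≤ n) (hr : r = s + 2) (ha : s * n = 2 * a) :
    IntegrableOn (fun t => bw a t * (r.choose 2 * t) ^ n) (Set.Ioo 0 1) ∧
    EY r n = 1 / 2 * ∫ t in Set.Ioo (0 : ℝ) 1, bw a t * (r.choose 2 * t) ^ n := by
  have hc : Set.EqOn (fun t => bw a t * (r.choose 2 * t) ^ n)
      (fun t => ((r.choose 2 : ℕ) : ℝ) ^ n * bint (n - 1) a t) (Set.Ioo 0 1) := by
    intro t ht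
    have h1 : 0 < 1 - t := by linarith [ht.2]
    have h2 := ht.1
    obtain ⟨m, rfl⟩ := Nat.exists_eq_add_of_le' hn
    simp only
    rw [bint, bw, Nat.add_sub_cancel]
    field_simp
    ring
  refine ⟨(integrableOn_congr_fun hc measurableSet_Ioo).2 ((integrable_bint_and _ _).1.const_mul _), ?_⟩
  rw [setIntegral_congr_fun measurableSet_Ioo hc, integral_const_mul, EY_eq' hr, card_ham hn]
  have h6 := cc_mul_dm (n - 1) a
  rw [Nat.sub_add_cancel hn, show a + (n - 1) + 1 = a + n by omega,
    show 2 * (a + n) = r * n by rw [hr, add_mul, ha]; ring] at h6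
  have h7 : 0 < dm (r * n) := dm_pos ⟨a + n, by rw [hr, add_mul, ha]; ring⟩
  have h8 : (0 : ℝ) < dm (r * n) := by exact_mod_cast h7
  rw [ha]
  push_cast
  rw [mul_assoc, h6]
  field_simp

theorem EQ_eq {n a s : ℕ} (hn : 1 ≤ n) (hs1 : 1 ≤ s) (hr : r = s + 2) (ha : s * n = 2 * a) :
    IntegrableOn (fun t => bw a t * (ap s (t / (1 - t)) ^ n + am s (t / (1 - t)) ^ n - 1)) (Set.Ioo 0 1) ∧
    EQ r n = 1 + 1 / 2 * ∫ t in Set.Ioo (0 : ℝ) 1,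
      bw a t * (ap s (t / (1 - t)) ^ n + am s (t / (1 - t)) ^ n - 1) := by
  have hpos : 0 < (ham (Fin n) r).card := by
    rw [card_ham hn]
    exact Nat.mul_pos (pow_pos (Nat.choose_pos (by omega)) _) (cc_pos n)
  obtain ⟨h0, hh0⟩ := card_pos.1 hpos
  refine ⟨(moment_sum hn hs1 hr ha hh0).1, ?_⟩
  have h1 : EQ r n = ((∑ M ∈ invs (univ : Finset (Fin n × Fin r)), ycnt M * ycnt M : ℕ) : ℝ) /
      ((ham (Fin n) r).card * dm (s * n)) := by
    unfold EQ wQ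
    rw [show r * n - 2 * n = s * n by rw [hr, add_mul, Nat.add_sub_cancel], Nat.cast_sum, sum_div]
    refine sum_congr rfl fun M _ => ?_
    push_cast; ring
  have h7 : 0 < dm (s * n) := dm_pos ⟨a, by omega⟩
  have h8 : (0 : ℝ) < dm (s * n) := by exact_mod_cast h7
  have h9 : (0 : ℝ) < (ham (Fin n) r).card := by exact_mod_cast hpos
  rw [h1, sum_ycnt_sq hn s hr, Nat.cast_sum, div_eq_iff (by positivity)]
  rw [sum_congr rfl fun h hh => by rw [Nat.cast_add, (moment_sum hn hs1 hr ha hh).2], sum_const,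
    nsmul_eq_mul]
  ring
end

end

section
open Finset Function Filter Topology

section
variable {s : ℕ} {x : ℝ}

lemma ap_sq (s : ℕ) (hx : 0 ≤ x) :
    ap s x ^ 2 = (1 + s.choose 2 * x) * ap s x + s * (s + 1) * x / 2 := by
  have h1 := ap_add_am s x
  have h2 := ap_mul_am s hx
  linear_combination ap s x * h1 - h2

lemma am_nonpos (s : ℕ) (hx : 0 ≤ x) : am s x ≤ 0 := by
  have : (1 + s.choose 2 * x) ≤ √((1 + s.choose 2 * x) ^ 2 + 2 * (s * (s + 1)) * x) :=
    Real.le_sqrt_of_sq_le (by have : 0 ≤ 2 * (s * (s + 1)) * x := by positivity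
                              linarith)
  unfold am; linarith

lemma one_le_ap (s : ℕ) (hx : 0 ≤ x) : 1 ≤ ap s x := by
  have h1 := ap_add_am s x
  have h2 := am_nonpos s hx
  have : 0 ≤ (s.choose 2 : ℝ) * x := by positivity
  linarith

lemma abs_am_le (s : ℕ) (hx : 0 ≤ x) : |am s x| ≤ ap s x - 1 := by
  have h1 := ap_add_am s x
  rw [abs_of_nonpos (am_nonpos s hx)]
  have : 0 ≤ (s.choose 2 : ℝ) * x := by positivity
  linarith

lemma choose_two_real (s : ℕ) : ((s.choose 2 : ℕ) : ℝ) = s * (s - 1) / 2 := Nat.cast_choose_two ℝ s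

lemma ap_sub_one_le (s : ℕ) (hx : 0 ≤ x) : ap s x - 1 ≤ s ^ 2 * x := by
  have h1 := one_le_ap s hx
  have h2 := ap_sq s hx
  have h3 : ap s x * (ap s x - 1) ≤ ap s x * (s ^ 2 * x) := by
    have : 0 ≤ (s * (s + 1) * x / 2) * (ap s x - 1) :=
      mul_nonneg (by positivity) (by linarith)
    rw [choose_two_real] at h2
    nlinarith
  exact le_of_mul_le_mul_left h3 (by linarith)

lemma ap_le_of_nonneg (hx : 0 ≤ x) {A : ℝ} (hA : 0 < A)
    (hQ : 0 ≤ A ^ 2 - (1 + s.choose 2 * x) * A - s * (s + 1) * x / 2) : ap s x ≤ A := by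
  have h1 := ap_add_am s x
  have h2 := ap_mul_am s hx
  have h3 := am_nonpos s hx
  have h4 : 0 ≤ (A - ap s x) * (A - am s x) := by nlinarith
  by_contra h
  push Not at h
  nlinarith

lemma pow_sub_bound {α β : ℝ} (hα : 1 ≤ α) (hβ : |β| ≤ α - 1) {n : ℕ} (hn : 1 ≤ n) :
    |β| ^ n ≤ α ^ n - 1 := by
  refine (pow_le_pow_left₀ (abs_nonneg _) hβ n).trans ?_
  obtain ⟨m, rfl⟩ := Nat.exists_eq_add_of_le' hn
  have h0 : 0 ≤ α - 1 := by linarith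
  have h1 : (α - 1) ^ m ≤ α ^ m := pow_le_pow_left₀ h0 (by linarith) m
  have h2 : 1 ≤ α ^ m := one_le_pow₀ hα
  rw [pow_succ, pow_succ]
  nlinarith

lemma pow_sub_one_le {α : ℝ} (hα : 1 ≤ α) {n : ℕ} (hn : 1 ≤ n) :
    α ^ n - 1 ≤ n * α ^ (n - 1) * (α - 1) := by
  obtain ⟨m, rfl⟩ := Nat.exists_eq_add_of_le' hn
  rw [Nat.add_sub_cancel]
  induction m with
  | zero => simp
  | succ m ih =>
    have := ih (by omega)
    have h1 : 1 ≤ α ^ (m + 1) := one_le_pow₀ hα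
    have h2 : α ^ (m + 1 + 1) - 1 = α * (α ^ (m + 1) - 1) + (α - 1) := by ring
    rw [h2]
    push_cast at this ⊢
    have h3 : α * (α ^ (m + 1) - 1) ≤ α * ((m + 1) * α ^ m * (α - 1)) :=
      mul_le_mul_of_nonneg_left this (by linarith)
    have h4 : (α - 1) ≤ α ^ (m + 1) * (α - 1) := le_mul_of_one_le_left (by linarith) h1
    calc _ ≤ α * ((m + 1) * α ^ m * (α - 1)) + α ^ (m + 1) * (α - 1) := add_le_add h3 h4
      _ = _ := by ring

/-- The discriminating tangent bound for the larger eigenvalue. -/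
lemma ap_tangent (hs : 1 ≤ s) (hx : 0 ≤ x) :
    ap s x ^ 2 * (1 + (1 - (s + 1) / ap s x) ^ 2 / (s * (s + 2))) ≤
      (s + 1) ^ 2 * (s * (1 + x) / (s + 2)) ^ s := by
  have h1 := one_le_ap s hx
  have h2 := ap_sq s hx
  rw [choose_two_real] at h2
  set α := ap s x
  have hα : 0 < α := by linarith
  have hs0 : (1 : ℝ) ≤ s := by exact_mod_cast hs
  rcases hs.eq_or_lt with rfl | hs2
  · have h3 : x = α ^ 2 - α := by norm_num at h2; linarith
    have : α ^ 2 * (1 + (1 - (((1 : ℕ) : ℝ) + 1) / α) ^ 2 / (((1 : ℕ) : ℝ) * (((1 : ℕ) : ℝ) + 2))) =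
        α ^ 2 + (α - 2) ^ 2 / 3 := by
      push_cast; field_simp; ring
    rw [this, h3]
    push_cast
    nlinarith
  · have hs2' : (2 : ℝ) ≤ s := by exact_mod_cast hs2
    set L : ℝ := (s - 1) * α + s + 1 with hL
    have hL0 : 0 < L := by nlinarith
    have hL1 : L ≤ 2 * s * α := by nlinarith
    have hxL : s * x * L = 2 * α * (α - 1) := by rw [hL]; linear_combination -2 * h2
    set z : ℝ := s * (1 + x) / (s + 2) with hz
    have hz0 : 0 ≤ z := by positivity
    have hb : 1 + (s / 2 : ℝ) * (z - 1) ≤ z ^ ((s : ℝ) / 2) := by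
      have := one_add_mul_self_le_rpow_one_add (s := z - 1) (by linarith) (p := (s : ℝ) / 2) (by linarith)
      rwa [add_sub_cancel] at this
    have hzs : z ^ s = (z ^ ((s : ℝ) / 2)) ^ 2 := by
      rw [← Real.rpow_natCast (z ^ ((s : ℝ) / 2)), ← Real.rpow_mul hz0]
      push_cast
      rw [div_mul_cancel₀ _ two_ne_zero, Real.rpow_natCast]
    have hid : (s + 1) * (1 + (s / 2 : ℝ) * (z - 1)) = α + 2 * (α - s - 1) ^ 2 / ((s + 2) * L) := by
      have hx' : x = 2 * α * (α - 1) / (s * L) := by field_simp; linarith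
      rw [hz, hx']
      clear_value L
      field_simp
      rw [hL]
      ring
    set δ : ℝ := (1 - (s + 1) / α) ^ 2 / (s * (s + 2)) with hδ
    have hδ0 : 0 ≤ δ := by positivity
    have hle : α * (1 + δ) ≤ (s + 1) * (1 + (s / 2 : ℝ) * (z - 1)) := by
      rw [hid, mul_add, mul_one]
      refine add_le_add le_rfl ?_
      have : α * δ = 2 * (α - s - 1) ^ 2 / ((s + 2) * (2 * s * α)) := by
        rw [hδ]; field_simp; ring
      rw [this]
      gcongr
    calc α ^ 2 * (1 + δ) ≤ (α * (1 + δ)) ^ 2 := by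
          rw [mul_pow]; gcongr; nlinarith
      _ ≤ ((s + 1) * z ^ ((s : ℝ) / 2)) ^ 2 := by
          refine pow_le_pow_left₀ (by positivity) (hle.trans ?_) 2
          gcongr
      _ = _ := by rw [mul_pow, hzs]

end

end

section
open Finset Function Filter Topology

section
variable {s : ℕ}

/-- The exponential base of the first moment integrand. -/
noncomputable def p1 (s : ℕ) (t : ℝ) : ℝ := ((s + 2).choose 2 : ℕ) * t * √(1 - t) ^ s

/-- The exponential base of the second moment integrand. -/
noncomputable def p2 (s : ℕ) (t : ℝ) : ℝ := ap s (t / (1 - t)) * √(1 - t) ^ s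

/-- The location of the maximum of both bases. -/
noncomputable def t0 (s : ℕ) : ℝ := 2 / (s + 2)

/-- The maximum of both bases. -/
noncomputable def phm (s : ℕ) : ℝ := (s + 1) * √(s / (s + 2)) ^ s

lemma one_sub_t0 (s : ℕ) : 1 - t0 s = s / (s + 2) := by unfold t0; field_simp; ring

lemma t0_pos (s : ℕ) : 0 < t0 s := by unfold t0; positivity

lemma t0_lt (hs : 1 ≤ s) : t0 s < 1 := by
  have : (0 : ℝ) < s / (s + 2) := by positivity
  rw [← one_sub_t0] at this; linarith

lemma p1_t0 (s : ℕ) : p1 s (t0 s) = phm s := by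
  rw [p1, phm, one_sub_t0, t0, choose_two_real]
  push_cast
  field_simp
  ring

lemma p2_nonneg (s : ℕ) {t : ℝ} (ht : t ∈ Set.Ico (0 : ℝ) 1) : 0 ≤ p2 s t := by
  have := one_le_ap s (div_nonneg ht.1 (by linarith [ht.2] : (0 : ℝ) ≤ 1 - t))
  unfold p2; positivity

lemma p2_sq_le (hs : 1 ≤ s) {t : ℝ} (ht : t ∈ Set.Ico (0 : ℝ) 1) :
    p2 s t ^ 2 * (1 + (1 - (s + 1) / ap s (t / (1 - t))) ^ 2 / (s * (s + 2))) ≤ phm s ^ 2 := by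
  have h1 : 0 < 1 - t := by linarith [ht.2]
  have h := ap_tangent hs (div_nonneg ht.1 h1.le)
  have h2 : √(1 - t) ^ s * √(1 - t) ^ s = (1 - t) ^ s := by
    rw [← mul_pow, Real.mul_self_sqrt h1.le]
  have h3 : √((s : ℝ) / (s + 2)) ^ s * √((s : ℝ) / (s + 2)) ^ s = (s / (s + 2)) ^ s := by
    rw [← mul_pow, Real.mul_self_sqrt (by positivity)]
  calc _ = (1 - t) ^ s * (ap s (t / (1 - t)) ^ 2 *
        (1 + (1 - (s + 1) / ap s (t / (1 - t))) ^ 2 / (s * (s + 2)))) := by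
        rw [← h2, p2]; ring
    _ ≤ (1 - t) ^ s * ((s + 1) ^ 2 * (s * (1 + t / (1 - t)) / (s + 2)) ^ s) := by gcongr
    _ = (s + 1) ^ 2 * ((1 - t) * (s * (1 + t / (1 - t)) / (s + 2))) ^ s := by rw [mul_pow]; ring
    _ = (s + 1) ^ 2 * (s / (s + 2)) ^ s := by
        congr 2; field_simp; ring
    _ = phm s ^ 2 := by rw [← h3, phm]; ring

lemma phm_pos (hs : 1 ≤ s) : 0 < phm s := by
  have : (0 : ℝ) < s := by exact_mod_cast hs
  exact mul_pos (by positivity) (pow_pos (Real.sqrt_pos.2 (div_pos this (by positivity))) s)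

lemma one_lt_phm (hs : 1 ≤ s) : 1 < phm s := by
  have h := p2_sq_le hs (t := 0) (by simp)
  have ha : ap s 0 = 1 := by simp [ap]
  have hp : p2 s 0 = 1 := by simp [p2, ha]
  have hs0 : (0 : ℝ) < s := by exact_mod_cast hs
  rw [hp, zero_div, ha] at h
  have h2 : 0 < (1 - ((s : ℝ) + 1) / 1) ^ 2 / (s * (s + 2)) := by
    have : (1 - ((s : ℝ) + 1) / 1) = - s := by ring
    rw [this, neg_sq]; positivity
  have h3 := phm_pos hs
  nlinarith

lemma ap_param (hs : 1 ≤ s) {t : ℝ} (ht : t ∈ Set.Ico (0 : ℝ) 1) {α : ℝ}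
    (hα : α = ap s (t / (1 - t))) :
    t = 2 * α * (α - 1) / (2 * α * (α - 1) + s * ((s - 1) * α + s + 1)) := by
  have h1 : 0 < 1 - t := by linarith [ht.2]
  have hx := div_nonneg ht.1 h1.le
  have h2 := ap_sq s hx
  have h3 := one_le_ap s hx
  rw [choose_two_real, ← hα] at h2
  rw [← hα] at h3
  have hs0 : (1 : ℝ) ≤ s := by exact_mod_cast hs
  have hL : 0 < ((s : ℝ) - 1) * α + s + 1 := by nlinarith
  have hD : 0 < 2 * α * (α - 1) + s * ((s - 1) * α + s + 1) := by
    have : 0 ≤ 2 * α * (α - 1) := by nlinarith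
    positivity
  rw [eq_div_iff hD.ne']
  field_simp at h2
  nlinarith

theorem p2_far (hs : 1 ≤ s) {η : ℝ} (hη : 0 < η) :
    ∃ ρ, 1 ≤ ρ ∧ ρ < phm s ∧ ∀ t ∈ Set.Ico (0 : ℝ) 1, η ≤ |t - t0 s| → p2 s t ≤ ρ := by
  have hs0 : (1 : ℝ) ≤ s := by exact_mod_cast hs
  set T : ℝ → ℝ := fun α => 2 * α * (α - 1) / (2 * α * (α - 1) + s * ((s - 1) * α + s + 1)) with hT
  have hTc : ContinuousAt T (s + 1) := by
    have : (2 * ((s : ℝ) + 1) * ((s + 1) - 1) + s * ((s - 1) * (s + 1) + s + 1)) ≠ 0 := by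
      have : (2 * ((s : ℝ) + 1) * ((s + 1) - 1) + s * ((s - 1) * (s + 1) + s + 1)) =
        s * (s + 1) * (s + 2) := by ring
      rw [this]; positivity
    exact ContinuousAt.div (f := fun α : ℝ => 2 * α * (α - 1))
      (g := fun α : ℝ => 2 * α * (α - 1) + s * ((s - 1) * α + s + 1)) (by fun_prop) (by fun_prop) this
  have hT0 : T (s + 1) = t0 s := by
    have : (2 * ((s : ℝ) + 1) * ((s + 1) - 1) + s * ((s - 1) * (s + 1) + s + 1)) =
        s * (s + 1) * (s + 2) := by ring
    rw [hT]
    simp only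
    rw [this, t0]
    field_simp
    ring
  obtain ⟨η', hη', hc⟩ := Metric.continuousAt_iff.1 hTc η hη
  set θ : ℝ := min (η' / (2 * (s + 1))) (1 / 2)
  have hθ : 0 < θ := lt_min (by positivity) (by norm_num)
  set d : ℝ := θ ^ 2 / (s * (s + 2))
  have hd : 0 < d := by positivity
  have hm := phm_pos hs
  have hsq : 1 < √(1 + d) := by
    rw [Real.lt_sqrt (by norm_num)]; linarith
  refine ⟨max (phm s / √(1 + d)) 1, le_max_right _ _, max_lt (div_lt_self hm hsq) (one_lt_phm hs),
    fun t ht hfar => le_max_of_le_left ?_⟩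
  set α := ap s (t / (1 - t)) with hα
  have h1 : 0 < 1 - t := by linarith [ht.2]
  have hα1 : 1 ≤ α := one_le_ap s (div_nonneg ht.1 h1.le)
  have hpar := ap_param hs ht hα
  have hdist : η' ≤ |α - (s + 1)| := by
    by_contra h
    push Not at h
    have := hc (x := α) (by rwa [Real.dist_eq])
    rw [hT0, Real.dist_eq] at this
    rw [hpar] at hfar
    exact absurd hfar (not_le.2 this)
  have hθ1 : θ ≤ |1 - (s + 1) / α| := by
    have : |1 - (s + 1) / α| = |α - (s + 1)| / α := by
      rw [← abs_of_pos (by linarith : 0 < α), ← abs_div, abs_of_pos (by linarith : 0 < α)]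
      congr 1; field_simp
    rw [this, le_div_iff₀ (by linarith)]
    rcases le_total α (2 * (s + 1)) with h | h
    · refine le_trans ?_ hdist
      calc θ * α ≤ (η' / (2 * (s + 1))) * (2 * (s + 1)) := by
            gcongr; exact min_le_left _ _
        _ = η' := by field_simp
    · calc θ * α ≤ 1 / 2 * α := by gcongr; exact min_le_right _ _
        _ ≤ α - (s + 1) := by linarith
        _ ≤ _ := le_abs_self _
  have hsq2 : θ ^ 2 ≤ (1 - (s + 1) / α) ^ 2 := by
    rw [← sq_abs (1 - _)]; exact pow_le_pow_left₀ hθ.le hθ1 2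
  have h5 := p2_sq_le hs ht
  have h6 : p2 s t ^ 2 * (1 + d) ≤ phm s ^ 2 := by
    refine le_trans ?_ h5
    have : d ≤ (1 - (s + 1) / α) ^ 2 / (s * (s + 2)) :=
      div_le_div_of_nonneg_right hsq2 (by positivity)
    gcongr
  rw [le_div_iff₀ (by positivity)]
  refine le_of_sq_le_sq ?_ hm.le
  rw [mul_pow, Real.sq_sqrt (by positivity)]
  exact h6
end

end

section
open Finset Function Filter Topology

section
variable {s : ℕ}

lemma eventually_le_of_second_deriv {f f' : ℝ → ℝ} {A : ℝ} (h : ∀ᶠ v in 𝓝 0, HasDerivAt f (f' v) v)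
    (h0 : f' 0 = 0) (h2 : HasDerivAt f' A 0) (hA : 0 < A) : ∀ᶠ v in 𝓝 0, f 0 ≤ f v := by
  have h3 : deriv f =ᶠ[𝓝 0] f' := h.mono fun v hv => hv.deriv
  have h4 : deriv (deriv f) 0 = A := by rw [h3.deriv_eq, h2.deriv]
  exact isLocalMin_of_deriv_deriv_pos (by rw [h4]; exact hA) (by rw [h.self_of_nhds.deriv, h0])
    h.self_of_nhds.continuousAt

lemma sqrt_pow_eq_exp {y : ℝ} (hy : 0 < y) (s : ℕ) : √y ^ s = Real.exp (s / 2 * Real.log y) := by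
  rw [show (s / 2 * Real.log y : ℝ) = s * (Real.log y / 2) by ring, Real.exp_nat_mul,
    ← Real.log_sqrt hy.le, Real.exp_log (Real.sqrt_pos.2 hy)]

theorem p2_le_p1_local (hs : 1 ≤ s) {l : ℝ} (hl : ((s : ℝ) + 2) / s < l) :
    ∀ᶠ v in 𝓝 (0 : ℝ), p2 s (t0 s + l * v) ≤ p1 s (t0 s + v) := by
  have hs0 : (0 : ℝ) < s := by exact_mod_cast hs
  have hl0 : 0 < l := lt_trans (by positivity) hl
  set b : ℝ := s / (s + 2) with hb
  have hb0 : 0 < b := by positivity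
  have hb1 : 1 - t0 s = b := one_sub_t0 s
  have ht0 := t0_pos s
  set C : ℝ := s * (s - 1) / 2 with hC
  set K : ℝ := s * (s + 1) / 2 with hK
  set C' : ℝ := (s + 2) * (s + 1) / 2 with hC'
  have hC'0 : 0 < C' := by positivity
  -- the comparison function and its derivatives
  set E : ℝ → ℝ := fun v => Real.log C' + Real.log (t0 s + v) +
    s / 2 * (Real.log (b - v) - Real.log (b - l * v)) with hE
  set E1 : ℝ → ℝ := fun v => (t0 s + v)⁻¹ + s / 2 * (-(b - v)⁻¹ + l * (b - l * v)⁻¹) with hE1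
  set X : ℝ → ℝ := fun v => (b - l * v)⁻¹ - 1 with hX
  set X1 : ℝ → ℝ := fun v => l * ((b - l * v)⁻¹) ^ 2 with hX1
  set A : ℝ → ℝ := fun v => Real.exp (E v) with hA
  set Q : ℝ → ℝ := fun v => A v ^ 2 - (1 + C * X v) * A v - K * X v with hQ
  set Q1 : ℝ → ℝ := fun v => A v * E1 v * (2 * A v - 1 - C * X v) - X1 v * (C * A v + K) with hQ1
  have hpos : ∀ᶠ v in 𝓝 (0 : ℝ), 0 < t0 s + v ∧ 0 < b - v ∧ 0 < b - l * v := by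
    refine (Tendsto.eventually_const_lt (v := t0 s + 0) (by simpa using ht0) ?_).and
      ((Tendsto.eventually_const_lt (v := b - 0) (by simpa using hb0) ?_).and
      (Tendsto.eventually_const_lt (v := b - l * 0) (by simpa using hb0) ?_))
    · exact (by fun_prop : Continuous fun v => t0 s + v).tendsto 0
    · exact (by fun_prop : Continuous fun v => b - v).tendsto 0
    · exact (by fun_prop : Continuous fun v => b - l * v).tendsto 0
  have hlin : ∀ v, HasDerivAt (fun v => b - l * v) (-l) v := fun v => by
    simpa using ((hasDerivAt_id v).const_mul l).const_sub b
  have hlin1 : ∀ v, HasDerivAt (fun v => b - v) (-1) v := fun v => by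
    simpa using (hasDerivAt_id v).const_sub b
  have hlin2 : ∀ v, HasDerivAt (fun v => t0 s + v) 1 v := fun v => by
    simpa using (hasDerivAt_id v).const_add (t0 s)
  have dX : ∀ v, 0 < b - l * v → HasDerivAt X (X1 v) v := fun v hv => by
    refine (((hlin v).fun_inv hv.ne').sub_const 1).congr_deriv ?_
    rw [hX1]; field_simp
  have dE : ∀ v, 0 < t0 s + v → 0 < b - v → 0 < b - l * v → HasDerivAt E (E1 v) v := by
    intro v h1 h2 h3
    refine ((((hlin2 v).log h1.ne').const_add (Real.log C')).add
      ((((hlin1 v).log h2.ne').sub ((hlin v).log h3.ne')).const_mul (s / 2 : ℝ))).congr_deriv ?_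
    rw [hE1]; simp only; field_simp; ring
  have dA : ∀ v, 0 < t0 s + v → 0 < b - v → 0 < b - l * v → HasDerivAt A (A v * E1 v) v :=
    fun v h1 h2 h3 => (dE v h1 h2 h3).exp
  have dQ : ∀ᶠ v in 𝓝 (0 : ℝ), HasDerivAt Q (Q1 v) v := by
    filter_upwards [hpos] with v ⟨h1, h2, h3⟩
    have ha := dA v h1 h2 h3
    have hx := dX v h3
    refine (((ha.fun_pow 2).sub (((hx.const_mul C).const_add 1).mul ha)).sub
      (hx.const_mul K)).congr_deriv ?_
    rw [hQ1]; simp only; push_cast; ring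
  have hA0 : A 0 = s + 1 := by
    have : Real.exp (E 0) = C' * t0 s := by
      rw [hE]; simp only [mul_zero, sub_zero, add_zero, sub_self]
      rw [← Real.log_mul hC'0.ne' ht0.ne', Real.exp_log (by positivity)]
    rw [hA]; simp only; rw [this, hC', t0]; field_simp
  have hX0 : X 0 = 2 / s := by rw [hX, hb]; simp only [mul_zero, sub_zero]; field_simp; ring
  have hE10 : E1 0 = l * (s + 2) / 2 := by
    rw [hE1, hb, t0]; simp only [mul_zero, sub_zero, add_zero]; field_simp; ring
  have hX10 : X1 0 = l * (s + 2) ^ 2 / s ^ 2 := by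
    rw [hX1, hb]; simp only [mul_zero, sub_zero]; field_simp
  have hQ0 : Q 0 = 0 := by
    rw [hQ]; simp only [hA0, hX0, hC, hK]; field_simp; ring
  have hQ10 : Q1 0 = 0 := by
    rw [hQ1]; simp only [hA0, hX0, hE10, hX10, hC, hK]; field_simp; ring
  have p1' : 0 < t0 s + 0 := by simpa using ht0
  have p2' : 0 < b - 0 := by simpa using hb0
  have p3' : 0 < b - l * 0 := by simpa using hb0
  have dE1 : HasDerivAt E1 (-(t0 s ^ 2)⁻¹ + s / 2 * (-(b ^ 2)⁻¹ + l ^ 2 * (b ^ 2)⁻¹)) 0 := by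
    refine (((hlin2 0).fun_inv p1'.ne').add ((((hlin1 0).fun_inv p2'.ne').neg.add
      (((hlin 0).fun_inv p3'.ne').const_mul l)).const_mul (s / 2 : ℝ))).congr_deriv ?_
    simp only [mul_zero, sub_zero, add_zero]
    field_simp
  have dX1 : HasDerivAt X1 (2 * l ^ 2 * (b ^ 3)⁻¹) 0 := by
    refine ((((hlin 0).fun_inv p3'.ne').fun_pow 2).const_mul l).congr_deriv ?_
    simp only [mul_zero, sub_zero]
    field_simp
    push_cast
    norm_num
    rw [mul_assoc, mul_inv_cancel₀ hb0.ne', mul_one]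
  have ha := dA 0 p1' p2' p3'
  have hx := dX 0 p3'
  have dQ1 := ((ha.mul dE1).mul (((ha.const_mul 2).sub_const 1).sub (hx.const_mul C))).sub
      (dX1.mul ((ha.const_mul C).add_const K))
  have hev := eventually_le_of_second_deriv (f := Q) (f' := Q1) dQ hQ10 dQ1 (by
    simp only [Pi.mul_apply, Pi.sub_apply, hA0, hX0, hE10, hX10]
    have hkey : 0 < l ^ 2 * s ^ 2 - (s + 2) ^ 2 := by
      rw [div_lt_iff₀ hs0] at hl
      nlinarith
    have : 0 < (s + 1) * (s + 2) ^ 2 / (4 * s) * (l ^ 2 * s ^ 2 - (s + 2) ^ 2) := by positivity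
    refine lt_of_lt_of_eq this ?_
    rw [hC, hK, hb, t0]
    field_simp
    ring)
  have hpos2 : ∀ᶠ v in 𝓝 (0 : ℝ), 0 < t0 s + l * v :=
    Tendsto.eventually_const_lt (v := t0 s + l * 0) (by simpa using ht0)
      ((by fun_prop : Continuous fun v => t0 s + l * v).tendsto 0)
  filter_upwards [hev, hpos, hpos2] with v hv ⟨h1, h2, h3⟩ h4
  rw [hQ0] at hv
  have ht : 1 - (t0 s + l * v) = b - l * v := by linarith
  have hx : (t0 s + l * v) / (1 - (t0 s + l * v)) = X v := by
    rw [ht, hX]; simp only; rw [div_eq_iff h3.ne', sub_mul, inv_mul_cancel₀ h3.ne']; linarith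
  have hAE : A v * √(b - l * v) ^ s = C' * (t0 s + v) * √(b - v) ^ s := by
    rw [sqrt_pow_eq_exp h3, sqrt_pow_eq_exp h2, hA]
    simp only
    have e1 := Real.exp_log hC'0
    have e2 := Real.exp_log h1
    rw [← Real.exp_add]
    nth_rewrite 1 [← e1]
    nth_rewrite 1 [← e2]
    rw [← Real.exp_add, ← Real.exp_add]
    congr 1; rw [hE]; simp only; ring
  have hle : ap s (X v) ≤ A v := by
    have hX0 : 0 ≤ X v := by rw [← hx, ht]; positivity
    refine ap_le_of_nonneg hX0 (Real.exp_pos _) ?_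
    rw [choose_two_real]
    refine hv.trans_eq ?_
    rw [hQ, hC, hK]; simp only; ring
  rw [p2, p1, hx, ht, choose_two_real, show 1 - (t0 s + v) = b - v by linarith]
  calc _ ≤ A v * √(b - l * v) ^ s := by gcongr
    _ = _ := hAE
    _ = _ := by rw [hC']; push_cast; ring
end

end

section
open Finset Function Filter Topology MeasureTheory

section
variable {s : ℕ}

lemma setIntegral_le_of_dilation {F G : ℝ → ℝ} {c l η K : ℝ} (hl : 0 < l) (hη : 0 < η)
    (hF : IntegrableOn F (Set.Ioo (c - η) (c + η)))
    (hG : ∀ v ∈ Set.Ioo (-η) η, 0 ≤ G (c + l * v))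
    (h : ∀ v ∈ Set.Ioo (-η) η, G (c + l * v) ≤ K * F (c + v)) :
    ∫ t in Set.Ioo (c - l * η) (c + l * η), G t ≤ l * (K * ∫ t in Set.Ioo (c - η) (c + η), F t) := by
  have e1 : ∫ t in Set.Ioo (c - l * η) (c + l * η), G t = l * ∫ v in Set.Ioo (-η) η, G (c + l * v) := by
    rw [← integral_Ioc_eq_integral_Ioo, ← integral_Ioc_eq_integral_Ioo,
      ← intervalIntegral.integral_of_le (by nlinarith), ← intervalIntegral.integral_of_le (by linarith),
      intervalIntegral.integral_comp_add_mul (fun t => G t) hl.ne', smul_eq_mul,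
      mul_inv_cancel_left₀ hl.ne']
    congr 1; ring
  have e2 : ∫ t in Set.Ioo (c - η) (c + η), F t = ∫ v in Set.Ioo (-η) η, F (c + v) := by
    rw [← integral_Ioc_eq_integral_Ioo, ← integral_Ioc_eq_integral_Ioo,
      ← intervalIntegral.integral_of_le (by linarith), ← intervalIntegral.integral_of_le (by linarith),
      intervalIntegral.integral_comp_add_left (fun t => F t)]
    congr 1
  have hFi : IntegrableOn (fun v => F (c + v)) (Set.Ioo (-η) η) := by
    have h1 : IntervalIntegrable F volume (c - η) (c + η) :=
      (intervalIntegrable_iff_integrableOn_Ioo_of_le (by linarith)).2 hF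
    have h2 := h1.comp_add_left c
    rw [intervalIntegrable_iff_integrableOn_Ioo_of_le (by linarith)] at h2
    simpa using h2
  rw [e1, e2]
  refine mul_le_mul_of_nonneg_left ?_ hl.le
  rw [← integral_const_mul]
  exact integral_mono_of_nonneg ((ae_restrict_iff' measurableSet_Ioo).2 (ae_of_all _ hG))
    (hFi.const_mul K) ((ae_restrict_iff' measurableSet_Ioo).2 (ae_of_all _ h))

/-- The first moment integrand. -/
noncomputable def gF (s n a : ℕ) (t : ℝ) : ℝ := bw a t * (((s + 2).choose 2 : ℕ) * t) ^ n

/-- The second moment integrand. -/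
noncomputable def gG (s n a : ℕ) (t : ℝ) : ℝ :=
  bw a t * (ap s (t / (1 - t)) ^ n + am s (t / (1 - t)) ^ n - 1)

lemma one_sub_pow_half {n a : ℕ} (ha : s * n = 2 * a) {t : ℝ} (ht : t < 1) :
    (1 - t) ^ a = (√(1 - t) ^ s) ^ n := by
  rw [← pow_mul, ha, pow_mul, Real.sq_sqrt (by linarith)]

lemma bw_nonneg (a : ℕ) {t : ℝ} (ht : t ∈ Set.Ioo (0 : ℝ) 1) : 0 ≤ bw a t := by
  have := ht.1; have : 0 < 1 - t := by linarith [ht.2]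
  unfold bw; positivity

lemma gF_eq {n a : ℕ} (ha : s * n = 2 * a) {t : ℝ} (ht : t ∈ Set.Ioo (0 : ℝ) 1) :
    gF s n a t = p1 s t ^ n * (t * √(1 - t))⁻¹ := by
  rw [gF, bw, one_sub_pow_half ha ht.2, p1]; ring

lemma gG_nonneg {n : ℕ} (a : ℕ) (hn : 1 ≤ n) {t : ℝ} (ht : t ∈ Set.Ioo (0 : ℝ) 1) :
    0 ≤ gG s n a t := by
  have hx : 0 ≤ t / (1 - t) := div_nonneg ht.1.le (by linarith [ht.2])
  have h := pow_sub_bound (one_le_ap s hx) (abs_am_le s hx) hn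
  rw [← abs_pow] at h
  exact mul_nonneg (bw_nonneg a ht) (by linarith [neg_abs_le (am s (t / (1 - t)) ^ n)])

lemma gG_le_two {n : ℕ} (a : ℕ) (hn : 1 ≤ n) {t : ℝ} (ht : t ∈ Set.Ioo (0 : ℝ) 1) :
    gG s n a t ≤ 2 * (bw a t * (ap s (t / (1 - t)) ^ n - 1)) := by
  have hx : 0 ≤ t / (1 - t) := div_nonneg ht.1.le (by linarith [ht.2])
  have h := pow_sub_bound (one_le_ap s hx) (abs_am_le s hx) hn
  rw [← abs_pow] at h
  have := bw_nonneg a ht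
  have h2 : gG s n a t ≤ bw a t * (2 * (ap s (t / (1 - t)) ^ n - 1)) :=
    mul_le_mul_of_nonneg_left (by linarith [le_abs_self (am s (t / (1 - t)) ^ n)]) this
  linarith

lemma gG_le_near {n a : ℕ} (ha : s * n = 2 * a) {t θ : ℝ} (ht : t ∈ Set.Ioo (0 : ℝ) 1)
    (hθ : |am s (t / (1 - t))| ≤ θ * ap s (t / (1 - t))) :
    gG s n a t ≤ p2 s t ^ n * (1 + θ ^ n) * (t * √(1 - t))⁻¹ := by
  have h1 : am s (t / (1 - t)) ^ n ≤ θ ^ n * ap s (t / (1 - t)) ^ n := by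
    rw [← mul_pow]
    refine (le_abs_self _).trans ?_
    rw [abs_pow]
    exact pow_le_pow_left₀ (abs_nonneg _) hθ n
  calc gG s n a t ≤ bw a t * (ap s (t / (1 - t)) ^ n * (1 + θ ^ n)) :=
        mul_le_mul_of_nonneg_left (by linarith) (bw_nonneg a ht)
    _ = _ := by rw [bw, one_sub_pow_half ha ht.2, p2]; ring

lemma gG_le_far {n a : ℕ} (hs : 1 ≤ s) (hn : 1 ≤ n) (ha : s * n = 2 * a) {t ρ : ℝ}
    (ht : t ∈ Set.Ioo (0 : ℝ) 1) (hρ : p2 s t ≤ ρ) :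
    gG s n a t ≤ 2 * (n * s ^ 2 / (1 - t0 s) + 1 / t0 s) * ρ ^ n * (√(1 - t))⁻¹ := by
  have h0 := ht.1
  have h1 : 0 < 1 - t := by linarith [ht.2]
  have hx : 0 ≤ t / (1 - t) := div_nonneg h0.le h1.le
  have hα := one_le_ap s hx
  have ht0 := t0_pos s
  have ht1 : 0 < 1 - t0 s := by linarith [t0_lt hs]
  have hp := pow_le_pow_left₀ (p2_nonneg s ⟨h0.le, ht.2⟩) hρ n
  have hρ0 : 0 ≤ ρ ^ n := le_trans (pow_nonneg (p2_nonneg s ⟨h0.le, ht.2⟩) n) hp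
  refine (gG_le_two a hn ht).trans ?_
  rw [show 2 * (n * (s : ℝ) ^ 2 / (1 - t0 s) + 1 / t0 s) * ρ ^ n * (√(1 - t))⁻¹ =
    2 * ((n * (s : ℝ) ^ 2 / (1 - t0 s) + 1 / t0 s) * ρ ^ n * (√(1 - t))⁻¹) by ring]
  refine mul_le_mul_of_nonneg_left ?_ (by norm_num)
  have hp0 := pow_nonneg (p2_nonneg s ⟨h0.le, ht.2⟩) n
  have hσ : 0 < √(1 - t) := Real.sqrt_pos.2 h1
  rcases le_total t (t0 s) with h | h
  · have h3 : ap s (t / (1 - t)) ^ n - 1 ≤ n * ap s (t / (1 - t)) ^ n * (s ^ 2 * (t / (1 - t))) := by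
      refine (pow_sub_one_le hα hn).trans ?_
      have h4 := ap_sub_one_le s hx
      have : 0 ≤ ap s (t / (1 - t)) - 1 := by linarith
      gcongr
      omega
    calc bw a t * (ap s (t / (1 - t)) ^ n - 1)
        ≤ bw a t * (n * ap s (t / (1 - t)) ^ n * (s ^ 2 * (t / (1 - t)))) :=
          mul_le_mul_of_nonneg_left h3 (bw_nonneg a ht)
      _ = n * s ^ 2 / (1 - t) * p2 s t ^ n * (√(1 - t))⁻¹ := by
          rw [bw, one_sub_pow_half ha ht.2, p2]; field_simp; rw [mul_pow, mul_comm]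
      _ ≤ n * s ^ 2 / (1 - t0 s) * ρ ^ n * (√(1 - t))⁻¹ := by gcongr
      _ ≤ _ := by
          have : 0 ≤ 1 / t0 s := by positivity
          gcongr; linarith
  · calc bw a t * (ap s (t / (1 - t)) ^ n - 1)
        ≤ bw a t * (ap s (t / (1 - t)) ^ n) :=
          mul_le_mul_of_nonneg_left (by linarith) (bw_nonneg a ht)
      _ = 1 / t * p2 s t ^ n * (√(1 - t))⁻¹ := by
          rw [bw, one_sub_pow_half ha ht.2, p2]; field_simp; rw [mul_pow, mul_comm]
      _ ≤ 1 / t0 s * ρ ^ n * (√(1 - t))⁻¹ := by gcongr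
      _ ≤ _ := by
          have : 0 ≤ n * s ^ 2 / (1 - t0 s) := by positivity
          gcongr; linarith

/-- Comparison of the two integrands near the maximum. -/
lemma gG_le_gF (hs : 1 ≤ s) {l ε : ℝ} (hl : ((s : ℝ) + 2) / s < l) (hε : 0 < ε) :
    ∃ η > 0, ∃ N : ℕ, ∀ v ∈ Set.Ioo (-η) η, t0 s + v ∈ Set.Ioo (0 : ℝ) 1 ∧
      t0 s + l * v ∈ Set.Ioo (0 : ℝ) 1 ∧
      ∀ n a : ℕ, N ≤ n → s * n = 2 * a → gG s n a (t0 s + l * v) ≤ (1 + ε) * gF s n a (t0 s + v) := by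
  have hs0 : (0 : ℝ) < s := by exact_mod_cast hs
  have ht0 := t0_pos s
  have ht1 := t0_lt hs
  obtain ⟨δ, hδ, hδε⟩ : ∃ δ > 0, (1 + δ) * (1 + δ) < 1 + ε := by
    have : Tendsto (fun δ : ℝ => (1 + δ) * (1 + δ)) (𝓝[>] 0) (𝓝 ((1 + 0) * (1 + 0))) :=
      ((by fun_prop : Continuous fun δ : ℝ => (1 + δ) * (1 + δ)).tendsto 0).mono_left nhdsWithin_le_nhds
    have h2 := (this.eventually_lt_const (u := 1 + ε) (by linarith)).and self_mem_nhdsWithin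
    obtain ⟨δ, h3, h4⟩ := h2.exists
    exact ⟨δ, h4, h3⟩
  set M : ℝ := 1 + s ^ 2 * (t0 s / (1 - t0 s) + 1) with hM
  have hM1 : 1 ≤ M := by
    have : 0 < 1 - t0 s := by linarith
    have : 0 ≤ s ^ 2 * (t0 s / (1 - t0 s) + 1) := by positivity
    linarith
  set θ : ℝ := 1 - 1 / M with hθ
  have hθ0 : 0 ≤ θ := by
    rw [hθ, sub_nonneg, div_le_one (by linarith)]; exact hM1
  have hθ1 : θ < 1 := by
    have : 0 < 1 / M := by positivity
    linarith
  obtain ⟨N, hN⟩ := eventually_atTop.1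
    ((tendsto_pow_atTop_nhds_zero_of_lt_one hθ0 hθ1).eventually_lt_const hδ)
  have c1 : Tendsto (fun v : ℝ => t0 s + v) (𝓝 0) (𝓝 (t0 s)) := by
    have := (by fun_prop : Continuous fun v : ℝ => t0 s + v).tendsto 0
    simpa using this
  have c2 : Tendsto (fun v : ℝ => t0 s + l * v) (𝓝 0) (𝓝 (t0 s)) := by
    have := (by fun_prop : Continuous fun v : ℝ => t0 s + l * v).tendsto 0
    simpa using this
  have hmem : ∀ᶠ t in 𝓝 (t0 s), t ∈ Set.Ioo (0 : ℝ) 1 := Ioo_mem_nhds ht0 ht1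
  have hg : Tendsto (fun t => (t * √(1 - t))⁻¹) (𝓝 (t0 s)) (𝓝 ((t0 s * √(1 - t0 s))⁻¹)) := by
    have h1 : 0 < √(1 - t0 s) := Real.sqrt_pos.2 (by linarith)
    exact ((by fun_prop : Continuous fun t : ℝ => t * √(1 - t)).tendsto (t0 s)).inv₀ (by positivity)
  have hgc : ∀ᶠ v in 𝓝 (0 : ℝ), ((t0 s + l * v) * √(1 - (t0 s + l * v)))⁻¹ <
      (1 + δ) * ((t0 s + v) * √(1 - (t0 s + v)))⁻¹ := by
    refine (hg.comp c2).eventually_lt ((hg.comp c1).const_mul (1 + δ)) ?_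
    have h1 : 0 < √(1 - t0 s) := Real.sqrt_pos.2 (by linarith)
    have : 0 < (t0 s * √(1 - t0 s))⁻¹ := by positivity
    nlinarith
  have hxc : ∀ᶠ t in 𝓝 (t0 s), t / (1 - t) < t0 s / (1 - t0 s) + 1 := by
    have : ContinuousAt (fun t : ℝ => t / (1 - t)) (t0 s) :=
      ContinuousAt.div (by fun_prop) (by fun_prop) (by linarith)
    exact this.tendsto.eventually_lt_const (by linarith)
  have hall := (((c1.eventually hmem).and (c2.eventually hmem)).and
    (hgc.and ((c2.eventually hxc).and (p2_le_p1_local hs hl))))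
  obtain ⟨η, hη, hη'⟩ := Metric.eventually_nhds_iff.1 hall
  refine ⟨η, hη, N, fun v hv => ?_⟩
  obtain ⟨⟨m1, m2⟩, h3, h4, h5⟩ := hη' (y := v) (by rw [Real.dist_eq, sub_zero, abs_lt]; exact hv)
  refine ⟨m1, m2, fun n a hn ha => ?_⟩
  have hx : 0 ≤ (t0 s + l * v) / (1 - (t0 s + l * v)) := div_nonneg m2.1.le (by linarith [m2.2])
  have hα := one_le_ap s hx
  have hαM : ap s ((t0 s + l * v) / (1 - (t0 s + l * v))) ≤ M := by
    have h6 := ap_sub_one_le s hx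
    have : (s : ℝ) ^ 2 * ((t0 s + l * v) / (1 - (t0 s + l * v))) ≤
      s ^ 2 * (t0 s / (1 - t0 s) + 1) := by gcongr
    linarith
  have hth : |am s ((t0 s + l * v) / (1 - (t0 s + l * v)))| ≤
      θ * ap s ((t0 s + l * v) / (1 - (t0 s + l * v))) := by
    refine (abs_am_le s hx).trans ?_
    have : ap s ((t0 s + l * v) / (1 - (t0 s + l * v))) / M ≤ 1 := (div_le_one (by linarith)).2 hαM
    rw [hθ, sub_mul, one_mul, one_div, inv_mul_eq_div]; linarith
  refine (gG_le_near ha m2 hth).trans ?_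
  rw [gF_eq ha m1]
  have q0 := p2_nonneg s ⟨m2.1.le, m2.2⟩
  have q1 : 0 < 1 - (t0 s + v) := by linarith [m1.2]
  have q2 : 0 < 1 - (t0 s + l * v) := by linarith [m2.2]
  have q3 := m1.1
  have q4 := m2.1
  have q5 := q0.trans h5
  calc _ ≤ p1 s (t0 s + v) ^ n * (1 + δ) * ((1 + δ) * ((t0 s + v) * √(1 - (t0 s + v)))⁻¹) := by
        have := (hN n hn).le
        gcongr
    _ = ((1 + δ) * (1 + δ)) * (p1 s (t0 s + v) ^ n * ((t0 s + v) * √(1 - (t0 s + v)))⁻¹) := by ring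
    _ ≤ _ := by gcongr

/-- Exponential lower bound for the first moment integral. -/
lemma integral_gF_ge (hs : 1 ≤ s) {q : ℝ} (hq0 : 0 ≤ q) (hq : q < phm s) :
    ∃ η > 0, ∀ n a : ℕ, 1 ≤ n → s * n = 2 * a → IntegrableOn (gF s n a) (Set.Ioo 0 1) →
      η * q ^ n ≤ ∫ t in Set.Ioo (0 : ℝ) 1, gF s n a t := by
  have ht0 := t0_pos s
  have ht1 := t0_lt hs
  have hc : Continuous (p1 s) := by unfold p1; fun_prop
  have h1 : ∀ᶠ t in 𝓝 (t0 s), t ∈ Set.Ioo (0 : ℝ) 1 ∧ q < p1 s t :=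
    Filter.Eventually.and (Ioo_mem_nhds ht0 ht1)
      ((hc.tendsto (t0 s)).eventually_const_lt (by rwa [p1_t0]))
  obtain ⟨η, hη, h⟩ := Metric.eventually_nhds_iff.1 h1
  refine ⟨2 * η, by positivity, fun n a hn ha hI => ?_⟩
  have hsub : Set.Ioo (t0 s - η) (t0 s + η) ⊆ Set.Ioo (0 : ℝ) 1 := fun t ht =>
    (h (y := t) (by rw [Real.dist_eq, abs_lt]; constructor <;> linarith [ht.1, ht.2])).1
  have hnn : ∀ t ∈ Set.Ioo (0 : ℝ) 1, 0 ≤ gF s n a t := fun t ht =>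
    mul_nonneg (bw_nonneg a ht) (pow_nonneg (mul_nonneg (Nat.cast_nonneg _) ht.1.le) n)
  calc 2 * η * q ^ n = ∫ t in Set.Ioo (t0 s - η) (t0 s + η), q ^ n := by
        rw [setIntegral_const]
        simp [Measure.real, show t0 s + η - (t0 s - η) = 2 * η by ring, hη.le]
    _ ≤ ∫ t in Set.Ioo (t0 s - η) (t0 s + η), gF s n a t := by
        refine setIntegral_mono_on (by simp) (hI.mono_set hsub) measurableSet_Ioo fun t ht => ?_
        have h2 := h (y := t) (by rw [Real.dist_eq, abs_lt]; constructor <;> linarith [ht.1, ht.2])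
        rw [gF_eq ha h2.1]
        have h3 := h2.1.1
        have h4 : 0 < 1 - t := by linarith [h2.1.2]
        have h5 : √(1 - t) ≤ 1 := Real.sqrt_le_one.2 (by linarith)
        have h6 : 1 ≤ (t * √(1 - t))⁻¹ := by
          have := Real.sqrt_pos.2 h4
          refine (one_le_inv₀ (by positivity)).2 ?_
          nlinarith [h2.1.2]
        calc q ^ n ≤ p1 s t ^ n * 1 := by rw [mul_one]; exact pow_le_pow_left₀ hq0 h2.2.le n
          _ ≤ _ := mul_le_mul_of_nonneg_left h6 (pow_nonneg (hq0.trans h2.2.le) n)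
    _ ≤ _ := setIntegral_mono_set hI
        ((ae_restrict_iff' measurableSet_Ioo).2 (ae_of_all _ hnn)) hsub.eventuallyLE

end

end

section
open Finset Function Filter Topology MeasureTheory

section
variable {s : ℕ}

lemma integral_gG_le (hs : 1 ≤ s) {l ε : ℝ} (hl : ((s : ℝ) + 2) / s < l) (hε : 0 < ε) :
    ∃ ρ C, 1 ≤ ρ ∧ ρ < phm s ∧ 0 ≤ C ∧ ∃ N : ℕ, ∀ n a : ℕ, N ≤ n → s * n = 2 * a →
      IntegrableOn (gF s n a) (Set.Ioo 0 1) → IntegrableOn (gG s n a) (Set.Ioo 0 1) →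
      ∫ t in Set.Ioo (0 : ℝ) 1, gG s n a t ≤
        l * (1 + ε) * (∫ t in Set.Ioo (0 : ℝ) 1, gF s n a t) + C * (n + 1) * ρ ^ n := by
  have hl0 : 0 < l := lt_trans (by have : (0 : ℝ) < s := by exact_mod_cast hs
                                   positivity) hl
  have ht0 := t0_pos s
  have ht1 : 0 < 1 - t0 s := by linarith [t0_lt hs]
  obtain ⟨η, hη, N, h⟩ := gG_le_gF hs hl hε
  obtain ⟨ρ, hρ1, hρ2, hρ⟩ := p2_far hs (η := l * η) (by positivity)
  set I := ∫ t in Set.Ioo (0 : ℝ) 1, bint 0 0 t with hI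
  have hI0 : 0 ≤ I := setIntegral_nonneg measurableSet_Ioo fun t ht => by
    have := ht.1
    unfold bint; simp
  have hbi : ∀ t, bint 0 0 t = (√(1 - t))⁻¹ := fun t => by simp [bint]
  set C := 2 * (s ^ 2 / (1 - t0 s) + 1 / t0 s) * I with hC
  refine ⟨ρ, C, hρ1, hρ2, by positivity, max N 1, fun n a hn ha hF hG => ?_⟩
  have hn1 : 1 ≤ n := (le_max_right _ _).trans hn
  have hnN : N ≤ n := (le_max_left _ _).trans hn
  have hsub : Set.Ioo (t0 s - η) (t0 s + η) ⊆ Set.Ioo (0 : ℝ) 1 := fun t ht => by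
    have := (h (t - t0 s) ⟨by linarith [ht.1], by linarith [ht.2]⟩).1
    rwa [add_sub_cancel] at this
  have hsub2 : Set.Ioo (t0 s - l * η) (t0 s + l * η) ⊆ Set.Ioo (0 : ℝ) 1 := fun t ht => by
    have := (h ((t - t0 s) / l) ⟨by rw [lt_div_iff₀ hl0]; linarith [ht.1],
      by rw [div_lt_iff₀ hl0]; linarith [ht.2]⟩).2.1
    rwa [mul_div_cancel₀ _ hl0.ne', add_sub_cancel] at this
  have hnn : ∀ t ∈ Set.Ioo (0 : ℝ) 1, 0 ≤ gF s n a t := fun t ht =>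
    mul_nonneg (bw_nonneg a ht) (pow_nonneg (mul_nonneg (Nat.cast_nonneg _) ht.1.le) n)
  have near := setIntegral_le_of_dilation (K := 1 + ε) hl0 hη (hF.mono_set hsub)
    (fun v hv => gG_nonneg a hn1 (h v hv).2.1) (fun v hv => (h v hv).2.2 n a hnN ha)
  have hFle : ∫ t in Set.Ioo (t0 s - η) (t0 s + η), gF s n a t ≤
      ∫ t in Set.Ioo (0 : ℝ) 1, gF s n a t := setIntegral_mono_set hF
        ((ae_restrict_iff' measurableSet_Ioo).2 (ae_of_all _ hnn)) hsub.eventuallyLE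
  set far := Set.Ioo (0 : ℝ) 1 \ Set.Ioo (t0 s - l * η) (t0 s + l * η) with hfar
  have hfm : MeasurableSet far := measurableSet_Ioo.diff measurableSet_Ioo
  have hfs : far ⊆ Set.Ioo (0 : ℝ) 1 := Set.sdiff_subset
  have hb := (integrable_bint_and 0 0).1
  set B := 2 * (n * s ^ 2 / (1 - t0 s) + 1 / t0 s) * ρ ^ n with hB
  have hB0 : 0 ≤ B := by positivity
  have hfar_le : ∫ t in far, gG s n a t ≤ B * I := by
    calc _ ≤ ∫ t in far, B * bint 0 0 t := by
          refine setIntegral_mono_on (hG.mono_set hfs) ((hb.mono_set hfs).const_mul B) hfm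
            fun t ht => ?_
          rw [hbi]
          refine gG_le_far hs hn1 ha ht.1 (hρ t ⟨ht.1.1.le, ht.1.2⟩ ?_)
          by_contra hcon
          push Not at hcon
          rw [abs_lt] at hcon
          exact ht.2 ⟨by linarith, by linarith⟩
      _ ≤ ∫ t in Set.Ioo (0 : ℝ) 1, B * bint 0 0 t := by
          refine setIntegral_mono_set (hb.const_mul B)
            ((ae_restrict_iff' measurableSet_Ioo).2 (ae_of_all _ fun t ht => ?_)) hfs.eventuallyLE
          simp only [hbi, Pi.zero_apply]
          positivity
      _ = B * I := by rw [integral_const_mul]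
  have hsplit : ∫ t in Set.Ioo (0 : ℝ) 1, gG s n a t =
      (∫ t in Set.Ioo (t0 s - l * η) (t0 s + l * η), gG s n a t) + ∫ t in far, gG s n a t := by
    rw [← setIntegral_union Set.disjoint_sdiff_right hfm (hG.mono_set hsub2) (hG.mono_set hfs),
      Set.union_sdiff_cancel hsub2]
  have hBC : B * I ≤ C * (n + 1) * ρ ^ n := by
    rw [hB, hC]
    have e1 : n * (s : ℝ) ^ 2 / (1 - t0 s) + 1 / t0 s ≤ (s ^ 2 / (1 - t0 s) + 1 / t0 s) * (n + 1) := by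
      have h1 : 0 ≤ (s : ℝ) ^ 2 / (1 - t0 s) := by positivity
      have h2 : 0 ≤ 1 / t0 s * n := by positivity
      rw [mul_div_assoc]; nlinarith
    calc _ ≤ 2 * ((s ^ 2 / (1 - t0 s) + 1 / t0 s) * (n + 1)) * ρ ^ n * I := by gcongr
      _ = _ := by ring
  have e3 : l * ((1 + ε) * ∫ t in Set.Ioo (t0 s - η) (t0 s + η), gF s n a t) ≤
      l * (1 + ε) * ∫ t in Set.Ioo (0 : ℝ) 1, gF s n a t := by
    rw [← mul_assoc]; gcongr
  linarith

/-- The size-biased first moment is at most `K` times the first moment for any `K > r/(r-2)`. -/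
theorem EQ_le {r : ℕ} (hs : 1 ≤ s) (hr : r = s + 2) {K : ℝ} (hK : ((s : ℝ) + 2) / s < K) :
    ∀ᶠ n in flt s, EQ r n ≤ K * EY r n := by
  have hs0 : (0 : ℝ) < s := by exact_mod_cast hs
  obtain ⟨l, hl1, hl2⟩ := exists_between hK
  have hl0 : 0 < l := lt_trans (by positivity) hl1
  obtain ⟨ε, hε, hε2⟩ : ∃ ε > 0, l * (1 + ε) < K :=
    ⟨(K - l) / (2 * l), div_pos (by linarith) (by positivity), by field_simp; linarith⟩
  obtain ⟨ρ, C, hρ1, hρ2, hC, N, h⟩ := integral_gG_le hs hl1 hε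
  obtain ⟨q, hq1, hq2⟩ := exists_between hρ2
  have hq0 : 0 < q := by linarith
  obtain ⟨η, hη, hF⟩ := integral_gF_ge hs hq0.le hq2
  have hlim : Tendsto (fun n : ℕ => (2 + C) * ((n + 1) * (ρ / q) ^ n)) atTop (𝓝 0) := by
    have hx0 : 0 ≤ ρ / q := by positivity
    have hx1 : ρ / q < 1 := (div_lt_one hq0).2 hq1
    have h1 := (tendsto_self_mul_const_pow_of_lt_one hx0 hx1).add (tendsto_pow_atTop_nhds_zero_of_lt_one hx0 hx1)
    have h2 := h1.const_mul (2 + C)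
    rw [add_zero, mul_zero] at h2
    exact h2.congr fun n => by ring
  have hev := hlim.eventually_lt_const (u := (K - l * (1 + ε)) * η) (mul_pos (by linarith) hη)
  filter_upwards [flt_le s hev, eventually_even s, flt_le s (eventually_ge_atTop (max N 1))]
    with n hn he hnN
  obtain ⟨a, ha⟩ := he
  rw [← two_mul] at ha
  have hn1 : 1 ≤ n := (le_max_right _ _).trans hnN
  obtain ⟨i1, e1⟩ := EY_eq hn1 hr ha
  obtain ⟨i2, e2⟩ := EQ_eq hn1 hs hr ha
  rw [hr] at i1 e1
  have b1 := h n a ((le_max_left _ _).trans hnN) ha i1 i2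
  have b2 := hF n a hn1 ha i1
  rw [hr] at e2 ⊢
  rw [e1, e2]
  change 1 + 1 / 2 * ∫ t in Set.Ioo (0 : ℝ) 1, gG s n a t ≤
    K * (1 / 2 * ∫ t in Set.Ioo (0 : ℝ) 1, gF s n a t)
  set J := ∫ t in Set.Ioo (0 : ℝ) 1, gF s n a t
  have hρn : 1 ≤ ρ ^ n := one_le_pow₀ hρ1
  have b3 : (2 + C) * ((n + 1) * ρ ^ n) ≤ (K - l * (1 + ε)) * (η * q ^ n) := by
    have hqn : 0 < q ^ n := by positivity
    rw [div_pow, mul_div_assoc', mul_div_assoc', div_lt_iff₀ hqn] at hn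
    linarith
  have b4 : (K - l * (1 + ε)) * (η * q ^ n) ≤ (K - l * (1 + ε)) * J :=
    mul_le_mul_of_nonneg_left b2 (by linarith)
  have b5 : 1 ≤ (n + 1) * ρ ^ n := by
    have : (0 : ℝ) ≤ n := Nat.cast_nonneg n
    nlinarith
  nlinarith

end

end

section
open Finset Function Filter Topology

lemma flt_add_two (s : ℕ) : flt (s + 2) = flt s := by
  unfold flt
  congr 2
  ext n
  simp [add_mul, Nat.even_add]

section
variable {r : ℕ} {F : Filter ℕ} {ω : ∀ n, (Fin n × Fin r → Fin n × Fin r) → ℝ} {ℓ : ℕ → ℝ}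

open scoped Classical in
theorem PHyp.tendsto_first (h : PHyp r F ω ℓ) {p : ℕ → ℝ} (hp : ∀ k, 0 ≤ p k ∧ p k ≤ 1) (m : ℕ) :
    Tendsto (fun n : ℕ => ∑ M ∈ invs univ, ω n M *
      ∑ c ∈ (cycs (Fin n) r m).filter (fun c => Sub c M), p (tch c).card) F
      (𝓝 (∑ k ∈ Icc 1 m, p k * ℓ k * lamc r k)) := by
  have h1 := (h.tendsto_fmom hp m 1)
  have h2 := (tendsto_sum_cycs r m (fun k => p k * ℓ k)).mono_left h.le_atTop
  have h3 := ((tendsto_zero_iff_abs_tendsto_zero _).2 h1).add h2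
  rw [zero_add] at h3
  refine h3.congr fun n => ?_
  simp only [es, fmom, powersetCard_one, sum_map, Function.Embedding.coeFn_mk, prod_singleton,
    sub_add_cancel]
  simp only [wt, mul_sum, sum_filter, mem_singleton, forall_eq]
  rw [sum_comm]
  refine sum_congr rfl fun M _ => sum_congr rfl fun c _ => ?_
  split_ifs <;> ring
end

section
variable {s : ℕ}

/-- The conditioning parameters. -/
noncomputable def pc (s k : ℕ) : ℝ := if Odd k then 2 / ((s : ℝ) + 1) ^ k else 0

lemma pc_mem (hs : 1 ≤ s) (k : ℕ) : 0 ≤ pc s k ∧ pc s k ≤ 1 := by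
  have hs1 : (1 : ℝ) ≤ s := by exact_mod_cast hs
  unfold pc
  split_ifs with h
  · refine ⟨by positivity, ?_⟩
    rw [div_le_one (by positivity)]
    calc (2 : ℝ) ≤ (s + 1) ^ 1 := by linarith
      _ ≤ _ := pow_le_pow_right₀ (by linarith) h.pos
  · simp

/-- Normalizing exponent of the conditioning weight. -/
noncomputable def kap (m : ℕ) : ℝ := ∑ k ∈ Icc 1 m, if Odd k then 1 / (k : ℝ) else 0

/-- Exponent of the explained variance. -/
noncomputable def vex (s m : ℕ) : ℝ :=
  ∑ k ∈ Icc 1 m, if Odd k then 2 / ((k : ℝ) * (s + 1) ^ k) else 0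

open scoped Classical in
/-- The conditioning weight: a function of the short odd cycle counts. -/
noncomputable def cw (s n m : ℕ) (M : Fin n × Fin (s + 2) → Fin n × Fin (s + 2)) : ℝ :=
  Real.exp (kap m) * ∏ c ∈ (cycs (Fin n) (s + 2) m).filter (fun c => Sub c M), (1 - pc s (tch c).card)

lemma lamc_mul (s k : ℕ) : ((((s + 2 : ℕ) : ℝ)) ^ k)⁻¹ * lamc (s + 2) k = (s + 1) ^ k / (2 * k) := by
  unfold lamc
  rw [mul_pow]
  push_cast
  rw [show (s : ℝ) + 2 - 1 = s + 1 by ring]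
  have : ((s : ℝ) + 2) ^ k ≠ 0 := by positivity
  field_simp

lemma lQ_mul_lamc (s k : ℕ) :
    lQ s k * lamc (s + 2) k = (((s : ℝ) + 1) ^ k + (-1) ^ k - 1) / (2 * k) := by
  unfold lamc lQ
  push_cast
  rw [show (s : ℝ) + 2 - 1 = s + 1 by ring]
  have : (((s : ℝ) + 2) * (s + 1)) ^ k ≠ 0 := by positivity
  field_simp

theorem tendsto_cw_sq (hs : 1 ≤ s) (m : ℕ) :
    Tendsto (fun n : ℕ => ∑ M ∈ invs univ, wP (s + 2) n M * cw s n m M ^ 2) (flt s)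
      (𝓝 (Real.exp (vex s m))) := by
  have hp : ∀ k, 0 ≤ 2 * pc s k - pc s k ^ 2 ∧ 2 * pc s k - pc s k ^ 2 ≤ 1 := fun k => by
    have := pc_mem hs k
    constructor <;> nlinarith
  have h := ((pHyp_wP (r := s + 2) (by omega)).tendsto_eprod hp m).const_mul (Real.exp (kap m) ^ 2)
  rw [flt_add_two] at h
  have e : Real.exp (kap m) ^ 2 * Real.exp (-∑ k ∈ Icc 1 m, (2 * pc s k - pc s k ^ 2) *
      (((s + 2 : ℕ) : ℝ) ^ k)⁻¹ * lamc (s + 2) k) = Real.exp (vex s m) := by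
    rw [← Real.exp_nat_mul, ← Real.exp_add, kap, vex, mul_sum, ← sub_eq_add_neg, ← sum_sub_distrib]
    congr 1
    refine sum_congr rfl fun k hk => ?_
    have hk : (k : ℝ) ≠ 0 := by have := (mem_Icc.1 hk).1; positivity
    rw [mul_assoc, lamc_mul, pc]
    split_ifs
    · push_cast; field_simp; ring
    · simp
  rw [e] at h
  refine h.congr fun n => ?_
  rw [eprod, mul_sum]
  refine sum_congr rfl fun M _ => ?_
  rw [cw, mul_pow, ← prod_pow]
  rw [prod_congr rfl fun c _ => show (1 - pc s (tch c).card) ^ 2 =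
    1 - (2 * pc s (tch c).card - pc s (tch c).card ^ 2) by ring]
  ring

theorem tendsto_cw_biased (hs : 1 ≤ s) (m : ℕ) :
    Tendsto (fun n : ℕ => ∑ M ∈ invs univ, wQ (s + 2) n M * cw s n m M) (flt s)
      (𝓝 (Real.exp (vex s m))) := by
  have h := ((pHyp_wQ (s := s) rfl hs).tendsto_eprod (pc_mem hs) m).const_mul (Real.exp (kap m))
  have e : Real.exp (kap m) * Real.exp (-∑ k ∈ Icc 1 m, pc s k * lQ s k * lamc (s + 2) k) =
      Real.exp (vex s m) := by
    rw [← Real.exp_add, kap, vex, ← sub_eq_add_neg, ← sum_sub_distrib]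
    congr 1
    refine sum_congr rfl fun k hk => ?_
    have hk : (k : ℝ) ≠ 0 := by have := (mem_Icc.1 hk).1; positivity
    rw [mul_assoc, lQ_mul_lamc, pc]
    split_ifs with ho
    · rw [ho.neg_one_pow]; field_simp; ring
    · simp
  rw [e] at h
  refine h.congr fun n => ?_
  rw [eprod, mul_sum]
  refine sum_congr rfl fun M _ => ?_
  rw [cw]; ring

/-- The variance of the normalized Hamilton cycle count not explained by short odd cycles. -/
theorem eventually_variance (hs : 1 ≤ s) (m : ℕ) {δ : ℝ} (hδ : 0 < δ) :
    ∀ᶠ n in flt s, ∑ M ∈ invs univ, wP (s + 2) n M * (ycnt M / EY (s + 2) n - cw s n m M) ^ 2 ≤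
      ((s : ℝ) + 2) / s - Real.exp (vex s m) + δ := by
  have h1 := (tendsto_cw_sq hs m).eventually_lt_const (u := Real.exp (vex s m) + δ / 4) (by linarith)
  have h2 := (tendsto_cw_biased hs m).eventually_const_lt (u := Real.exp (vex s m) - δ / 4) (by linarith)
  have h3 := EQ_le (r := s + 2) hs rfl (K := ((s : ℝ) + 2) / s + δ / 4) (by linarith)
  filter_upwards [h1, h2, h3, eventually_even s, flt_le s (eventually_ge_atTop 1)]
    with n h1 h2 h3 he hn
  have hEY := EY_eq' (n := n) (s := s) (r := s + 2) rfl
  have hd1 : (0 : ℝ) < dm (s * n) := by exact_mod_cast dm_pos he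
  have hd2 : (0 : ℝ) < dm ((s + 2) * n) := by
    exact_mod_cast dm_pos (by rw [add_mul]; exact he.add (by simp))
  have hham : (0 : ℝ) < (ham (Fin n) (s + 2)).card := by
    rw [card_ham hn]
    exact_mod_cast Nat.mul_pos (pow_pos (Nat.choose_pos (by omega)) _) (cc_pos n)
  have hEY0 : 0 < EY (s + 2) n := by rw [hEY]; positivity
  have hPQ : ∀ M, wP (s + 2) n M * (ycnt M / EY (s + 2) n) = wQ (s + 2) n M := fun M => by
    rw [hEY, wP, wQ, show (s + 2) * n - 2 * n = s * n by rw [add_mul, Nat.add_sub_cancel]]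
    field_simp
  have hx : ∑ M ∈ invs univ, wP (s + 2) n M * (ycnt M / EY (s + 2) n - cw s n m M) ^ 2 =
      EQ (s + 2) n / EY (s + 2) n - 2 * ∑ M ∈ invs univ, wQ (s + 2) n M * cw s n m M +
        ∑ M ∈ invs univ, wP (s + 2) n M * cw s n m M ^ 2 := by
    rw [EQ, sum_div, mul_sum, ← sum_sub_distrib, ← sum_add_distrib]
    refine sum_congr rfl fun M _ => ?_
    rw [← hPQ]; ring
  have h4 : EQ (s + 2) n / EY (s + 2) n ≤ ((s : ℝ) + 2) / s + δ / 4 := (div_le_iff₀ hEY0).2 h3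
  rw [hx]
  linarith
end

end

section
open Finset Function Filter Topology

section
variable {s : ℕ}

lemma vex_two_mul (s j : ℕ) : vex s (2 * j) =
    ∑ k ∈ range j, (2 : ℝ) * (1 / (2 * k + 1)) * (1 / ((s : ℝ) + 1)) ^ (2 * k + 1) := by
  unfold vex
  induction j with
  | zero => simp
  | succ j ih =>
    rw [sum_range_succ, ← ih, show 2 * (j + 1) = 2 * j + 1 + 1 by ring,
      sum_Icc_succ_top (by omega), sum_Icc_succ_top (by omega), if_pos (by simp), if_neg (by simp [Nat.even_add_one])]
    push_cast
    rw [add_zero, one_div_pow]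
    congr 1
    have : ((s : ℝ) + 1) ^ (2 * j + 1) ≠ 0 := by positivity
    field_simp

lemma exists_variance_tail (hs : 1 ≤ s) :
    ∃ C : ℝ, 0 ≤ C ∧ ∀ j, ((s : ℝ) + 2) / s - Real.exp (vex s (2 * j)) ≤ C * (1 / 4) ^ j := by
  have hs1 : (1 : ℝ) ≤ s := by exact_mod_cast hs
  set x : ℝ := 1 / ((s : ℝ) + 1) with hx
  have hx0 : 0 < x := by positivity
  have hx1 : x ≤ 1 / 2 := by rw [hx]; gcongr; linarith
  have hsum := Real.hasSum_log_sub_log_of_abs_lt_one (x := x) (by rw [abs_of_pos hx0]; linarith)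
  set V := Real.log (1 + x) - Real.log (1 - x) with hV
  have hVe : Real.exp V = ((s : ℝ) + 2) / s := by
    rw [hV, Real.exp_sub, Real.exp_log (by linarith), Real.exp_log (by linarith), hx]
    have h0 : (s : ℝ) ≠ 0 := by positivity
    have e : (1 : ℝ) - 1 / (s + 1) = s / (s + 1) := by field_simp; ring
    rw [e]
    field_simp; ring
  have hV0 : 0 ≤ V := hsum.nonneg fun k => by positivity
  refine ⟨Real.exp V * V, by positivity, fun j => ?_⟩
  rw [vex_two_mul, ← hVe]
  set v := ∑ k ∈ range j, (2 : ℝ) * (1 / (2 * k + 1)) * x ^ (2 * k + 1) with hv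
  have htail : V - v ≤ V * (1 / 4) ^ j := by
    have h1 := (hasSum_nat_add_iff' j).2 hsum
    have h2 := hsum.mul_right ((1 / 4 : ℝ) ^ j)
    refine hasSum_le (fun k => ?_) h1 h2
    have e1 : x ^ (2 * (k + j) + 1) = x ^ (2 * k + 1) * (x ^ 2) ^ j := by ring
    have e2 : (x ^ 2) ^ j ≤ (1 / 4) ^ j := by
      have : x ^ 2 ≤ 1 / 4 := by nlinarith
      gcongr
    have e3 : (1 : ℝ) / (2 * (k + j : ℕ) + 1) ≤ 1 / (2 * k + 1) := by
      push_cast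
      have : (0 : ℝ) ≤ j := Nat.cast_nonneg j
      gcongr; linarith
    rw [e1, ← mul_assoc]
    gcongr
  have h3 : Real.exp v = Real.exp V * Real.exp (-(V - v)) := by rw [← Real.exp_add]; congr 1; ring
  have h4 := Real.add_one_le_exp (-(V - v))
  have h5 := Real.exp_pos V
  rw [h3]
  nlinarith

/-- No cycle of length at most two is contained in `M`. -/
def Smp {V : Type*} [Fintype V] [DecidableEq V] {r : ℕ} (M : V × Fin r → V × Fin r) : Prop :=
  ∀ c, IsCyc c → (tch c).card ≤ 2 → ¬ Sub c M

/-- Parameters dominating the logarithmic loss of the conditioning weight. -/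
noncomputable def pl (s k : ℕ) : ℝ := if 3 ≤ k then 2 * pc s k else 0

lemma pc_le (hs : 1 ≤ s) {k : ℕ} (hk : 3 ≤ k) : pc s k ≤ 1 / 4 := by
  have hs1 : (1 : ℝ) ≤ s := by exact_mod_cast hs
  unfold pc
  split_ifs
  · rw [div_le_iff₀ (by positivity)]
    calc (2 : ℝ) = 1 / 4 * 2 ^ 3 := by norm_num
      _ ≤ 1 / 4 * (s + 1) ^ 3 := by gcongr; linarith
      _ ≤ _ := by gcongr; linarith
  · norm_num

lemma pl_mem (hs : 1 ≤ s) (k : ℕ) : 0 ≤ pl s k ∧ pl s k ≤ 1 := by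
  unfold pl
  have := (pc_mem hs k).1
  split_ifs with h
  · have := pc_le hs h
    constructor <;> linarith
  · simp

lemma exp_neg_pl_le (hs : 1 ≤ s) {k : ℕ} (hk : 3 ≤ k) : Real.exp (-pl s k) ≤ 1 - pc s k := by
  rw [pl, if_pos hk]
  have h0 := (pc_mem hs k).1
  have h1 := pc_le hs hk
  have h2 := Real.add_one_le_exp (2 * pc s k)
  rw [Real.exp_neg, inv_le_iff_one_le_mul₀ (Real.exp_pos _)]
  nlinarith

open scoped Classical in
/-- The logarithmic loss. -/
noncomputable def loss (s n m : ℕ) (M : Fin n × Fin (s + 2) → Fin n × Fin (s + 2)) : ℝ :=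
  ∑ c ∈ (cycs (Fin n) (s + 2) m).filter (fun c => Sub c M), pl s (tch c).card

lemma loss_nonneg (hs : 1 ≤ s) (n m : ℕ) (M) : 0 ≤ loss s n m M :=
  sum_nonneg fun c _ => (pl_mem hs _).1

lemma exp_neg_loss_le (hs : 1 ≤ s) {n m : ℕ} {M : Fin n × Fin (s + 2) → Fin n × Fin (s + 2)}
    (hM : Smp M) : Real.exp (-loss s n m M) ≤ cw s n m M := by
  have hk : 0 ≤ kap m := sum_nonneg fun k _ => by split_ifs <;> positivity
  rw [loss, ← sum_neg_distrib, Real.exp_sum, cw]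
  have h1 : ∏ c ∈ (cycs (Fin n) (s + 2) m).filter (fun c => Sub c M), Real.exp (-pl s (tch c).card) ≤
      ∏ c ∈ (cycs (Fin n) (s + 2) m).filter (fun c => Sub c M), (1 - pc s (tch c).card) := by
    refine prod_le_prod (fun c _ => (Real.exp_pos _).le) fun c hc => exp_neg_pl_le hs ?_
    rw [mem_filter, mem_cycs] at hc
    by_contra h
    exact hM c hc.1.1 (by omega) hc.2
  refine h1.trans (le_mul_of_one_le_left ?_ (Real.one_le_exp hk))
  exact prod_nonneg fun c _ => by linarith [(pc_mem hs (tch c).card).2]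

theorem eventually_loss (hs : 1 ≤ s) (m : ℕ) :
    ∀ᶠ n in flt s, ∑ M ∈ invs univ, wP (s + 2) n M * loss s n m M ≤
      2 * (∑ k ∈ range m, 1 / ((k : ℝ) + 1)) + 1 := by
  have h := (pHyp_wP (r := s + 2) (by omega)).tendsto_first (pl_mem hs) m
  rw [flt_add_two] at h
  refine h.eventually_le_const (lt_of_le_of_lt ?_ (lt_add_one _))
  rw [mul_sum, show Icc 1 m = Ico 1 (m + 1) from rfl, sum_Ico_eq_sum_range, Nat.add_sub_cancel]
  refine sum_le_sum fun k _ => ?_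
  rw [mul_assoc, lamc_mul, pl, pc]
  have h2 : (0 : ℝ) < ((1 + k : ℕ) : ℝ) := by positivity
  split_ifs
  · apply le_of_eq; push_cast; field_simp; ring
  · simp; positivity
  · simp; positivity

open scoped Classical in
theorem tendsto_bad (hs : 1 ≤ s) :
    Tendsto (fun n : ℕ => ∑ M ∈ (invs univ).filter (fun M => Smp M ∧ ycnt M = 0), wP (s + 2) n M)
      (flt s) (𝓝 0) := by
  obtain ⟨C, hC0, hC⟩ := exists_variance_tail hs
  set H : ℕ → ℝ := fun m => ∑ k ∈ range m, 1 / ((k : ℝ) + 1) with hH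
  have hw : ∀ n M, 0 ≤ wP (s + 2) n M := fun n M => by unfold wP; positivity
  have key : ∀ j : ℕ, 0 < j → ∀ᶠ n in flt s,
      ∑ M ∈ (invs univ).filter (fun M => Smp M ∧ ycnt M = 0), wP (s + 2) n M ≤
      (2 * H (2 * j) + 1) * (4 / j) + (C + 1) * (1 / 2) ^ j := by
    intro j hj
    have hj0 : (0 : ℝ) < j := by exact_mod_cast hj
    filter_upwards [eventually_variance hs (2 * j) (δ := (1 / 4) ^ j) (by positivity),
      eventually_loss hs (2 * j)] with n h1 h2
    have hpt : ∀ M ∈ (invs univ).filter (fun M => Smp M ∧ ycnt M = 0), wP (s + 2) n M ≤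
        wP (s + 2) n M * loss s n (2 * j) M * (4 / j) +
        wP (s + 2) n M * (ycnt M / EY (s + 2) n - cw s n (2 * j) M) ^ 2 * 2 ^ j := by
      intro M hM
      obtain ⟨_, hM1, hM2⟩ := mem_filter.1 hM
      rw [hM2]
      have hl := loss_nonneg hs n (2 * j) M
      have hcw := exp_neg_loss_le (m := 2 * j) hs hM1
      have : 1 ≤ loss s n (2 * j) M * (4 / j) + cw s n (2 * j) M ^ 2 * 2 ^ j := by
        rcases le_total (loss s n (2 * j) M) (j / 4) with h | h
        · have e1 : Real.exp (-(j / 4)) ≤ cw s n (2 * j) M :=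
            (Real.exp_le_exp.2 (by linarith)).trans hcw
          have e2 : Real.exp (-(j / 4)) ^ 2 ≤ cw s n (2 * j) M ^ 2 :=
            pow_le_pow_left₀ (Real.exp_pos _).le e1 2
          have e3 : 1 ≤ Real.exp (-(j / 4)) ^ 2 * 2 ^ j := by
            rw [← Real.exp_nat_mul, show ((2 : ℕ) : ℝ) * (-(j / 4)) = -(j * (1 / 2)) by push_cast; ring,
              Real.exp_neg, Real.exp_nat_mul, inv_mul_eq_div, one_le_div (by positivity)]
            refine pow_le_pow_left₀ (Real.exp_pos _).le ?_ j
            have e4 : Real.exp (1 / 2) ^ 2 ≤ 2 ^ 2 := by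
              rw [← Real.exp_nat_mul]
              norm_num
              linarith [Real.exp_one_lt_d9]
            exact (pow_le_pow_iff_left₀ (Real.exp_pos _).le (by norm_num) (by norm_num)).1 e4
          have e5 : Real.exp (-(j / 4)) ^ 2 * 2 ^ j ≤ cw s n (2 * j) M ^ 2 * 2 ^ j := by gcongr
          have e6 : 0 ≤ loss s n (2 * j) M * (4 / j) := by positivity
          linarith
        · have e1 : 1 ≤ loss s n (2 * j) M * (4 / j) := by
            calc (1 : ℝ) = j / 4 * (4 / j) := by field_simp
              _ ≤ _ := by gcongr
          have e2 : 0 ≤ cw s n (2 * j) M ^ 2 * 2 ^ j := by positivity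
          linarith
      have h3 := mul_le_mul_of_nonneg_left this (hw n M)
      calc _ = wP (s + 2) n M * 1 := (mul_one _).symm
        _ ≤ _ := h3
        _ = _ := by push_cast; ring
    calc _ ≤ ∑ M ∈ (invs univ).filter (fun M => Smp M ∧ ycnt M = 0),
          (wP (s + 2) n M * loss s n (2 * j) M * (4 / j) +
          wP (s + 2) n M * (ycnt M / EY (s + 2) n - cw s n (2 * j) M) ^ 2 * 2 ^ j) := sum_le_sum hpt
      _ ≤ ∑ M ∈ invs univ, (wP (s + 2) n M * loss s n (2 * j) M * (4 / j) +
          wP (s + 2) n M * (ycnt M / EY (s + 2) n - cw s n (2 * j) M) ^ 2 * 2 ^ j) := by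
          refine sum_le_sum_of_subset_of_nonneg (filter_subset _ _) fun M _ _ => ?_
          have := hw n M
          have := loss_nonneg hs n (2 * j) M
          positivity
      _ = (∑ M ∈ invs univ, wP (s + 2) n M * loss s n (2 * j) M) * (4 / j) +
          (∑ M ∈ invs univ, wP (s + 2) n M * (ycnt M / EY (s + 2) n - cw s n (2 * j) M) ^ 2) * 2 ^ j := by
          rw [sum_add_distrib, sum_mul, sum_mul]
      _ ≤ (2 * H (2 * j) + 1) * (4 / j) + (C * (1 / 4) ^ j + (1 / 4) ^ j) * 2 ^ j := by
          have := hC j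
          gcongr
          linarith
      _ = _ := by
          have : (1 / 4 : ℝ) ^ j * 2 ^ j = (1 / 2) ^ j := by rw [← mul_pow]; norm_num
          rw [← this]; ring
  have hlim : Tendsto (fun j : ℕ => (2 * H (2 * j) + 1) * (4 / j) + (C + 1) * (1 / 2) ^ j) atTop (𝓝 0) := by
    have c1 := (tendsto_one_div_add_atTop_nhds_zero_nat (𝕜 := ℝ)).cesaro
    have c2 := c1.comp (tendsto_id.const_mul_atTop' (zero_lt_two' ℕ))
    have c3 := tendsto_inv_atTop_nhds_zero_nat (𝕜 := ℝ)
    have c4 := tendsto_pow_atTop_nhds_zero_of_lt_one (r := (1 / 2 : ℝ)) (by norm_num) (by norm_num)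
    have c5 := ((c2.const_mul 16).add (c3.const_mul 4)).add (c4.const_mul (C + 1))
    simp only [mul_zero, add_zero] at c5
    refine c5.congr fun j => ?_
    simp only [Function.comp_apply, id, hH]
    push_cast
    rw [mul_inv]
    ring
  rw [Metric.tendsto_nhds]
  intro ε hε
  obtain ⟨j, hj1, hj2⟩ := ((hlim.eventually_lt_const hε).and (eventually_gt_atTop 0)).exists
  filter_upwards [key j hj2] with n hn
  rw [Real.dist_eq, sub_zero, abs_of_nonneg (sum_nonneg fun M _ => hw n M)]
  linarith

open scoped Classical in
theorem tendsto_simple (hs : 1 ≤ s) : ∃ c : ℝ, 0 < c ∧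
    Tendsto (fun n : ℕ => ∑ M ∈ (invs univ).filter (fun M => Smp M), wP (s + 2) n M)
      (flt s) (𝓝 c) := by
  have h := (pHyp_wP (r := s + 2) (by omega)).tendsto_eprod (p := fun _ => 1)
    (fun _ => ⟨zero_le_one, le_rfl⟩) 2
  rw [flt_add_two] at h
  refine ⟨_, Real.exp_pos _, h.congr fun n => ?_⟩
  rw [eprod, sum_filter]
  refine sum_congr rfl fun M _ => ?_
  split_ifs with hM
  · rw [filter_eq_empty_iff.2, prod_empty, mul_one]
    intro c hc
    rw [mem_cycs] at hc
    exact hM c hc.1 hc.2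
  · unfold Smp at hM
    push Not at hM
    obtain ⟨c, h1, h2, h3⟩ := hM
    rw [prod_eq_zero (i := c) (by rw [mem_filter, mem_cycs]; exact ⟨⟨h1, h2⟩, h3⟩) (by simp), mul_zero]

open scoped Classical in
/-- Among simple matchings, the proportion without Hamilton cycles tends to zero. -/
theorem tendsto_proportion (hs : 1 ≤ s) :
    Tendsto (fun n : ℕ =>
      (((invs (univ : Finset (Fin n × Fin (s + 2)))).filter (fun M => Smp M ∧ ycnt M = 0)).card : ℝ) /
      ((invs (univ : Finset (Fin n × Fin (s + 2)))).filter (fun M => Smp M)).card) (flt s) (𝓝 0) := by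
  obtain ⟨c, hc, h⟩ := tendsto_simple hs
  have h2 := (tendsto_bad hs).div h hc.ne'
  rw [zero_div] at h2
  refine h2.congr' ?_
  filter_upwards [eventually_even s] with n he
  have hd2 : (dm ((s + 2) * n) : ℝ) ≠ 0 := by
    exact_mod_cast (dm_pos (by rw [add_mul]; exact he.add (by simp))).ne'
  simp only [Pi.div_apply, wP, sum_const, nsmul_eq_mul]
  field_simp
end

end

section
open Finset Function

section
variable {V : Type*} [Fintype V] [DecidableEq V] {r : ℕ}

lemma twoFib_of_pairs {S : Finset (V × Fin r)}
    (h : ∀ x ∈ S, ∃ y ∈ S, y ≠ x ∧ y.1 = x.1 ∧ ∀ z ∈ S, z.1 = x.1 → z = x ∨ z = y) : TwoFib S := by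
  intro v
  rcases (slice S v).eq_empty_or_nonempty with h0 | ⟨i, hi⟩
  · left; rw [h0, card_empty]
  · right
    obtain ⟨⟨w, j⟩, hy, hne, hw, hz⟩ := h _ (mem_slice.1 hi)
    simp only at hw
    subst hw
    rw [card_eq_two]
    refine ⟨i, j, fun e => hne (by rw [e]), ?_⟩
    ext l
    rw [mem_slice, mem_insert, mem_singleton]
    constructor
    · intro hl
      rcases hz _ hl rfl with e | e
      · exact Or.inl (Prod.ext_iff.1 e).2
      · exact Or.inr (Prod.ext_iff.1 e).2
    · rintro (rfl | rfl)
      · exact mem_slice.1 hi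
      · exact hy

lemma isCyc_restr {M : V × Fin r → V × Fin r} (hM : ∀ x, M (M x) = x) (hM' : ∀ x, M x ≠ x)
    {S : Finset (V × Fin r)} (hne : S.Nonempty) (hS : ∀ x ∈ S, M x ∈ S) (h2 : TwoFib S)
    (hc : ∀ T ⊆ S, T.Nonempty → (∀ x ∈ T, M x ∈ T) → (∀ x ∈ T, other S x ∈ T) → S ⊆ T) :
    IsCyc (restr M S) ∧ tch (restr M S) = S.image Prod.fst ∧ Sub (restr M S) M := by
  have hmv : mv (restr M S) = S := by
    rw [mv_restr, inter_eq_right]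
    exact fun x _ => mem_mv.2 (hM' x)
  refine ⟨⟨restr_invol hM hS, by rwa [hmv], by rwa [hmv], ?_⟩, by rw [tch, hmv], ?_⟩
  · rw [hmv]
    intro T hT hT0 hcl
    rw [h2.mv_other] at hT ⊢
    refine hT.antisymm (hc T hT hT0 (fun x hx => ?_) fun x hx => (hcl x hx).1)
    have := (hcl x hx).2
    rwa [restr, if_pos (hT hx)] at this
  · intro x hx
    have : x ∈ S := by rw [← hmv, mem_mv]; exact hx
    rw [restr, if_pos this]

lemma Smp.fst_ne {M : V × Fin r → V × Fin r} (hM : ∀ x, M (M x) = x) (hM' : ∀ x, M x ≠ x)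
    (h : Smp M) (a : V × Fin r) : (M a).1 ≠ a.1 := by
  intro hab
  have hne := hM' a
  set S : Finset (V × Fin r) := {a, M a} with hS
  have h2 : TwoFib S := by
    apply twoFib_of_pairs
    intro x hx
    rw [hS, mem_insert, mem_singleton] at hx
    rcases hx with rfl | rfl
    · exact ⟨M x, by simp [hS], hne, hab, by simp [hS]⟩
    · exact ⟨a, by simp [hS], hne.symm, hab.symm, by simp [hS, or_comm]⟩
  obtain ⟨c1, c2, c3⟩ := isCyc_restr hM hM' (S := S) ⟨a, by simp [hS]⟩ (by simp [hS, hM]) h2 (by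
    intro T hT ⟨x, hx⟩ hcl _
    have hx' := hT hx
    have hmx := hcl x hx
    rw [hS, mem_insert, mem_singleton] at hx'
    rw [hS, insert_subset_iff, singleton_subset_iff]
    rcases hx' with rfl | rfl
    · exact ⟨hx, hmx⟩
    · rw [hM] at hmx; exact ⟨hmx, hx⟩)
  refine h _ c1 ?_ c3
  rw [c2]
  exact card_image_le.trans card_le_two

lemma Smp.fst_inj {M : V × Fin r → V × Fin r} (hM : ∀ x, M (M x) = x) (hM' : ∀ x, M x ≠ x)
    (h : Smp M) {a b : V × Fin r} (hab : a.1 = b.1) (hMab : (M a).1 = (M b).1) : a = b := by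
  by_contra hne
  have ha := h.fst_ne hM hM' a
  have hne2 : M a ≠ M b := fun e => hne (by rw [← hM a, e, hM])
  set S : Finset (V × Fin r) := {a, b, M a, M b} with hS
  have key : ∀ x y : V × Fin r, x ≠ y → x.1 = y.1 → (M x).1 = (M y).1 → (M x).1 ≠ x.1 →
      ∀ z ∈ ({x, y, M x, M y} : Finset (V × Fin r)), z.1 = x.1 → z = x ∨ z = y := by
    intro x y h1 h2 h3 h4 z hz hzx
    simp only [mem_insert, mem_singleton] at hz
    rcases hz with rfl | rfl | rfl | rfl
    · simp
    · simp
    · exact absurd hzx h4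
    · exact absurd (h3.trans hzx) h4
  have p1 : S = {b, a, M b, M a} := by ext; simp [hS]; tauto
  have p2 : S = {M a, M b, M (M a), M (M b)} := by ext; simp [hS, hM]; tauto
  have p3 : S = {M b, M a, M (M b), M (M a)} := by ext; simp [hS, hM]; tauto
  have h2 : TwoFib S := by
    apply twoFib_of_pairs
    intro x hx
    simp only [hS, mem_insert, mem_singleton] at hx
    rcases hx with rfl | rfl | rfl | rfl
    · exact ⟨b, by simp [hS], Ne.symm hne, hab.symm, key x b hne hab hMab ha⟩
    · refine ⟨a, by simp [hS], hne, hab, ?_⟩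
      rw [p1]
      exact key x a (Ne.symm hne) hab.symm hMab.symm (by rw [← hMab, ← hab]; exact ha)
    · refine ⟨M b, by simp [hS], hne2.symm, hMab.symm, ?_⟩
      rw [p2]
      exact key _ _ hne2 hMab (by rw [hM, hM, hab]) (by rw [hM]; exact ha.symm)
    · refine ⟨M a, by simp [hS], hne2, hMab, ?_⟩
      rw [p3]
      exact key _ _ hne2.symm hMab.symm (by rw [hM, hM, hab]) (by rw [hM, ← hMab, ← hab]; exact ha.symm)
  have ma : a ∈ S := by simp [hS]
  have mb : b ∈ S := by simp [hS]
  have mMa : M a ∈ S := by simp [hS]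
  have mMb : M b ∈ S := by simp [hS]
  have oa : other S a = b := h2.other_eq ma mb hab.symm (Ne.symm hne)
  have ob : other S b = a := h2.other_eq mb ma hab hne
  obtain ⟨c1, c2, c3⟩ := isCyc_restr hM hM' (S := S) ⟨a, ma⟩ (by simp [hS, hM]) h2 (by
    intro T hT ⟨x, hx⟩ hcl ho
    have hx' := hT hx
    have hmx := hcl x hx
    have haT : a ∈ T := by
      simp only [hS, mem_insert, mem_singleton] at hx'
      rcases hx' with rfl | rfl | rfl | rfl
      · exact hx
      · rw [← ob]; exact ho _ hx
      · rwa [hM] at hmx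
      · rw [hM] at hmx; rw [← ob]; exact ho _ hmx
    have hbT : b ∈ T := by rw [← oa]; exact ho _ haT
    simp only [hS, insert_subset_iff, singleton_subset_iff]
    exact ⟨haT, hbT, hcl _ haT, hcl _ hbT⟩)
  refine h _ c1 ?_ c3
  rw [c2]
  have : S.image Prod.fst ⊆ {a.1, (M a).1} := by
    intro v
    simp only [hS, mem_image, mem_insert, mem_singleton]
    rintro ⟨x, rfl | rfl | rfl | rfl, rfl⟩
    · simp
    · simp [hab]
    · simp
    · simp [hMab]
  exact (card_le_card this).trans card_le_two

lemma smp_of_inj {M : V × Fin r → V × Fin r} (h1 : ∀ a, (M a).1 ≠ a.1)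
    (h2 : ∀ a b : V × Fin r, a.1 = b.1 → (M a).1 = (M b).1 → a = b) : Smp M := by
  intro c hc hcard hsub
  obtain ⟨x, hx⟩ := hc.ne
  obtain ⟨y, hy, hyx, hyx1⟩ := hc.two.exists hx
  have ex : c x = M x := (hsub x (mem_mv.1 hx)).symm
  have ey : c y = M y := (hsub y (mem_mv.1 hy)).symm
  have : 2 < (tch c).card := by
    rw [two_lt_card]
    refine ⟨x.1, mem_image_of_mem _ hx, (M x).1, ?_, (M y).1, ?_, (h1 x).symm, ?_, ?_⟩
    · rw [← ex]; exact mem_image_of_mem _ (mv_closed hc.inv hx)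
    · rw [← ey]; exact mem_image_of_mem _ (mv_closed hc.inv hy)
    · rw [← hyx1]; exact (h1 y).symm
    · exact fun e => hyx (h2 _ _ hyx1 e.symm)
  omega

/-- The graph of a matching of points. -/
def toG (M : V × Fin r → V × Fin r) : SimpleGraph V :=
  SimpleGraph.fromRel fun u v => ∃ i, (M (u, i)).1 = v

lemma toG_adj {M : V × Fin r → V × Fin r} (hM : ∀ x, M (M x) = x) (h : ∀ a, (M a).1 ≠ a.1)
    {u v : V} : (toG M).Adj u v ↔ ∃ i, (M (u, i)).1 = v := by
  rw [toG, SimpleGraph.fromRel_adj]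
  constructor
  · rintro ⟨_, h | ⟨i, rfl⟩⟩
    · exact h
    · exact ⟨(M (v, i)).2, by rw [Prod.mk.eta, hM]⟩
  · rintro ⟨i, rfl⟩
    exact ⟨(h (u, i)).symm, Or.inl ⟨i, rfl⟩⟩

lemma toG_regular {M : V × Fin r → V × Fin r} (hM : ∀ x, M (M x) = x) (h : ∀ a, (M a).1 ≠ a.1)
    (h2 : ∀ a b : V × Fin r, a.1 = b.1 → (M a).1 = (M b).1 → a = b) (v : V) :
    ((toG M).neighborSet v).ncard = r := by
  have : (toG M).neighborSet v = (fun i => (M (v, i)).1) '' Set.univ := by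
    ext w
    simp [SimpleGraph.mem_neighborSet, toG_adj hM h]
  rw [this, Set.ncard_image_of_injective, Set.ncard_univ, Nat.card_fin]
  exact fun i j e => (Prod.ext_iff.1 (h2 (v, i) (v, j) rfl e)).2
end

end

section
open Finset Function

section
variable {V : Type*} [Fintype V] [DecidableEq V] {r : ℕ}

/-- The matching obtained by numbering the neighbours of every vertex. -/
def ofNum {G : SimpleGraph V} (e : ∀ v, Fin r ≃ G.neighborSet v) (x : V × Fin r) : V × Fin r :=
  ((e x.1 x.2 : V), (e (e x.1 x.2)).symm ⟨x.1, (e x.1 x.2).2.symm⟩)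

lemma ofNum_eq {G : SimpleGraph V} (e : ∀ v, Fin r ≃ G.neighborSet v) {x y : V × Fin r}
    (h1 : (e x.1 x.2 : V) = y.1) (h2 : (e y.1 y.2 : V) = x.1) : ofNum e x = y := by
  obtain ⟨w, j⟩ := y
  simp only at h1 h2
  subst h1
  refine Prod.ext rfl ?_
  simp only [ofNum]
  rw [Equiv.symm_apply_eq]
  exact Subtype.ext h2.symm

lemma ofNum_invol {G : SimpleGraph V} (e : ∀ v, Fin r ≃ G.neighborSet v) (x : V × Fin r) :
    ofNum e (ofNum e x) = x := by
  apply ofNum_eq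
  · exact congrArg Subtype.val ((e (e x.1 x.2 : V)).apply_symm_apply _)
  · rfl

lemma ofNum_fst_ne {G : SimpleGraph V} (e : ∀ v, Fin r ≃ G.neighborSet v) (x : V × Fin r) :
    (ofNum e x).1 ≠ x.1 := (e x.1 x.2).2.ne'

lemma ofNum_fst_inj {G : SimpleGraph V} (e : ∀ v, Fin r ≃ G.neighborSet v) (x y : V × Fin r)
    (h : x.1 = y.1) (h2 : (ofNum e x).1 = (ofNum e y).1) : x = y := by
  obtain ⟨v, i⟩ := x
  obtain ⟨w, j⟩ := y
  simp only at h
  subst h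
  exact congrArg (Prod.mk v) ((e v).injective (Subtype.ext h2))

lemma toG_ofNum {G : SimpleGraph V} (e : ∀ v, Fin r ≃ G.neighborSet v) : toG (ofNum e) = G := by
  ext u v
  rw [toG_adj (ofNum_invol e) (ofNum_fst_ne e)]
  constructor
  · rintro ⟨i, rfl⟩
    exact (e u i).2
  · intro h
    exact ⟨(e u).symm ⟨v, h⟩, by simp [ofNum]⟩

lemma mem_invs_univ {M : V × Fin r → V × Fin r} :
    M ∈ invs univ ↔ (∀ x, M (M x) = x) ∧ ∀ x, M x ≠ x := by
  rw [mem_invs, eq_univ_iff_forall]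
  simp only [mem_mv]

open scoped Classical in
lemma card_fibre_toG {G : SimpleGraph V} (hG : ∀ v, (G.neighborSet v).ncard = r) :
    (((invs (univ : Finset (V × Fin r))).filter fun M => Smp M).filter fun M => toG M = G).card =
      r.factorial ^ Fintype.card V := by
  have hcard : ∀ v, Fintype.card (Fin r ≃ G.neighborSet v) = r.factorial := fun v => by
    have : Fintype.card (G.neighborSet v) = r := by
      rw [← Nat.card_eq_fintype_card, Nat.card_coe_set_eq, hG]
    rw [Fintype.card_equiv (Fintype.equivOfCardEq (by rw [this, Fintype.card_fin])), Fintype.card_fin]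
  have hpi : (univ : Finset (∀ v, Fin r ≃ G.neighborSet v)).card = r.factorial ^ Fintype.card V := by
    rw [card_univ, Fintype.card_pi]
    simp only [hcard, prod_const, card_univ]
  rw [← hpi]
  symm
  refine card_bij (fun e _ => ofNum e) (fun e _ => ?_) (fun e _ e' _ h => ?_) (fun M hM => ?_)
  · rw [mem_filter, mem_filter, mem_invs_univ]
    exact ⟨⟨⟨ofNum_invol e, fun x h => ofNum_fst_ne e x (by rw [h])⟩,
      smp_of_inj (ofNum_fst_ne e) (ofNum_fst_inj e)⟩, toG_ofNum e⟩
  · funext v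
    ext i
    exact congrArg Prod.fst (congrFun h (v, i))
  · rw [mem_filter, mem_filter, mem_invs_univ] at hM
    obtain ⟨⟨⟨h1, h2⟩, h3⟩, rfl⟩ := hM
    have hadj : ∀ v i, (toG M).Adj v (M (v, i)).1 := fun v i =>
      (toG_adj h1 (h3.fst_ne h1 h2)).2 ⟨i, rfl⟩
    refine ⟨fun v => Equiv.ofBijective (fun i => ⟨(M (v, i)).1, hadj v i⟩) ⟨?_, ?_⟩, mem_univ _, ?_⟩
    · intro i j h
      exact (Prod.ext_iff.1 (h3.fst_inj h1 h2 (a := (v, i)) (b := (v, j)) rfl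
        (congrArg Subtype.val h))).2
    · rintro ⟨w, hw⟩
      obtain ⟨i, rfl⟩ := (toG_adj h1 (h3.fst_ne h1 h2)).1 hw
      exact ⟨i, rfl⟩
    · funext x
      apply ofNum_eq
      · rfl
      · exact congrArg Prod.fst (h1 x)

open scoped Classical in
lemma card_smp_eq (P : SimpleGraph V → Prop) :
    ((invs (univ : Finset (V × Fin r))).filter fun M => Smp M ∧ P (toG M)).card =
      (univ.filter fun G : SimpleGraph V => (∀ v, (G.neighborSet v).ncard = r) ∧ P G).card *
        r.factorial ^ Fintype.card V := by
  rw [card_eq_sum_card_fiberwise (f := toG)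
    (t := univ.filter fun G : SimpleGraph V => (∀ v, (G.neighborSet v).ncard = r) ∧ P G),
    sum_const_nat fun G hG => ?_]
  · rw [mem_filter] at hG
    rw [← card_fibre_toG hG.2.1]
    congr 1
    ext M
    simp only [mem_filter]
    constructor
    · rintro ⟨⟨a, b, c⟩, d⟩; exact ⟨⟨a, b⟩, d⟩
    · rintro ⟨⟨a, b⟩, d⟩; exact ⟨⟨a, b, d ▸ hG.2.2⟩, d⟩
  · intro M hM
    simp only [coe_filter, Set.mem_ofPred_eq, mem_univ, true_and, mem_invs_univ] at hM ⊢
    obtain ⟨⟨h1, h2⟩, h3, h4⟩ := hM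
    exact ⟨toG_regular h1 (h3.fst_ne h1 h2) fun a b => h3.fst_inj h1 h2, h4⟩
end

lemma isHamiltonian_of_seq {n : ℕ} (hn : 3 ≤ n) {G : SimpleGraph (Fin n)} {w : ℕ → Fin n}
    (hper : ∀ i, w (i + n) = w i) (hadj : ∀ i, G.Adj (w i) (w (i + 1)))
    (hinj : ∀ i < n, ∀ j < n, w i = w j → i = j) : G.IsHamiltonian := by
  obtain ⟨m, rfl⟩ := Nat.exists_eq_add_of_le' hn
  have hsucc : ∀ u : Fin (m + 3), w (u + 1 : Fin (m + 3)).val = w (u.val + 1) := fun u => by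
    rw [Fin.val_add, Fin.val_one]
    exact (show Function.Periodic w (m + 3) from hper).map_mod_nat _
  let f : SimpleGraph.cycleGraph (m + 3) →g G :=
    { toFun := fun i => w i.val
      map_rel' := by
        intro u v huv
        rw [SimpleGraph.cycleGraph_adj] at huv
        rcases huv with h | h
        · rw [sub_eq_iff_eq_add'] at h
          rw [show w u.val = w (v.val + 1) by rw [h, hsucc]]
          exact (hadj _).symm
        · rw [sub_eq_iff_eq_add'] at h
          rw [h, hsucc]
          exact hadj _ }
  have hf : Bijective f := Finite.injective_iff_bijective.1 fun u v h =>
    Fin.ext (hinj _ u.2 _ v.2 h)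
  intro _
  refine ⟨_, (SimpleGraph.cycleGraph.cycle m).map f, SimpleGraph.Walk.IsHamiltonianCycle.map hf ?_⟩
  rw [SimpleGraph.Walk.isHamiltonianCycle_iff_isCycle_and_length_eq]
  exact ⟨SimpleGraph.cycleGraph.isCycle_cycle, by
    rw [SimpleGraph.cycleGraph.length_cycle, Fintype.card_fin]⟩

lemma isHamiltonian_toG {n r : ℕ} (hn : 3 ≤ n) {M : Fin n × Fin r → Fin n × Fin r}
    (hM : ∀ x, M (M x) = x) (hM' : ∀ x, M x ≠ x) (hs : Smp M) (hy : ycnt M ≠ 0) :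
    (toG M).IsHamiltonian := by
  obtain ⟨h, hh⟩ := card_ne_zero.1 hy
  rw [mem_filter, mem_ham] at hh
  obtain ⟨⟨hc, hfull⟩, hsub⟩ := hh
  have hmv := hc.two.mv_other
  obtain ⟨x0, hx0⟩ := hc.ne
  obtain ⟨k, x, hk, hk0, L⟩ := exists_labelling hc.two.other_invol hc.inv hmv.symm hc.conn x0
    (by rwa [hmv])
  have hkn : k = n := by
    rw [hmv, hfull.card, Fintype.card_fin] at hk
    omega
  subst hkn
  refine isHamiltonian_of_seq hn (w := fun i => (x i).1) (fun i => by simp only [L.per])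
    (fun i => ?_) fun i hi j hj hij => ?_
  · have h1 := L.mem i
    have h2 : other (mv h) (x i) ∈ mv h := by
      rw [hmv] at h1
      exact (hc.two.other_spec h1).1
    have h3 := hsub _ (mem_mv.1 h2)
    rw [L.step] at h3
    rw [toG_adj hM (hs.fst_ne hM hM')]
    refine ⟨(other (mv h) (x i)).2, ?_⟩
    rw [← h3]
    congr 2
    exact congrArg (·, (other (mv h) (x i)).2) (other_fst hc.two (x i)).symm
  · apply L.inj i hi j hj
    by_contra hne
    have hi' := L.mem i
    have hj' := L.mem j
    rw [hmv] at hi' hj'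
    exact L.disj j i (hc.two.other_eq hi' hj' hij.symm (Ne.symm hne)).symm

open Filter Topology
open scoped Classical in
theorem tendsto_regular_hamiltonian {s : ℕ} (hs : 1 ≤ s) :
    Tendsto (fun n : ℕ =>
      ((univ.filter fun G : SimpleGraph (Fin n) =>
        (∀ v, (G.neighborSet v).ncard = s + 2) ∧ G.IsHamiltonian).card : ℝ) /
      (univ.filter fun G : SimpleGraph (Fin n) =>
        ∀ v, (G.neighborSet v).ncard = s + 2).card) (flt s) (𝓝 1) := by
  have hbad := (tendsto_proportion hs).const_sub 1
  rw [sub_zero] at hbad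
  obtain ⟨c, hc, hsim⟩ := tendsto_simple hs
  have hge : ∀ᶠ n in flt s, 3 ≤ n := flt_le s (eventually_ge_atTop 3)
  refine tendsto_of_tendsto_of_tendsto_of_le_of_le' hbad tendsto_const_nhds ?_
    (Eventually.of_forall fun n => div_le_one_of_le₀ ?_ (by positivity))
  · filter_upwards [hge, hsim.eventually_const_lt hc] with n hn hpos
    have hK : (0 : ℝ) < ((s + 2).factorial ^ n : ℕ) := by positivity
    have e1 := card_smp_eq (V := Fin n) (r := s + 2) fun _ => True
    have e2 := card_smp_eq (V := Fin n) (r := s + 2) fun G => ¬ G.IsHamiltonian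
    simp only [and_true, Fintype.card_fin] at e1 e2
    have e3 := card_filter_add_card_filter_not (s := univ.filter fun G : SimpleGraph (Fin n) =>
      ∀ v, (G.neighborSet v).ncard = s + 2) fun G => G.IsHamiltonian
    rw [filter_filter, filter_filter] at e3
    have e4 : ((invs (univ : Finset (Fin n × Fin (s + 2)))).filter
        fun M => Smp M ∧ ¬ (toG M).IsHamiltonian).card ≤
        ((invs (univ : Finset (Fin n × Fin (s + 2)))).filter fun M => Smp M ∧ ycnt M = 0).card := by
      refine card_le_card fun M hM => ?_
      rw [mem_filter] at hM ⊢
      refine ⟨hM.1, hM.2.1, ?_⟩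
      by_contra hy
      obtain ⟨h1, h2⟩ := mem_invs_univ.1 hM.1
      exact hM.2.2 (isHamiltonian_toG hn h1 h2 hM.2.1 hy)
    have e5 : 0 < ((invs (univ : Finset (Fin n × Fin (s + 2)))).filter fun M => Smp M).card := by
      rw [card_pos]
      by_contra h
      rw [not_nonempty_iff_eq_empty] at h
      rw [h, sum_empty] at hpos
      exact lt_irrefl _ hpos
    set A := (univ.filter fun G : SimpleGraph (Fin n) => ∀ v, (G.neighborSet v).ncard = s + 2).card
      with hAdef
    set B := (univ.filter fun G : SimpleGraph (Fin n) =>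
      (∀ v, (G.neighborSet v).ncard = s + 2) ∧ ¬ G.IsHamiltonian).card with hBdef
    set H := (univ.filter fun G : SimpleGraph (Fin n) =>
      (∀ v, (G.neighborSet v).ncard = s + 2) ∧ G.IsHamiltonian).card with hHdef
    have f1 : H + B = A := by
      rw [← e3, hHdef, hBdef]
    have f2 : B * (s + 2).factorial ^ n ≤ ((invs (univ : Finset (Fin n × Fin (s + 2)))).filter
        fun M => Smp M ∧ ycnt M = 0).card := by
      refine le_of_eq_of_le ?_ e4
      rw [hBdef]
      convert e2.symm
    have f3 : ((invs (univ : Finset (Fin n × Fin (s + 2)))).filter fun M => Smp M).card =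
        A * (s + 2).factorial ^ n := by
      rw [e1, hAdef]
    rw [f3] at e5 ⊢
    have hA : (0 : ℝ) < A := by exact_mod_cast Nat.pos_of_mul_pos_right e5
    have f4 : (H : ℝ) = A - B := by rw [← f1]; push_cast; ring
    have f5 : (B : ℝ) / A = (B * (s + 2).factorial ^ n : ℕ) / (A * (s + 2).factorial ^ n : ℕ) := by
      push_cast
      field_simp
    rw [f4, sub_div, div_self hA.ne', f5]
    gcongr
  · exact_mod_cast card_le_card fun G hG => by
      rw [mem_filter] at hG ⊢
      exact ⟨hG.1, hG.2.1⟩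

end

end RegHam

/-- For each fixed integer `r ≥ 3`, almost all `r`-regular graphs are Hamiltonian,
as `n → ∞` along those `n` with `r * n` even and `n ≥ r + 1`. -/
theorem almost_all_regular_graphs_hamiltonian (r : ℕ) (hr : 3 ≤ r) :
    Filter.Tendsto
      (fun n => regularProportion r n (fun G => G.IsHamiltonian))
      (Filter.atTop ⊓ Filter.principal {n : ℕ | Even (r * n) ∧ r + 1 ≤ n}) (nhds 1) := by
  obtain ⟨s, rfl⟩ := Nat.exists_eq_add_of_le' (show 2 ≤ r by omega)
  refine (RegHam.tendsto_regular_hamiltonian (s := s) (by omega)).congr (fun n => ?_) |>.mono_left ?_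
  · unfold regularProportion
    congr!
  · rw [← RegHam.flt_add_two]
    exact inf_le_inf_left _ (Filter.principal_mono.2 fun n hn => hn.1)
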